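/- arXiv:0909.5175 — 2 statements merged into one kernel-verified Lean document; each statement's English description precedes it below -/
import Mathlib

section
/- For every integer d ≥ 1 there exist constants c_d ∈ N, Δ_d ∈ N, and α_d ∈ (0,1) such that the following holds for every ε ∈ (0,1). Let P be a multilinear polynomial of degree at most d on n variables with variables ordered so that w_1(P) ≥ … ≥ w_n(P), let θ ∈ R, let f(x) = sign(P(x) − θ), and let M = min( K(P,ε), c_d · log(1/ε)/ε² ). Then for X^M = (X_1,…,X_M) uniform on {-1,1}^M, with probability at least α_d the restricted function f_{X^M}(X_{M+1},…,X_n) = sign(P(X_1,…,X_M,X_{M+1},…,X_n) − θ) satisfies NS_ε(f_{X^M}) ≤ Δ_d · ε^{1/(2d+2)}. -/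
open Finset MeasureTheory ProbabilityTheory
open scoped Classical

noncomputable section

/-- The ±1 real value of a Boolean bit (`true ↦ 1`, `false ↦ -1`). -/
def pmOne (b : Bool) : ℝ := if b then 1 else -1

/-- Noise sensitivity at rate `δ` of a Boolean function on the hypercube `{-1,1}^n`:
`Pr[f(X) ≠ f(Z)]` where `X` is uniform and `Z` flips each coordinate of `X`
independently with probability `δ`. -/
def noiseSens {n : ℕ} (δ : ℝ) (f : (Fin n → Bool) → Bool) : ℝ :=
  (1 / 2 ^ n : ℝ) * ∑ x : Fin n → Bool, ∑ s : Fin n → Bool,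
    (∏ i, if s i then δ else 1 - δ) * (if f x ≠ f (fun i => xor (s i) (x i)) then 1 else 0)

/-- Influence of the `i`-th variable: `Pr[f(X) ≠ f(X^{(i)})]`. -/
def influence {n : ℕ} (f : (Fin n → Bool) → Bool) (i : Fin n) : ℝ :=
  (1 / 2 ^ n : ℝ) * ∑ x : Fin n → Bool,
    if f x ≠ f (Function.update x i (!x i)) then 1 else 0

/-- Average sensitivity (total influence). -/
def avgSens {n : ℕ} (f : (Fin n → Bool) → Bool) : ℝ := ∑ i, influence f i

/-- `f` is a degree-`d` polynomial threshold function: `f = sign(P)` for some real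
polynomial of total degree at most `d`, with the convention `sign 0 = 1`. -/
def IsPTF {n : ℕ} (d : ℕ) (f : (Fin n → Bool) → Bool) : Prop :=
  ∃ P : MvPolynomial (Fin n) ℝ, P.totalDegree ≤ d ∧
    ∀ x, (f x = true ↔ 0 ≤ MvPolynomial.eval (fun i => pmOne (x i)) P)

/-- Evaluation of the multilinear polynomial with coefficients `a` at the point `x`. -/
def mlEval {n : ℕ} (a : Finset (Fin n) → ℝ) (x : Fin n → ℝ) : ℝ :=
  ∑ I : Finset (Fin n), a I * ∏ i ∈ I, x i

/-- The multilinear polynomial with coefficients `a` has degree at most `d`. -/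
def DegLE {n : ℕ} (a : Finset (Fin n) → ℝ) (d : ℕ) : Prop :=
  ∀ I, a I ≠ 0 → I.card ≤ d

/-- Squared weight `w_i²` of coordinate `i`: `Σ_{I ∋ i} a_I²`. -/
def wsq {n : ℕ} (a : Finset (Fin n) → ℝ) (i : Fin n) : ℝ :=
  ∑ I ∈ univ.filter (fun I : Finset (Fin n) => i ∈ I), a I ^ 2

/-- `ε`-regularity: `Σ_i w_i⁴ ≤ ε² (Σ_i w_i²)²`. -/
def Regular {n : ℕ} (a : Finset (Fin n) → ℝ) (ε : ℝ) : Prop :=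
  ∑ i, wsq a i ^ 2 ≤ ε ^ 2 * (∑ i, wsq a i) ^ 2

/-- `σ_{k+1}²(P) = Σ_{j ≥ k (0-based)} w_j²` (tail weight, `k` restricted variables). -/
def sigmaSq {n : ℕ} (a : Finset (Fin n) → ℝ) (k : ℕ) : ℝ :=
  ∑ j ∈ univ.filter (fun j : Fin n => k ≤ (j : ℕ)), wsq a j

/-- The variables are ordered by decreasing weight. -/
def OrderedWeights {n : ℕ} (a : Finset (Fin n) → ℝ) : Prop :=
  ∀ i j : Fin n, i ≤ j → wsq a j ≤ wsq a i

/-- The `ε`-critical index `K(P,ε)`: least `k` such that `w_j² ≤ ε² σ_{k+1}²` for all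
`j` beyond the first `k` variables. -/
def critIndex {n : ℕ} (a : Finset (Fin n) → ℝ) (ε : ℝ) : ℕ :=
  sInf {k : ℕ | ∀ j : Fin n, k ≤ (j : ℕ) → wsq a j ≤ ε ^ 2 * sigmaSq a k}

/-- Coefficients (in the variables `Y_j`, `j ≥ K`) of the restriction of the multilinear
polynomial `a` obtained by fixing the first `K` variables to `x`. -/
def restCoeff {n : ℕ} (a : Finset (Fin n) → ℝ) (K : ℕ) (x : Fin n → ℝ)
    (J : Finset (Fin n)) : ℝ :=
  if ∀ j ∈ J, K ≤ (j : ℕ) then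
    ∑ I ∈ univ.filter (fun I : Finset (Fin n) => I.filter (fun i => K ≤ i.val) = J),
      a I * ∏ i ∈ I.filter (fun i => i.val < K), x i
  else 0

/-- Standard Gaussian measure on `ℝ^n`. -/
def gaussn (n : ℕ) : Measure (Fin n → ℝ) := Measure.pi fun _ => gaussianReal 0 1

/-- Gaussian noise sensitivity: `Pr[f(X) ≠ f((1-δ)X + √(2δ-δ²)Y)]` for independent
standard Gaussian vectors `X, Y`. -/
def gns (n : ℕ) (δ : ℝ) (f : (Fin n → ℝ) → ℝ) : ℝ :=
  (((gaussn n).prod (gaussn n))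
    {p | f p.1 ≠ f (fun i => (1 - δ) * p.1 i + Real.sqrt (2 * δ - δ ^ 2) * p.2 i)}).toReal

/-- Normalized probabilists' Hermite polynomial `H_k(x)`. -/
def normHermite (k : ℕ) (x : ℝ) : ℝ :=
  Polynomial.aeval x (Polynomial.hermite k) / Real.sqrt (Nat.factorial k)

/-- Probability laws on `ℝ` with finite moments whose first three moments agree with those of a
Rademacher variable and whose fourth moment is at most `9`. -/
class MomentLaw (ν : Measure ℝ) : Prop extends IsProbabilityMeasure ν where
  int : ∀ k : ℕ, Integrable (fun x : ℝ => x ^ k) ν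
  m1 : ∫ x, x ∂ν = 0
  m2 : ∫ x, x ^ 2 ∂ν = 1
  m3 : ∫ x, x ^ 3 ∂ν = 0
  m4 : ∫ x, x ^ 4 ∂ν ≤ 9

/-- `mlEval a` as a polynomial. -/
def mlPoly {n : ℕ} (a : Finset (Fin n) → ℝ) : MvPolynomial (Fin n) ℝ :=
  ∑ I : Finset (Fin n), MvPolynomial.C (a I) * ∏ i ∈ I, MvPolynomial.X i

lemma eval_mlPoly {n : ℕ} (a : Finset (Fin n) → ℝ) (x : Fin n → ℝ) :
    MvPolynomial.eval x (mlPoly a) = mlEval a x := by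
  simp [mlPoly, mlEval, map_sum, map_prod]

lemma continuous_mlEval {n : ℕ} (a : Finset (Fin n) → ℝ) : Continuous (mlEval a) := by
  unfold mlEval; fun_prop

lemma measurable_mlEval {n : ℕ} (a : Finset (Fin n) → ℝ) : Measurable (mlEval a) :=
  (continuous_mlEval a).measurable

lemma integrable_eval_pi {n : ℕ} (μ : Fin n → Measure ℝ) [∀ i, MomentLaw (μ i)]
    (Q : MvPolynomial (Fin n) ℝ) :
    Integrable (fun x => MvPolynomial.eval x Q) (Measure.pi μ) := by
  simp only [MvPolynomial.eval_eq']
  refine integrable_finsetSum _ fun m _ => Integrable.const_mul ?_ _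
  exact Integrable.fintype_prod (f := fun i (y : ℝ) => y ^ m i) fun i => MomentLaw.int (m i)

lemma measurable_update_pair {n : ℕ} (k : Fin n) :
    Measurable (fun p : (Fin n → ℝ) × ℝ => Function.update p.1 k p.2) := by
  refine measurable_pi_lambda _ fun i => ?_
  by_cases h : i = k
  · subst h; simpa using measurable_snd
  · simp only [Function.update_of_ne h]
    exact (measurable_pi_apply i).comp measurable_fst

lemma map_update_pi {n : ℕ} (μ : Fin n → Measure ℝ) [∀ i, IsProbabilityMeasure (μ i)]
    (k : Fin n) (ν : Measure ℝ) [IsProbabilityMeasure ν] :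
    ((Measure.pi μ).prod ν).map (fun p => Function.update p.1 k p.2)
      = Measure.pi (Function.update μ k ν) := by
  have hm := measurable_update_pair k
  have : ∀ i, IsProbabilityMeasure (Function.update μ k ν i) := by
    intro i
    by_cases h : i = k
    · subst h; simpa
    · simpa [Function.update_of_ne h] using inferInstanceAs (IsProbabilityMeasure (μ i))
  symm
  refine Measure.pi_eq fun s hs => ?_
  rw [Measure.map_apply hm (MeasurableSet.univ_pi hs)]
  have : (fun p : (Fin n → ℝ) × ℝ => Function.update p.1 k p.2) ⁻¹' (Set.univ.pi s)
      = (Set.univ.pi (Function.update s k Set.univ)) ×ˢ s k := by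
    ext ⟨x, t⟩
    simp only [Set.mem_preimage, Set.mem_pi, Set.mem_univ, true_implies, Set.mem_prod]
    constructor
    · intro h
      refine ⟨fun i => ?_, by simpa using h k⟩
      by_cases hi : i = k
      · subst hi; simp
      · simpa [Function.update_of_ne hi] using h i
    · rintro ⟨h, ht⟩ i
      by_cases hi : i = k
      · subst hi; simpa
      · simpa [Function.update_of_ne hi] using h i
  rw [this, Measure.prod_prod, Measure.pi_pi, ← Finset.mul_prod_erase _ _ (Finset.mem_univ k),
    ← Finset.mul_prod_erase _ (fun i => (Function.update μ k ν i) (s i)) (Finset.mem_univ k)]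
  simp only [Function.update_self, measure_univ, one_mul]
  rw [mul_comm]
  congr 1
  refine Finset.prod_congr rfl fun i hi => ?_
  have hi := Finset.ne_of_mem_erase hi
  simp [Function.update_of_ne hi]

lemma integral_pi_update {n : ℕ} (μ : Fin n → Measure ℝ) [∀ i, IsProbabilityMeasure (μ i)]
    (k : Fin n) (ν : Measure ℝ) [IsProbabilityMeasure ν] {f : (Fin n → ℝ) → ℝ}
    (hf : Integrable f (Measure.pi (Function.update μ k ν))) :
    ∫ x, f x ∂Measure.pi (Function.update μ k ν)
      = ∫ x, ∫ s, f (Function.update x k s) ∂ν ∂Measure.pi μ := by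
  have hm := measurable_update_pair k
  rw [← map_update_pi] at hf ⊢
  rw [integral_map hm.aemeasurable hf.1, integral_prod]
  exact (integrable_map_measure hf.1 hm.aemeasurable).1 hf

lemma integral_pi_pow_mul {n : ℕ} (μ : Fin n → Measure ℝ) [∀ i, IsProbabilityMeasure (μ i)]
    (k : Fin n) (j : ℕ) {h : (Fin n → ℝ) → ℝ} (hk : ∀ x s, h (Function.update x k s) = h x)
    (hf : Integrable (fun x => x k ^ j * h x) (Measure.pi μ)) :
    ∫ x, x k ^ j * h x ∂Measure.pi μ = (∫ s, s ^ j ∂μ k) * ∫ x, h x ∂Measure.pi μ := by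
  have := integral_pi_update μ k (μ k) (f := fun x => x k ^ j * h x)
  rw [Function.update_eq_self] at this
  rw [this hf]
  simp [hk, integral_mul_const, integral_const_mul]

/-- The part of a coefficient family not involving the variable `k`. -/
def coefOff {n : ℕ} (a : Finset (Fin n) → ℝ) (k : Fin n) (J : Finset (Fin n)) : ℝ :=
  if k ∈ J then 0 else a J

/-- The coefficients of the partial derivative in the variable `k`. -/
def coefDeriv {n : ℕ} (a : Finset (Fin n) → ℝ) (k : Fin n) (J : Finset (Fin n)) : ℝ :=
  if k ∈ J then 0 else a (insert k J)

lemma sum_split {n : ℕ} (k : Fin n) (F : Finset (Fin n) → ℝ) :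
    ∑ I, F I = ∑ I, (if k ∈ I then 0 else F I) + ∑ I, (if k ∈ I then 0 else F (insert k I)) := by
  have h1 : ∑ I, F I = ∑ I, (if k ∈ I then 0 else F I) + ∑ I, (if k ∈ I then F I else 0) := by
    rw [← Finset.sum_add_distrib]
    refine Finset.sum_congr rfl fun I _ => ?_
    split_ifs <;> simp
  rw [h1]
  congr 1
  have e1 : ∑ I, (if k ∈ I then F I else 0) = ∑ I ∈ univ.filter (fun I => k ∈ I), F I := by
    rw [Finset.sum_filter]
  have e2 : ∑ I, (if k ∈ I then 0 else F (insert k I))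
      = ∑ I ∈ univ.filter (fun I => k ∉ I), F (insert k I) := by
    rw [Finset.sum_filter]
    refine Finset.sum_congr rfl fun I _ => ?_
    by_cases h : k ∈ I <;> simp [h]
  rw [e1, e2]
  refine Finset.sum_bij' (fun I _ => I.erase k) (fun I _ => insert k I) ?_ ?_ ?_ ?_ ?_
  · intro I hI; simp
  · intro I hI; simp
  · intro I hI; simp at hI; simp [Finset.insert_erase hI]
  · intro I hI; simp at hI; simp [Finset.erase_insert hI]
  · intro I hI; simp at hI; simp [Finset.insert_erase hI]

lemma mlEval_split {n : ℕ} (a : Finset (Fin n) → ℝ) (k : Fin n) (x : Fin n → ℝ) :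
    mlEval a x = mlEval (coefOff a k) x + x k * mlEval (coefDeriv a k) x := by
  unfold mlEval coefOff coefDeriv
  rw [sum_split k, Finset.mul_sum]
  congr 1
  · refine Finset.sum_congr rfl fun I _ => ?_
    split_ifs <;> simp
  · refine Finset.sum_congr rfl fun I _ => ?_
    split_ifs with h
    · simp
    · rw [Finset.prod_insert h]; ring

lemma mlEval_update_of_forall {n : ℕ} {a : Finset (Fin n) → ℝ} {k : Fin n}
    (h : ∀ I, k ∈ I → a I = 0) (x : Fin n → ℝ) (s : ℝ) :
    mlEval a (Function.update x k s) = mlEval a x := by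
  unfold mlEval
  refine Finset.sum_congr rfl fun I _ => ?_
  by_cases hI : k ∈ I
  · simp [h I hI]
  · congr 1
    refine Finset.prod_congr rfl fun i hi => ?_
    rw [Function.update_of_ne]
    rintro rfl; exact hI hi

lemma mlEval_coefOff_update {n : ℕ} (a : Finset (Fin n) → ℝ) (k : Fin n) (x : Fin n → ℝ)
    (s : ℝ) : mlEval (coefOff a k) (Function.update x k s) = mlEval (coefOff a k) x :=
  mlEval_update_of_forall (fun I hI => by simp [coefOff, hI]) x s

lemma mlEval_coefDeriv_update {n : ℕ} (a : Finset (Fin n) → ℝ) (k : Fin n) (x : Fin n → ℝ)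
    (s : ℝ) : mlEval (coefDeriv a k) (Function.update x k s) = mlEval (coefDeriv a k) x :=
  mlEval_update_of_forall (fun I hI => by simp [coefDeriv, hI]) x s

lemma sum_sq_split {n : ℕ} (a : Finset (Fin n) → ℝ) (k : Fin n) :
    ∑ I, a I ^ 2 = ∑ I, coefOff a k I ^ 2 + ∑ I, coefDeriv a k I ^ 2 := by
  rw [sum_split k]
  congr 1 <;>
  · refine Finset.sum_congr rfl fun I _ => ?_
    simp only [coefOff, coefDeriv]
    split_ifs <;> simp

lemma sum_sq_coefDeriv {n : ℕ} (a : Finset (Fin n) → ℝ) (k : Fin n) :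
    ∑ I, coefDeriv a k I ^ 2 = wsq a k := by
  have h := sum_sq_split a k
  have h2 : ∑ I, a I ^ 2 = wsq a k + ∑ I, coefOff a k I ^ 2 := by
    rw [wsq, Finset.sum_filter, ← Finset.sum_add_distrib]
    refine Finset.sum_congr rfl fun I _ => ?_
    simp only [coefOff]
    split_ifs <;> simp
  linarith

lemma DegLE.coefOff {n : ℕ} {a : Finset (Fin n) → ℝ} {d : ℕ} (h : DegLE a d) (k : Fin n) :
    DegLE (coefOff a k) d := by
  intro I hI
  simp only [_root_.coefOff] at hI
  split_ifs at hI with hk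
  · simp at hI
  · exact h I hI

lemma DegLE.coefDeriv {n : ℕ} {a : Finset (Fin n) → ℝ} {d : ℕ} (h : DegLE a (d + 1))
    (k : Fin n) : DegLE (coefDeriv a k) d := by
  intro I hI
  simp only [_root_.coefDeriv] at hI
  split_ifs at hI with hk
  · simp at hI
  · have := h _ hI
    rw [Finset.card_insert_of_notMem hk] at this
    omega

lemma integral_prod_mul_prod {n : ℕ} (μ : Fin n → Measure ℝ) [∀ i, MomentLaw (μ i)]
    (I J : Finset (Fin n)) :
    ∫ x, (∏ i ∈ I, x i) * ∏ i ∈ J, x i ∂Measure.pi μ = if I = J then 1 else 0 := by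
  have h : ∀ x : Fin n → ℝ, (∏ i ∈ I, x i) * ∏ i ∈ J, x i
      = ∏ i, (if i ∈ I then x i else 1) * (if i ∈ J then x i else 1) := by
    intro x
    rw [Finset.prod_mul_distrib, Finset.prod_ite_mem, Finset.prod_ite_mem]
    simp
  simp_rw [h]
  rw [integral_fintype_prod_eq_prod (𝕜 := ℝ)
    (fun i (y : ℝ) => (if i ∈ I then y else 1) * (if i ∈ J then y else 1))]
  by_cases hIJ : I = J
  · subst hIJ
    simp only [if_true]
    refine Finset.prod_eq_one fun i _ => ?_
    by_cases hi : i ∈ I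
    · simp only [hi, if_true]
      simpa [sq] using MomentLaw.m2 (ν := μ i)
    · simp [hi]
  · simp only [hIJ, if_false]
    have : ∃ i, ¬ (i ∈ I ↔ i ∈ J) := by
      by_contra hc
      push Not at hc
      exact hIJ (Finset.ext hc)
    obtain ⟨i, hi⟩ := this
    refine Finset.prod_eq_zero (Finset.mem_univ i) ?_
    by_cases h1 : i ∈ I <;> by_cases h2 : i ∈ J <;> simp [h1, h2] at hi ⊢
    all_goals exact MomentLaw.m1

lemma integrable_mlEval_pow {n : ℕ} (μ : Fin n → Measure ℝ) [∀ i, MomentLaw (μ i)]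
    (a : Finset (Fin n) → ℝ) (m : ℕ) :
    Integrable (fun x => mlEval a x ^ m) (Measure.pi μ) := by
  convert integrable_eval_pi μ (mlPoly a ^ m) using 2
  simp [eval_mlPoly]

lemma integral_mlEval_sq {n : ℕ} (μ : Fin n → Measure ℝ) [∀ i, MomentLaw (μ i)]
    (a : Finset (Fin n) → ℝ) : ∫ x, mlEval a x ^ 2 ∂Measure.pi μ = ∑ I, a I ^ 2 := by
  have h : ∀ x : Fin n → ℝ, mlEval a x ^ 2
      = ∑ I, ∑ J, a I * a J * ((∏ i ∈ I, x i) * ∏ i ∈ J, x i) := by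
    intro x
    rw [sq, mlEval, Finset.sum_mul_sum]
    refine Finset.sum_congr rfl fun I _ => Finset.sum_congr rfl fun J _ => by ring
  simp_rw [h]
  have hInt : ∀ I J : Finset (Fin n),
      Integrable (fun x : Fin n → ℝ => a I * a J * ((∏ i ∈ I, x i) * ∏ i ∈ J, x i))
        (Measure.pi μ) := by
    intro I J
    refine Integrable.const_mul ?_ _
    convert integrable_eval_pi μ ((∏ i ∈ I, MvPolynomial.X i) * ∏ i ∈ J, MvPolynomial.X i) using 2
    simp [map_prod]
  rw [integral_finsetSum _ fun I _ => integrable_finsetSum _ fun J _ => hInt I J]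
  refine Finset.sum_congr rfl fun I _ => ?_
  rw [integral_finsetSum _ fun J _ => hInt I J]
  simp_rw [integral_const_mul, integral_prod_mul_prod]
  simp [sq]

lemma sq_integral_mul_le {Ω : Type*} [MeasurableSpace Ω] {μ : Measure Ω} {f g : Ω → ℝ}
    (hf : Integrable (fun x => f x ^ 2) μ) (hg : Integrable (fun x => g x ^ 2) μ)
    (hfg : Integrable (fun x => f x * g x) μ) :
    (∫ x, f x * g x ∂μ) ^ 2 ≤ (∫ x, f x ^ 2 ∂μ) * ∫ x, g x ^ 2 ∂μ := by
  have key : ∀ t : ℝ, 0 ≤ (∫ x, f x ^ 2 ∂μ) * (t * t) + (2 * ∫ x, f x * g x ∂μ) * t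
      + ∫ x, g x ^ 2 ∂μ := by
    intro t
    have h : 0 ≤ ∫ x, (t * f x + g x) ^ 2 ∂μ := integral_nonneg fun x => sq_nonneg _
    have e : ∀ x, (t * f x + g x) ^ 2 = (t * t) * f x ^ 2 + (2 * t) * (f x * g x) + g x ^ 2 := by
      intro x; ring
    simp_rw [e] at h
    rw [integral_add (by exact (hf.const_mul _).add (hfg.const_mul _)) hg,
      integral_add (hf.const_mul _) (hfg.const_mul _), integral_const_mul, integral_const_mul] at h
    linarith
  have := discrim_le_zero key
  unfold discrim at this
  nlinarith

lemma coef_zero_of_degLE_zero {n : ℕ} {a : Finset (Fin n) → ℝ} (h : DegLE a 0)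
    (k : Fin n) : coefDeriv a k = 0 := by
  ext J
  simp only [coefDeriv, Pi.zero_apply, ite_eq_left_iff]
  intro hk
  by_contra hne
  have := h _ hne
  simp at this

lemma hypercontractive_aux {n : ℕ} (μ : Fin n → Measure ℝ) [∀ i, MomentLaw (μ i)]
    (S : Finset (Fin n)) : ∀ (d : ℕ) (a : Finset (Fin n) → ℝ), DegLE a d →
      (∀ I, a I ≠ 0 → I ⊆ S) →
      ∫ x, mlEval a x ^ 4 ∂Measure.pi μ ≤ 9 ^ d * (∑ I, a I ^ 2) ^ 2 := by
  induction S using Finset.induction_on with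
  | empty =>
    intro d a _ ha
    have h0 : ∀ I, I ≠ ∅ → a I = 0 := by
      intro I hI
      by_contra h
      exact hI (Finset.subset_empty.1 (ha I h))
    have e1 : ∀ x : Fin n → ℝ, mlEval a x = a ∅ := by
      intro x
      rw [mlEval, Finset.sum_eq_single ∅]
      · simp
      · intro I _ hI; simp [h0 I hI]
      · simp
    have e2 : ∑ I, a I ^ 2 = a ∅ ^ 2 := by
      rw [Finset.sum_eq_single ∅]
      · intro I _ hI; simp [h0 I hI]
      · simp
    simp only [e1, e2, integral_const, probReal_univ, smul_eq_mul, one_mul]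
    have : (1 : ℝ) ≤ 9 ^ d := one_le_pow₀ (by norm_num)
    nlinarith [sq_nonneg (a ∅ ^ 2)]
  | insert k S hk ih =>
    intro d a hd ha
    set q := coefOff a k with hq
    set r := coefDeriv a k with hr
    have hqS : ∀ I, q I ≠ 0 → I ⊆ S := by
      intro I hI
      simp only [hq, coefOff] at hI
      split_ifs at hI with h
      · simp at hI
      · exact (Finset.subset_insert_iff_of_notMem h).1 (ha I hI)
    have hrS : ∀ I, r I ≠ 0 → I ⊆ S := by
      intro I hI
      simp only [hr, coefDeriv] at hI
      split_ifs at hI with h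
      · simp at hI
      · have := ha _ hI
        intro i hi
        have h2 := this (Finset.mem_insert_of_mem hi)
        rcases Finset.mem_insert.1 h2 with rfl | h3
        · exact absurd hi h
        · exact h3
    have hQ := ih d q (hd.coefOff k) hqS
    have hsq := sum_sq_split a k
    rw [← hq, ← hr] at hsq
    have int : ∀ i j l : ℕ, Integrable
        (fun x : Fin n → ℝ => x k ^ i * (mlEval q x ^ j * mlEval r x ^ l)) (Measure.pi μ) := by
      intro i j l
      convert integrable_eval_pi μ (MvPolynomial.X k ^ i * (mlPoly q ^ j * mlPoly r ^ l)) using 2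
      simp [eval_mlPoly]
    have fac : ∀ i j l : ℕ, ∫ x : Fin n → ℝ, x k ^ i * (mlEval q x ^ j * mlEval r x ^ l)
        ∂(Measure.pi μ) = (∫ s, s ^ i ∂μ k) *
          ∫ x, mlEval q x ^ j * mlEval r x ^ l ∂(Measure.pi μ) := by
      intro i j l
      refine integral_pi_pow_mul μ k i (fun x s => ?_) (int i j l)
      rw [hq, hr, mlEval_coefOff_update, mlEval_coefDeriv_update]
    have expand : ∀ x : Fin n → ℝ, mlEval a x ^ 4 = mlEval q x ^ 4
        + 4 * (x k ^ 1 * (mlEval q x ^ 3 * mlEval r x ^ 1))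
        + 6 * (x k ^ 2 * (mlEval q x ^ 2 * mlEval r x ^ 2))
        + 4 * (x k ^ 3 * (mlEval q x ^ 1 * mlEval r x ^ 3))
        + x k ^ 4 * (mlEval q x ^ 0 * mlEval r x ^ 4) := by
      intro x
      rw [mlEval_split a k x]; ring
    have total : ∫ x, mlEval a x ^ 4 ∂Measure.pi μ = ∫ x, mlEval q x ^ 4 ∂Measure.pi μ
        + 6 * ∫ x, mlEval q x ^ 2 * mlEval r x ^ 2 ∂Measure.pi μ
        + (∫ s, s ^ 4 ∂μ k) * ∫ x, mlEval r x ^ 4 ∂Measure.pi μ := by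
      simp_rw [expand]
      have i0 := integrable_mlEval_pow μ q 4
      have i1 := (int 1 3 1).const_mul 4
      have i2 := (int 2 2 2).const_mul 6
      have i3 := (int 3 1 3).const_mul 4
      have i4 := int 4 0 4
      rw [integral_add (by exact ((i0.add i1).add i2).add i3) i4,
        integral_add (by exact (i0.add i1).add i2) i3, integral_add (by exact i0.add i1) i2, integral_add i0 i1]
      simp only [integral_const_mul, fac]
      have m1 : ∫ s, s ^ 1 ∂μ k = 0 := by simpa using MomentLaw.m1 (ν := μ k)
      rw [m1, MomentLaw.m2 (ν := μ k), MomentLaw.m3 (ν := μ k)]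
      simp
    rcases d with _ | d
    · have hr0 : r = 0 := coef_zero_of_degLE_zero hd k
      have hr1 : ∀ x, mlEval r x = 0 := by intro x; simp [hr0, mlEval]
      have hr2 : ∑ I, r I ^ 2 = 0 := by simp [hr0]
      rw [total, hsq, hr2]
      simpa [hr1] using hQ
    · have hR := ih d r (hd.coefDeriv k) hrS
      have cs := sq_integral_mul_le (μ := Measure.pi μ) (f := fun x => mlEval q x ^ 2)
        (g := fun x => mlEval r x ^ 2)
        (by simpa [← pow_mul] using integrable_mlEval_pow μ q 4)
        (by simpa [← pow_mul] using integrable_mlEval_pow μ r 4)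
        (by simpa using int 0 2 2)
      simp only [← pow_mul] at cs
      norm_num at cs
      have hm4 := MomentLaw.m4 (ν := μ k)
      have hq4 : 0 ≤ ∫ x, mlEval q x ^ 4 ∂Measure.pi μ := integral_nonneg fun x => by positivity
      have hr4 : 0 ≤ ∫ x, mlEval r x ^ 4 ∂Measure.pi μ := integral_nonneg fun x => by positivity
      have hqr : 0 ≤ ∫ x, mlEval q x ^ 2 * mlEval r x ^ 2 ∂Measure.pi μ :=
        integral_nonneg fun x => by positivity
      rw [total, hsq]
      set Q := ∑ I, q I ^ 2
      set R := ∑ I, r I ^ 2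
      have hQ0 : 0 ≤ Q := Finset.sum_nonneg fun I _ => sq_nonneg _
      have hR0 : 0 ≤ R := Finset.sum_nonneg fun I _ => sq_nonneg _
      set A := ∫ x, mlEval q x ^ 4 ∂Measure.pi μ
      set B := ∫ x, mlEval r x ^ 4 ∂Measure.pi μ
      set D := ∫ x, mlEval q x ^ 2 * mlEval r x ^ 2 ∂Measure.pi μ
      have hD : D ≤ 3 * 9 ^ d * (Q * R) := by
        refine le_of_sq_le_sq ?_ (by positivity)
        calc D ^ 2 ≤ A * B := cs
          _ ≤ (9 ^ (d + 1) * Q ^ 2) * (9 ^ d * R ^ 2) := by gcongr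
          _ = (3 * 9 ^ d * (Q * R)) ^ 2 := by rw [pow_succ]; ring
      have h4 : (∫ s, s ^ 4 ∂μ k) * B ≤ 9 * (9 ^ d * R ^ 2) := by gcongr
      calc A + 6 * D + (∫ s, s ^ 4 ∂μ k) * B
          ≤ 9 ^ (d + 1) * Q ^ 2 + 6 * (3 * 9 ^ d * (Q * R)) + 9 * (9 ^ d * R ^ 2) := by gcongr
        _ = 9 ^ (d + 1) * (Q + R) ^ 2 := by rw [pow_succ]; ring

/-- Degree-`d` multilinear polynomials satisfy a `(2, 4)`-hypercontractive inequality. -/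
lemma hypercontractive {n : ℕ} (μ : Fin n → Measure ℝ) [∀ i, MomentLaw (μ i)] {d : ℕ}
    {a : Finset (Fin n) → ℝ} (hd : DegLE a d) :
    ∫ x, mlEval a x ^ 4 ∂Measure.pi μ ≤ 9 ^ d * (∑ I, a I ^ 2) ^ 2 :=
  hypercontractive_aux μ univ d a hd fun I _ => Finset.subset_univ I

/-- The Rademacher law on `ℝ`. -/
def rad : Measure ℝ := ((PMF.uniformOfFintype Bool).toMeasure).map pmOne

lemma measurable_pmOne : Measurable pmOne := measurable_of_finite _

lemma uniformBool_real (b : Bool) : (PMF.uniformOfFintype Bool).toMeasure.real {b} = 1 / 2 := by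
  rw [Measure.real, PMF.toMeasure_apply_singleton _ _ (MeasurableSet.singleton b)]
  simp

lemma integral_rad (f : ℝ → ℝ) (hf : Measurable f) :
    ∫ x, f x ∂rad = (f 1 + f (-1)) / 2 := by
  rw [rad, integral_map measurable_pmOne.aemeasurable hf.aestronglyMeasurable,
    integral_fintype Integrable.of_finite]
  simp [uniformBool_real, pmOne]
  ring

instance : IsProbabilityMeasure rad :=
  Measure.isProbabilityMeasure_map measurable_pmOne.aemeasurable

instance : MomentLaw rad where
  int k := by
    rw [rad, integrable_map_measure (by fun_prop) measurable_pmOne.aemeasurable]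
    exact Integrable.of_finite
  m1 := by rw [integral_rad _ (by fun_prop)]; norm_num
  m2 := by rw [integral_rad _ (by fun_prop)]; norm_num
  m3 := by rw [integral_rad _ (by fun_prop)]; norm_num
  m4 := by rw [integral_rad _ (by fun_prop)]; norm_num

lemma pi_rad_eq (n : ℕ) : Measure.pi (fun _ : Fin n => rad)
    = (Measure.pi fun _ : Fin n => (PMF.uniformOfFintype Bool).toMeasure).map
        (fun x i => pmOne (x i)) := by
  exact (Measure.pi_map_pi (μ := fun _ : Fin n => (PMF.uniformOfFintype Bool).toMeasure)
    (f := fun _ => pmOne) fun _ => measurable_pmOne.aemeasurable).symm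

lemma measurable_pmOne_pi (n : ℕ) : Measurable fun (x : Fin n → Bool) i => pmOne (x i) :=
  measurable_of_finite _

lemma integral_pi_rad {n : ℕ} (f : (Fin n → ℝ) → ℝ) (hf : Measurable f) :
    ∫ x, f x ∂Measure.pi (fun _ : Fin n => rad)
      = (1 / 2 ^ n : ℝ) * ∑ x : Fin n → Bool, f (fun i => pmOne (x i)) := by
  rw [pi_rad_eq, integral_map (measurable_pmOne_pi n).aemeasurable hf.aestronglyMeasurable,
    integral_fintype Integrable.of_finite, Finset.mul_sum]
  refine Finset.sum_congr rfl fun x _ => ?_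
  have : (Measure.pi fun _ : Fin n => (PMF.uniformOfFintype Bool).toMeasure).real {x}
      = 1 / 2 ^ n := by
    rw [Measure.real, Measure.pi_singleton, ENNReal.toReal_prod]
    simp
  rw [this, smul_eq_mul]

lemma integrable_pow_gaussian (k : ℕ) : Integrable (fun x : ℝ => x ^ k) (gaussianReal 0 1) := by
  rcases Nat.eq_zero_or_pos k with rfl | hk
  · simp
  · have h := (memLp_id_gaussianReal (μ := 0) (v := 1) (k : NNReal)).integrable_norm_rpow
      (by simp; omega) (by simp)
    refine (integrable_norm_iff (by fun_prop)).1 ?_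
    simpa using h

lemma iteratedDeriv_exp_sq (k : ℕ) :
    iteratedDeriv k (fun t : ℝ => Real.exp (t ^ 2 / 2)) 0
      = ∫ x, x ^ k ∂gaussianReal 0 1 := by
  have h := iteratedDeriv_mgf_zero (X := (id : ℝ → ℝ)) (μ := gaussianReal 0 1)
    (by simp [integrableExpSet, integrable_exp_mul_gaussianReal]) k
  rw [mgf_id_gaussianReal] at h
  simpa using h

lemma deriv_mul_exp_sq (p p' : ℝ → ℝ) (hp : ∀ t, HasDerivAt p (p' t) t) :
    deriv (fun t => p t * Real.exp (t ^ 2 / 2))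
      = fun t => (p' t + t * p t) * Real.exp (t ^ 2 / 2) := by
  ext t
  have h : HasDerivAt (fun t : ℝ => t ^ 2 / 2) t t := by
    exact ((hasDerivAt_pow 2 t).div_const 2).congr_deriv (by simp)
  have := ((hp t).mul h.exp).deriv
  simp only [Pi.mul_def] at this
  rw [this]; ring

lemma gaussian_moments : ∫ x, x ^ 3 ∂gaussianReal 0 1 = 0 ∧ ∫ x, x ^ 4 ∂gaussianReal 0 1 = 3 := by
  have d1 : deriv (fun t : ℝ => Real.exp (t ^ 2 / 2)) = fun t => t * Real.exp (t ^ 2 / 2) := by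
    have := deriv_mul_exp_sq (fun _ => 1) (fun _ => 0) (fun t => hasDerivAt_const t 1)
    simpa using this
  have d2 := deriv_mul_exp_sq (fun t => t) (fun _ => 1) (fun t => hasDerivAt_id t)
  have d3 := deriv_mul_exp_sq (fun t => 1 + t * t) (fun t => t + t) (fun t => by
    have := ((hasDerivAt_id t).mul (hasDerivAt_id t)).const_add 1
    simpa using this)
  have d4 := deriv_mul_exp_sq (fun t => t + t + t * (1 + t * t))
    (fun t => 1 + 1 + (1 + t * t + t * (t + t))) (fun t => by
    exact (((hasDerivAt_id t).add (hasDerivAt_id t)).add ((hasDerivAt_id t).mul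
      (((hasDerivAt_id t).mul (hasDerivAt_id t)).const_add 1))).congr_deriv (by simp))
  constructor
  · rw [← iteratedDeriv_exp_sq, iteratedDeriv_succ, iteratedDeriv_succ, iteratedDeriv_one,
      d1, d2, d3]
    simp
  · rw [← iteratedDeriv_exp_sq, iteratedDeriv_succ, iteratedDeriv_succ, iteratedDeriv_succ,
      iteratedDeriv_one, d1, d2, d3, d4]
    norm_num

instance : MomentLaw (gaussianReal 0 1) where
  int := integrable_pow_gaussian
  m1 := integral_id_gaussianReal
  m2 := by
    have := variance_fun_id_gaussianReal (μ := 0) (v := 1)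
    rw [variance_of_integral_eq_zero (by fun_prop) integral_id_gaussianReal] at this
    simpa using this
  m3 := gaussian_moments.1
  m4 := by rw [gaussian_moments.2]; norm_num

/-- `ψ` is approximated to fourth order by cubic polynomials, uniformly. -/
def CubicApprox (ψ : ℝ → ℝ) (C : ℝ) : Prop :=
  ∀ q, ∃ c₁ c₂ c₃ : ℝ, ∀ u, |ψ (q + u) - (ψ q + c₁ * u + c₂ * u ^ 2 + c₃ * u ^ 3)| ≤ C * u ^ 4

lemma cubicApprox_of_contDiff {ψ : ℝ → ℝ} (hψ : ContDiff ℝ 4 ψ) (hc : HasCompactSupport ψ) :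
    ∃ C, 0 ≤ C ∧ CubicApprox ψ C := by
  have hcont : Continuous (iteratedDeriv 4 ψ) := hψ.continuous_iteratedDeriv' 4
  have hcs : HasCompactSupport (iteratedDeriv 4 ψ) := by
    simp only [iteratedDeriv_succ, iteratedDeriv_zero]
    exact hc.deriv.deriv.deriv.deriv
  obtain ⟨C, hC⟩ := hcs.exists_bound_of_continuous hcont
  have hC0 : 0 ≤ C := (norm_nonneg _).trans (hC 0)
  refine ⟨C, hC0, fun q => ⟨iteratedDeriv 1 ψ q, iteratedDeriv 2 ψ q / 2,
    iteratedDeriv 3 ψ q / 6, fun u => ?_⟩⟩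
  rcases eq_or_ne u 0 with rfl | hu
  · simp
  have hne : q ≠ q + u := by simpa using hu
  have hud : UniqueDiffOn ℝ (Set.uIcc q (q + u)) := uniqueDiffOn_uIcc hne
  obtain ⟨y, -, hy⟩ := taylor_mean_remainder_lagrange_iteratedDeriv (n := 3) hne
    (f := ψ) (by exact_mod_cast hψ.contDiffOn)
  have hw : ∀ k : ℕ, k ≤ 4 → iteratedDerivWithin k ψ (Set.uIcc q (q + u)) q
      = iteratedDeriv k ψ q := fun k hk =>
    iteratedDerivWithin_eq_iteratedDeriv hud
      ((hψ.of_le (by exact_mod_cast hk)).contDiffAt) Set.left_mem_uIcc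
  rw [taylorWithinEval_succ, taylorWithinEval_succ, taylorWithinEval_succ,
    taylor_within_zero_eval, hw 1 (by norm_num), hw 2 (by norm_num), hw 3 (by norm_num)] at hy
  have e : ψ (q + u) - (ψ q + iteratedDeriv 1 ψ q * u + iteratedDeriv 2 ψ q / 2 * u ^ 2
      + iteratedDeriv 3 ψ q / 6 * u ^ 3) = iteratedDeriv 4 ψ y * u ^ 4 / 24 := by
    simp [Nat.factorial] at hy
    rw [iteratedDeriv_one]
    linear_combination hy
  rw [e, abs_div, abs_mul, abs_of_nonneg (by positivity : 0 ≤ u ^ 4)]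
  have h1 : |iteratedDeriv 4 ψ y| ≤ C := hC y
  have h2 : 0 ≤ u ^ 4 := by positivity
  rw [abs_of_pos (by norm_num : (0 : ℝ) < 24), div_le_iff₀ (by norm_num)]
  nlinarith [mul_le_mul_of_nonneg_right h1 h2, mul_nonneg hC0 h2]

lemma integrable_comp_bdd {Ω : Type*} [MeasurableSpace Ω] {μ : Measure Ω} [IsFiniteMeasure μ]
    {ψ : ℝ → ℝ} (hψ : Measurable ψ) (hb : ∀ x, |ψ x| ≤ 1) {f : Ω → ℝ} (hf : Measurable f) :
    Integrable (fun x => ψ (f x)) μ :=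
  Integrable.of_bound (hψ.comp hf).aestronglyMeasurable 1 (ae_of_all _ fun x => hb (f x))

lemma cubicApprox_integral {ψ : ℝ → ℝ} {C : ℝ} (h : CubicApprox ψ C)
    (hψ : Measurable ψ) (hb : ∀ x, |ψ x| ≤ 1) (q r : ℝ) :
    ∃ A, ∀ ν : Measure ℝ, MomentLaw ν → |∫ s, ψ (q + s * r) ∂ν - A| ≤ 9 * C * r ^ 4 := by
  obtain ⟨c₁, c₂, c₃, hc⟩ := h q
  have hC : 0 ≤ C := by
    have := (abs_nonneg _).trans (hc 1)
    simpa using this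
  refine ⟨ψ q + c₂ * r ^ 2, fun ν _ => ?_⟩
  have j1 : Integrable (fun s : ℝ => c₁ * r * s) ν := by
    simpa using (MomentLaw.int (ν := ν) 1).const_mul (c₁ * r)
  have j2 : Integrable (fun s : ℝ => c₂ * r ^ 2 * s ^ 2) ν := (MomentLaw.int 2).const_mul _
  have j3 : Integrable (fun s : ℝ => c₃ * r ^ 3 * s ^ 3) ν := (MomentLaw.int 3).const_mul _
  have j4 : Integrable (fun s : ℝ => C * r ^ 4 * s ^ 4) ν := (MomentLaw.int 4).const_mul _
  have jT : Integrable (fun s : ℝ => ψ q + c₁ * r * s + c₂ * r ^ 2 * s ^ 2 + c₃ * r ^ 3 * s ^ 3)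
      ν := (((integrable_const _).add j1).add j2).add j3
  have eT : ∫ s, (ψ q + c₁ * r * s + c₂ * r ^ 2 * s ^ 2 + c₃ * r ^ 3 * s ^ 3) ∂ν
      = ψ q + c₂ * r ^ 2 := by
    rw [integral_add (by exact ((integrable_const _).add j1).add j2) j3,
      integral_add (by exact (integrable_const _).add j1) j2, integral_add (integrable_const _) j1]
    have e1 : ∫ s, c₁ * r * s ∂ν = c₁ * r * ∫ s, s ∂ν := integral_const_mul _ _
    simp only [e1, integral_const_mul, integral_const, probReal_univ]
    rw [MomentLaw.m1, MomentLaw.m2, MomentLaw.m3]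
    simp
  have jψ : Integrable (fun s => ψ (q + s * r)) ν := integrable_comp_bdd hψ hb (by fun_prop)
  rw [← eT, ← integral_sub jψ jT]
  calc |∫ s, (ψ (q + s * r) - (ψ q + c₁ * r * s + c₂ * r ^ 2 * s ^ 2 + c₃ * r ^ 3 * s ^ 3)) ∂ν|
      ≤ ∫ s, |ψ (q + s * r) - (ψ q + c₁ * r * s + c₂ * r ^ 2 * s ^ 2 + c₃ * r ^ 3 * s ^ 3)| ∂ν :=
        abs_integral_le_integral_abs
    _ ≤ ∫ s, C * r ^ 4 * s ^ 4 ∂ν := by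
        refine integral_mono (jψ.sub jT).abs j4 fun s => ?_
        have := hc (s * r)
        refine le_trans (le_of_eq ?_) (this.trans (le_of_eq (by ring)))
        congr 1; ring
    _ = C * r ^ 4 * ∫ s, s ^ 4 ∂ν := integral_const_mul _ _
    _ ≤ C * r ^ 4 * 9 := by
        have := MomentLaw.m4 (ν := ν)
        have h4 : 0 ≤ C * r ^ 4 := by positivity
        gcongr
    _ = 9 * C * r ^ 4 := by ring

lemma momentLaw_update {n : ℕ} (μ : Fin n → Measure ℝ) [h : ∀ i, MomentLaw (μ i)] (k : Fin n)
    (ν : Measure ℝ) [MomentLaw ν] (i : Fin n) : MomentLaw (Function.update μ k ν i) := by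
  by_cases hi : i = k
  · subst hi; simpa
  · simpa [Function.update_of_ne hi] using h i

lemma lindeberg_step {n d : ℕ} {a : Finset (Fin n) → ℝ} (ha : DegLE a d)
    {ψ : ℝ → ℝ} {C : ℝ} (hC : 0 ≤ C) (h : CubicApprox ψ C) (hψ : Measurable ψ)
    (hb : ∀ x, |ψ x| ≤ 1) (μ : Fin n → Measure ℝ) [∀ i, MomentLaw (μ i)] (k : Fin n)
    (ν₁ ν₂ : Measure ℝ) [MomentLaw ν₁] [MomentLaw ν₂] :
    |∫ x, ψ (mlEval a x) ∂Measure.pi (Function.update μ k ν₁)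
      - ∫ x, ψ (mlEval a x) ∂Measure.pi (Function.update μ k ν₂)|
      ≤ 18 * C * (9 ^ d * wsq a k ^ 2) := by
  have inst : ∀ ν : Measure ℝ, ∀ _ : MomentLaw ν, ∀ i, MomentLaw (Function.update μ k ν i) :=
    fun ν _ => momentLaw_update μ k ν
  have hI : ∀ ν : Measure ℝ, ∀ _ : MomentLaw ν,
      ∫ x, ψ (mlEval a x) ∂Measure.pi (Function.update μ k ν)
        = ∫ x, ∫ s, ψ (mlEval (coefOff a k) x + s * mlEval (coefDeriv a k) x) ∂ν
          ∂Measure.pi μ := by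
    intro ν hν
    have := inst ν hν
    rw [integral_pi_update μ k ν (integrable_comp_bdd hψ hb (measurable_mlEval a))]
    refine integral_congr_ae (ae_of_all _ fun x => integral_congr_ae (ae_of_all _ fun s => ?_))
    simp only
    rw [mlEval_split a k, mlEval_coefOff_update, mlEval_coefDeriv_update, Function.update_self]
  have hJ : ∀ ν : Measure ℝ, ∀ _ : MomentLaw ν, Integrable (fun x =>
      ∫ s, ψ (mlEval (coefOff a k) x + s * mlEval (coefDeriv a k) x) ∂ν) (Measure.pi μ) := by
    intro ν hν
    refine Integrable.of_bound (C := 1) ?_ (ae_of_all _ fun x => ?_)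
    · have : Measurable (fun p : (Fin n → ℝ) × ℝ =>
          ψ (mlEval (coefOff a k) p.1 + p.2 * mlEval (coefDeriv a k) p.1)) := by
        have := measurable_mlEval (coefOff a k)
        have := measurable_mlEval (coefDeriv a k)
        fun_prop
      exact this.stronglyMeasurable.integral_prod_right.aestronglyMeasurable
    · refine (norm_integral_le_of_norm_le_const (C := 1) (ae_of_all _ fun s => hb _)).trans ?_
      simp
  rw [hI ν₁ ‹_›, hI ν₂ ‹_›, ← integral_sub (hJ _ ‹_›) (hJ _ ‹_›)]
  have h4 : ∫ x, mlEval (coefDeriv a k) x ^ 4 ∂Measure.pi μ ≤ 9 ^ d * wsq a k ^ 2 := by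
    rcases d with _ | d
    · have := coef_zero_of_degLE_zero ha k
      simp [this, mlEval]
      positivity
    · refine (hypercontractive μ (ha.coefDeriv k)).trans ?_
      rw [sum_sq_coefDeriv]
      gcongr
      · norm_num
      · omega
  calc |∫ x, (∫ s, ψ (mlEval (coefOff a k) x + s * mlEval (coefDeriv a k) x) ∂ν₁
        - ∫ s, ψ (mlEval (coefOff a k) x + s * mlEval (coefDeriv a k) x) ∂ν₂) ∂Measure.pi μ|
      ≤ ∫ x, |∫ s, ψ (mlEval (coefOff a k) x + s * mlEval (coefDeriv a k) x) ∂ν₁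
        - ∫ s, ψ (mlEval (coefOff a k) x + s * mlEval (coefDeriv a k) x) ∂ν₂| ∂Measure.pi μ :=
        abs_integral_le_integral_abs
    _ ≤ ∫ x, 18 * C * mlEval (coefDeriv a k) x ^ 4 ∂Measure.pi μ := by
        refine integral_mono ((hJ _ ‹_›).sub (hJ _ ‹_›)).abs
          ((integrable_mlEval_pow μ _ 4).const_mul _) fun x => ?_
        obtain ⟨A, hA⟩ := cubicApprox_integral h hψ hb (mlEval (coefOff a k) x)
          (mlEval (coefDeriv a k) x)
        have h1 := abs_le.1 (hA ν₁ ‹_›)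
        have h2 := abs_le.1 (hA ν₂ ‹_›)
        exact abs_le.2 ⟨by linarith, by linarith⟩
    _ = 18 * C * ∫ x, mlEval (coefDeriv a k) x ^ 4 ∂Measure.pi μ := integral_const_mul _ _
    _ ≤ 18 * C * (9 ^ d * wsq a k ^ 2) := by gcongr

/-- The invariance principle for smooth test functions. -/
lemma lindeberg {n d : ℕ} {a : Finset (Fin n) → ℝ} (ha : DegLE a d)
    {ψ : ℝ → ℝ} {C : ℝ} (hC : 0 ≤ C) (h : CubicApprox ψ C) (hψ : Measurable ψ)
    (hb : ∀ x, |ψ x| ≤ 1) (ν₁ ν₂ : Measure ℝ) [MomentLaw ν₁] [MomentLaw ν₂] :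
    |∫ x, ψ (mlEval a x) ∂Measure.pi (fun _ : Fin n => ν₁)
      - ∫ x, ψ (mlEval a x) ∂Measure.pi (fun _ : Fin n => ν₂)|
      ≤ 18 * C * 9 ^ d * ∑ k, wsq a k ^ 2 := by
  have key : ∀ S : Finset (Fin n),
      |∫ x, ψ (mlEval a x) ∂Measure.pi (fun _ : Fin n => ν₁)
        - ∫ x, ψ (mlEval a x) ∂Measure.pi (fun i : Fin n => if i ∈ S then ν₂ else ν₁)|
        ≤ 18 * C * 9 ^ d * ∑ k ∈ S, wsq a k ^ 2 := by
    intro S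
    induction S using Finset.induction_on with
    | empty => simp
    | insert k S hk ih =>
      set μ : Fin n → Measure ℝ := fun i => if i ∈ S then ν₂ else ν₁ with hμ
      have inst : ∀ i, MomentLaw (μ i) := by
        intro i; simp only [hμ]; split_ifs <;> infer_instance
      have e1 : Function.update μ k ν₁ = μ := by
        ext1 i
        by_cases hi : i = k
        · subst hi; simp [hμ, hk]
        · simp [Function.update_of_ne hi]
      have e2 : Function.update μ k ν₂ = fun i => if i ∈ insert k S then ν₂ else ν₁ := by
        ext1 i
        by_cases hi : i = k
        · subst hi; simp
        · simp [hμ, hi]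
      have st := lindeberg_step ha hC h hψ hb μ k ν₁ ν₂
      rw [e1, e2] at st
      rw [Finset.sum_insert hk]
      have := (abs_sub_le _ _ _).trans (add_le_add ih st)
      linarith
  simpa using key univ

/-- Comparison of small ball probabilities of low-influence polynomials. -/
lemma smallBall_compare : ∃ C : ℝ, 0 ≤ C ∧ ∀ (n d : ℕ) (a : Finset (Fin n) → ℝ), DegLE a d →
    ∀ t : ℝ, 0 < t →
      (Measure.pi (fun _ : Fin n => rad)).real {x | |mlEval a x| ≤ t}
        ≤ (gaussn n).real {x | |mlEval a x| ≤ 2 * t}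
          + C * 9 ^ d * (∑ k, wsq a k ^ 2) / t ^ 4 := by
  let f : ContDiffBump (0 : ℝ) := ⟨1, 2, by norm_num, by norm_num⟩
  obtain ⟨C, hC, hf⟩ := cubicApprox_of_contDiff (ψ := f) f.contDiff f.hasCompactSupport
  refine ⟨18 * C, by positivity, fun n d a ha t ht => ?_⟩
  have hm : Measurable (f : ℝ → ℝ) := f.continuous.measurable
  have hb : ∀ x, |f x| ≤ 1 := fun x => abs_le.2 ⟨by linarith [f.nonneg (x := x)], f.le_one⟩
  set b : Finset (Fin n) → ℝ := fun I => a I / t with hbdef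
  have hbd : DegLE b d := fun I hI => ha I fun h0 => hI (by simp [hbdef, h0])
  have hev : ∀ x, mlEval b x = mlEval a x / t := by
    intro x
    simp only [mlEval, hbdef, Finset.sum_div]
    exact Finset.sum_congr rfl fun I _ => by ring
  have hw : ∀ k, wsq b k = wsq a k / t ^ 2 := by
    intro k
    simp only [wsq, hbdef, Finset.sum_div]
    exact Finset.sum_congr rfl fun I _ => by ring
  have hl := lindeberg hbd hC hf hm hb rad (gaussianReal 0 1)
  have ms : ∀ s : ℝ, MeasurableSet {x : Fin n → ℝ | |mlEval a x| ≤ s} := fun s =>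
    measurableSet_le (measurable_mlEval a).abs measurable_const
  have lo : (Measure.pi (fun _ : Fin n => rad)).real {x | |mlEval a x| ≤ t}
      ≤ ∫ x, f (mlEval b x) ∂Measure.pi (fun _ : Fin n => rad) := by
    rw [← integral_indicator_one (ms t)]
    refine integral_mono ((integrable_const _).indicator (ms t))
      (integrable_comp_bdd hm hb (measurable_mlEval b)) fun x => ?_
    by_cases hx : |mlEval a x| ≤ t
    · have : f (mlEval b x) = 1 := by
        refine f.one_of_mem_closedBall ?_
        simp only [Metric.mem_closedBall, dist_zero_right, Real.norm_eq_abs, hev, abs_div,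
          abs_of_pos ht, f]
        exact (div_le_one ht).2 hx
      simp [this, hx]
    · simp [hx, f.nonneg]
  have hi : ∫ x, f (mlEval b x) ∂gaussn n ≤ (gaussn n).real {x | |mlEval a x| ≤ 2 * t} := by
    have : IsProbabilityMeasure (gaussn n) := by unfold gaussn; infer_instance
    rw [← integral_indicator_one (ms (2 * t))]
    refine integral_mono (integrable_comp_bdd hm hb (measurable_mlEval b))
      ((integrable_const _).indicator (ms _)) fun x => ?_
    by_cases hx : |mlEval a x| ≤ 2 * t
    · simp [hx, f.le_one]
    · have : f (mlEval b x) = 0 := by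
        refine f.zero_of_le_dist ?_
        simp only [dist_zero_right, Real.norm_eq_abs, hev, abs_div, abs_of_pos ht, f]
        rw [le_div_iff₀ ht]
        exact (not_le.1 hx).le
      simp [this, hx]
  have hl2 := (abs_le.1 hl).2
  have hs : ∑ k, wsq b k ^ 2 = (∑ k, wsq a k ^ 2) / t ^ 4 := by
    rw [Finset.sum_div]
    exact Finset.sum_congr rfl fun k _ => by rw [hw]; ring
  rw [hs] at hl2
  have : 18 * C * 9 ^ d * ((∑ k, wsq a k ^ 2) / t ^ 4) = 18 * C * 9 ^ d * (∑ k, wsq a k ^ 2) / t ^ 4 := by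
    ring
  unfold gaussn at *
  linarith

/-- Real trigonometric polynomials of degree at most `d`. -/
def TrigPoly (d : ℕ) (p : ℝ → ℝ) : Prop :=
  ∃ q : Polynomial ℂ, q.natDegree ≤ 2 * d ∧
    ∀ φ : ℝ, (p φ : ℂ) * Complex.exp (φ * Complex.I) ^ d
      = q.eval (Complex.exp (φ * Complex.I))

lemma hasDerivAt_exp_ofReal_mul_I (φ : ℝ) :
    HasDerivAt (fun φ : ℝ => Complex.exp (φ * Complex.I))
      (Complex.exp (φ * Complex.I) * Complex.I) φ := by
  have h : HasDerivAt (fun φ : ℝ => (φ : ℂ) * Complex.I) Complex.I φ := by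
    simpa using (Complex.ofRealCLM.hasDerivAt (x := φ)).mul_const Complex.I
  exact h.cexp

lemma trig_deriv_eq {d : ℕ} {p : ℝ → ℝ} {q : Polynomial ℂ}
    (hq : ∀ φ : ℝ, (p φ : ℂ) * Complex.exp (φ * Complex.I) ^ d
      = q.eval (Complex.exp (φ * Complex.I))) {p' φ : ℝ} (hp : HasDerivAt p p' φ) :
    (p' : ℂ) * Complex.exp (φ * Complex.I) ^ d
      = Complex.I * (q.derivative.eval (Complex.exp (φ * Complex.I)) * Complex.exp (φ * Complex.I)
        - d * q.eval (Complex.exp (φ * Complex.I))) := by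
  have hz := hasDerivAt_exp_ofReal_mul_I φ
  have h1 := (hp.ofReal_comp).mul (hz.pow d)
  have h2 := (q.hasDerivAt (Complex.exp (φ * Complex.I))).comp φ hz
  have h3 : (fun φ : ℝ => (p φ : ℂ) * Complex.exp (φ * Complex.I) ^ d)
      = (fun φ : ℝ => q.eval (Complex.exp (φ * Complex.I))) := funext hq
  have h4 := h1.unique (by
    have := h2
    simp only [Function.comp_def] at this
    rw [← h3] at this
    exact this)
  rw [← hq φ]
  set z := Complex.exp (φ * Complex.I)
  rcases d with _ | d
  · simp at h4 ⊢; rw [h4]; ring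
  · simp only [Nat.add_sub_cancel, Nat.cast_add, Nat.cast_one, Pi.pow_apply] at h4 ⊢
    linear_combination h4

lemma norm_exp_sub_exp_ge {s t : ℝ} (hs : s ∈ Set.Icc (0 : ℝ) 1) (ht : t ∈ Set.Icc (0 : ℝ) 1) :
    |s - t| / 2 ≤ ‖Complex.exp (s * Complex.I) - Complex.exp (t * Complex.I)‖ := by
  wlog hst : t ≤ s generalizing s t
  · rw [abs_sub_comm, norm_sub_rev]
    exact this ht hs (le_of_not_ge hst)
  have e : Complex.exp (s * Complex.I) - Complex.exp (t * Complex.I)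
      = Complex.exp (t * Complex.I) * (Complex.exp ((s - t : ℝ) * Complex.I) - 1) := by
    rw [mul_sub, ← Complex.exp_add]; congr 2
    · push_cast; ring
    · ring
  rw [e, norm_mul, Complex.norm_exp_ofReal_mul_I, one_mul]
  have h0 : 0 ≤ s - t := by linarith
  have h1 : s - t ≤ 1 := by linarith [hs.2, ht.1]
  have hpi := Real.pi_gt_three
  have hpi4 := Real.pi_le_four
  have h2 := Real.mul_le_sin h0 (by linarith)
  have h3 : (1 : ℝ) / 2 ≤ 2 / Real.pi := by
    rw [div_le_div_iff₀ (by norm_num) Real.pi_pos]; linarith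
  calc |s - t| / 2 = 1 / 2 * (s - t) := by rw [abs_of_nonneg h0]; ring
    _ ≤ 2 / Real.pi * (s - t) := by gcongr
    _ ≤ Real.sin (s - t) := h2
    _ = (Complex.exp ((s - t : ℝ) * Complex.I) - 1).im := by
        rw [Complex.sub_im, Complex.exp_ofReal_mul_I_im, Complex.one_im, sub_zero]
    _ ≤ _ := (le_abs_self _).trans (Complex.abs_im_le_norm _)

lemma volume_exp_near_le (z : ℂ) (r : ℝ) :
    volume {φ : ℝ | φ ∈ Set.Icc (0 : ℝ) 1 ∧ ‖Complex.exp (φ * Complex.I) - z‖ ≤ r}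
      ≤ ENNReal.ofReal (4 * r) := by
  refine (Real.volume_le_diam _).trans (Metric.ediam_le fun s hs t ht => ?_)
  rw [edist_dist]
  refine ENNReal.ofReal_le_ofReal ?_
  have h := norm_exp_sub_exp_ge hs.1 ht.1
  have h2 : ‖Complex.exp (s * Complex.I) - Complex.exp (t * Complex.I)‖ ≤ r + r := by
    refine (norm_sub_le_norm_sub_add_norm_sub _ z _).trans (add_le_add hs.2 ?_)
    rw [norm_sub_rev]; exact ht.2
  rw [Real.dist_eq]; linarith

lemma norm_multiset_sum_le_card_mul {s : Multiset ℂ} {c : ℝ} (h : ∀ z ∈ s, ‖z‖ ≤ c) :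
    ‖s.sum‖ ≤ s.card * c := by
  induction s using Multiset.induction_on with
  | empty => simp
  | cons a s ih =>
    rw [Multiset.sum_cons, Multiset.card_cons]
    have h1 := h a (Multiset.mem_cons_self a s)
    have h2 := ih fun z hz => h z (Multiset.mem_cons_of_mem hz)
    push_cast
    linarith [norm_add_le a s.sum]

lemma trig_small {d : ℕ} (hd : 1 ≤ d) {p p' : ℝ → ℝ} (hp : TrigPoly d p)
    (hp' : ∀ φ, HasDerivAt p (p' φ) φ) {ρ : ℝ} (hρ : 0 < ρ) :
    volume {φ : ℝ | φ ∈ Set.Icc (0 : ℝ) 1 ∧ |p φ| < ρ * |p' φ|}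
      ≤ ENNReal.ofReal (32 * d ^ 2 * ρ) := by
  obtain ⟨q, hqd, hq⟩ := hp
  have hd' : (1 : ℝ) ≤ d := by exact_mod_cast hd
  rcases le_or_gt (1 / (2 * (d : ℝ))) ρ with hbig | hsmall
  · calc volume {φ : ℝ | φ ∈ Set.Icc (0 : ℝ) 1 ∧ |p φ| < ρ * |p' φ|}
        ≤ volume (Set.Icc (0 : ℝ) 1) := measure_mono fun φ h => h.1
      _ = ENNReal.ofReal 1 := by simp
      _ ≤ _ := by
        refine ENNReal.ofReal_le_ofReal ?_
        rw [div_le_iff₀ (by positivity)] at hbig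
        nlinarith [mul_le_mul_of_nonneg_left hd' (by positivity : 0 ≤ ρ * d)]
  have hsub : {φ : ℝ | φ ∈ Set.Icc (0 : ℝ) 1 ∧ |p φ| < ρ * |p' φ|} ⊆
      ⋃ z ∈ q.roots.toFinset, {φ : ℝ | φ ∈ Set.Icc (0 : ℝ) 1 ∧
        ‖Complex.exp (φ * Complex.I) - z‖ ≤ 4 * d * ρ} := by
    rintro φ ⟨h01, hlt⟩
    have hder := trig_deriv_eq hq (hp' φ)
    set z := Complex.exp (φ * Complex.I) with hz
    have hzn : ‖z‖ = 1 := Complex.norm_exp_ofReal_mul_I φ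
    have hq0 : q ≠ 0 := by
      rintro rfl
      have : ‖(p' φ : ℂ) * z ^ d‖ = 0 := by rw [hder]; simp
      rw [norm_mul, norm_pow, hzn, one_pow, mul_one, Complex.norm_real, Real.norm_eq_abs] at this
      rw [this] at hlt
      linarith [abs_nonneg (p φ)]
    simp only [Set.mem_iUnion, Set.mem_ofPred_eq, Multiset.mem_toFinset, exists_prop]
    by_contra hcon
    push Not at hcon
    have hfar : ∀ w ∈ q.roots, 4 * d * ρ < ‖z - w‖ := fun w hw => hcon w hw h01
    have hqz : q.eval z ≠ 0 := by
      intro h0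
      have := hfar z ((Polynomial.mem_roots hq0).2 h0)
      simp at this
      have : 0 < 4 * d * ρ := by positivity
      linarith
    have hs := (IsAlgClosed.splits q).eval_derivative_eq_eval_mul_sum hqz
    rw [hs] at hder
    have hn : |p' φ| ≤ |p φ| * (d + 1 / (2 * ρ)) := by
      have e1 : ‖(p' φ : ℂ) * z ^ d‖ = |p' φ| := by
        rw [norm_mul, norm_pow, hzn, one_pow, mul_one, Complex.norm_real, Real.norm_eq_abs]
      have e2 : ‖q.eval z‖ = |p φ| := by
        rw [← hq φ, norm_mul, norm_pow, hzn, one_pow, mul_one, Complex.norm_real,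
          Real.norm_eq_abs]
      rw [← e1, ← e2, hder, norm_mul, Complex.norm_I, one_mul]
      have e3 : q.eval z * (q.roots.map fun w => 1 / (z - w)).sum * z - d * q.eval z
          = q.eval z * ((q.roots.map fun w => 1 / (z - w)).sum * z - d) := by ring
      rw [e3, norm_mul]
      refine mul_le_mul_of_nonneg_left ?_ (norm_nonneg _)
      refine (norm_sub_le _ _).trans ?_
      rw [norm_mul, hzn, mul_one, Complex.norm_natCast, add_comm]
      refine add_le_add le_rfl ?_
      refine (norm_multiset_sum_le_card_mul (c := 1 / (4 * d * ρ)) ?_).trans ?_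
      · intro w hw
        obtain ⟨v, hv, rfl⟩ := Multiset.mem_map.1 hw
        rw [norm_div, norm_one]
        exact one_div_le_one_div_of_le (by positivity) (hfar v hv).le
      · rw [Multiset.card_map]
        have hc : (q.roots.card : ℝ) ≤ 2 * d := by
          exact_mod_cast (Polynomial.card_roots' q).trans hqd
        calc (q.roots.card : ℝ) * (1 / (4 * d * ρ)) ≤ 2 * d * (1 / (4 * d * ρ)) := by gcongr
          _ = 1 / (2 * ρ) := by field_simp; norm_num
    have h5 : (d : ℝ) + 1 / (2 * ρ) < 1 / ρ := by
      have : (d : ℝ) < 1 / (2 * ρ) := by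
        rw [lt_div_iff₀ (by positivity)] at hsmall ⊢
        linarith
      have h6 : 1 / ρ = 1 / (2 * ρ) + 1 / (2 * ρ) := by field_simp; norm_num
      linarith
    have h7 : ρ * |p' φ| ≤ |p φ| := by
      calc ρ * |p' φ| ≤ ρ * (|p φ| * (d + 1 / (2 * ρ))) := by gcongr
        _ ≤ ρ * (|p φ| * (1 / ρ)) := by gcongr
        _ = |p φ| := by field_simp
    linarith
  calc volume {φ : ℝ | φ ∈ Set.Icc (0 : ℝ) 1 ∧ |p φ| < ρ * |p' φ|}
      ≤ volume (⋃ z ∈ q.roots.toFinset, {φ : ℝ | φ ∈ Set.Icc (0 : ℝ) 1 ∧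
        ‖Complex.exp (φ * Complex.I) - z‖ ≤ 4 * d * ρ}) := measure_mono hsub
    _ ≤ ∑ z ∈ q.roots.toFinset, volume {φ : ℝ | φ ∈ Set.Icc (0 : ℝ) 1 ∧
        ‖Complex.exp (φ * Complex.I) - z‖ ≤ 4 * d * ρ} := measure_biUnion_finset_le _ _
    _ ≤ ∑ z ∈ q.roots.toFinset, ENNReal.ofReal (4 * (4 * d * ρ)) :=
        Finset.sum_le_sum fun z _ => volume_exp_near_le z _
    _ = q.roots.toFinset.card * ENNReal.ofReal (4 * (4 * d * ρ)) := by simp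
    _ = ENNReal.ofReal (q.roots.toFinset.card * (4 * (4 * d * ρ))) := by
        rw [ENNReal.ofReal_mul (Nat.cast_nonneg _), ENNReal.ofReal_natCast]
    _ ≤ _ := by
        refine ENNReal.ofReal_le_ofReal ?_
        have hc : (q.roots.toFinset.card : ℝ) ≤ 2 * d := by
          exact_mod_cast ((Multiset.toFinset_card_le _).trans (Polynomial.card_roots' q)).trans hqd
        calc (q.roots.toFinset.card : ℝ) * (4 * (4 * d * ρ)) ≤ 2 * d * (4 * (4 * d * ρ)) := by
              gcongr
          _ = 32 * d ^ 2 * ρ := by ring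

/-- The interpolation nodes `k / (2d + 1)`. -/
def trigNode (d k : ℕ) : ℝ := k / (2 * d + 1)

lemma exists_bound_unit_circle (q : Polynomial ℂ) :
    ∃ C : ℝ, 0 ≤ C ∧ ∀ z : ℂ, ‖z‖ = 1 → ‖q.eval z‖ ≤ C := by
  obtain ⟨C, hC⟩ := (isCompact_sphere (0 : ℂ) 1).exists_bound_of_continuousOn
    (f := fun z => q.eval z) q.continuous.continuousOn
  refine ⟨max C 0, le_max_right _ _, fun z hz => (hC z ?_).trans (le_max_left _ _)⟩
  simpa using hz

lemma trig_sup (d : ℕ) : ∃ C : ℝ, 0 ≤ C ∧ ∀ p p' : ℝ → ℝ, TrigPoly d p →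
    (∀ φ, HasDerivAt p (p' φ) φ) → ∀ φ,
      |p φ| ≤ C * ∑ k ∈ range (2 * d + 1), |p (trigNode d k)| ∧
      |p' φ| ≤ C * ∑ k ∈ range (2 * d + 1), |p (trigNode d k)| := by
  set v : ℕ → ℂ := fun k => Complex.exp (trigNode d k * Complex.I) with hv
  have hnode : ∀ k ∈ range (2 * d + 1), trigNode d k ∈ Set.Icc (0 : ℝ) 1 := by
    intro k hk
    have : (k : ℝ) ≤ 2 * d + 1 := by exact_mod_cast (Finset.mem_range.1 hk).le
    exact ⟨by unfold trigNode; positivity, (div_le_one (by positivity)).2 this⟩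
  have hinj : Set.InjOn v (range (2 * d + 1)) := by
    intro i hi j hj hij
    have h := norm_exp_sub_exp_ge (hnode i hi) (hnode j hj)
    have h0 : Complex.exp (trigNode d i * Complex.I) - Complex.exp (trigNode d j * Complex.I) = 0 :=
      sub_eq_zero.2 hij
    rw [h0, norm_zero] at h
    have h1 : trigNode d i = trigNode d j := by
      have : |trigNode d i - trigNode d j| = 0 := le_antisymm (by linarith) (abs_nonneg _)
      exact sub_eq_zero.1 (abs_eq_zero.1 this)
    unfold trigNode at h1
    rw [div_left_inj' (by positivity)] at h1
    exact_mod_cast h1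
  choose A hA0 hA using fun k => exists_bound_unit_circle (Lagrange.basis (range (2 * d + 1)) v k)
  choose B hB0 hB using fun k =>
    exists_bound_unit_circle (Lagrange.basis (range (2 * d + 1)) v k).derivative
  set SA := ∑ k ∈ range (2 * d + 1), A k
  set SB := ∑ k ∈ range (2 * d + 1), B k
  have hSA : 0 ≤ SA := Finset.sum_nonneg fun k _ => hA0 k
  have hSB : 0 ≤ SB := Finset.sum_nonneg fun k _ => hB0 k
  refine ⟨(d + 1) * SA + SB, by positivity, ?_⟩
  rintro p p' ⟨q, hqd, hq⟩ hp' φ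
  set S := ∑ k ∈ range (2 * d + 1), |p (trigNode d k)| with hS
  have hS0 : 0 ≤ S := Finset.sum_nonneg fun k _ => abs_nonneg _
  have hqk : ∀ k, ‖q.eval (v k)‖ = |p (trigNode d k)| := by
    intro k
    rw [hv, ← hq, norm_mul, norm_pow, Complex.norm_exp_ofReal_mul_I, one_pow, mul_one,
      Complex.norm_real, Real.norm_eq_abs]
  have hInt : q = ∑ k ∈ range (2 * d + 1),
      Polynomial.C (q.eval (v k)) * Lagrange.basis (range (2 * d + 1)) v k := by
    have := Lagrange.eq_interpolate (f := q) hinj (by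
      rw [Finset.card_range]
      refine (Polynomial.degree_le_natDegree).trans_lt ?_
      exact_mod_cast Nat.lt_succ_of_le hqd)
    rwa [Lagrange.interpolate_apply] at this
  have hle : ∀ k ∈ range (2 * d + 1), |p (trigNode d k)| ≤ S := fun k hk =>
    Finset.single_le_sum (f := fun k => |p (trigNode d k)|) (fun k _ => abs_nonneg _) hk
  have hder := trig_deriv_eq hq (hp' φ)
  have hqφ := hq φ
  set z := Complex.exp (φ * Complex.I) with hz
  have hzn : ‖z‖ = 1 := Complex.norm_exp_ofReal_mul_I φ
  have b1 : ‖q.eval z‖ ≤ SA * S := by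
    rw [hInt, Polynomial.eval_finsetSum, Finset.sum_mul]
    refine (norm_sum_le _ _).trans (Finset.sum_le_sum fun k hk => ?_)
    rw [Polynomial.eval_mul, Polynomial.eval_C, norm_mul, hqk, mul_comm]
    exact mul_le_mul (hA k z hzn) (hle k hk) (abs_nonneg _) (hA0 k)
  have b2 : ‖q.derivative.eval z‖ ≤ SB * S := by
    rw [hInt, Polynomial.derivative_sum, Polynomial.eval_finsetSum, Finset.sum_mul]
    refine (norm_sum_le _ _).trans (Finset.sum_le_sum fun k hk => ?_)
    rw [Polynomial.derivative_C_mul, Polynomial.eval_mul, Polynomial.eval_C, norm_mul, hqk,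
      mul_comm]
    exact mul_le_mul (hB k z hzn) (hle k hk) (abs_nonneg _) (hB0 k)
  have e1 : ‖(p φ : ℂ) * z ^ d‖ = |p φ| := by
    rw [norm_mul, norm_pow, hzn, one_pow, mul_one, Complex.norm_real, Real.norm_eq_abs]
  have e2 : ‖(p' φ : ℂ) * z ^ d‖ = |p' φ| := by
    rw [norm_mul, norm_pow, hzn, one_pow, mul_one, Complex.norm_real, Real.norm_eq_abs]
  have hASS : 0 ≤ SA * S := by positivity
  have hdASS : 0 ≤ d * (SA * S) := by positivity
  have hBSS : 0 ≤ SB * S := by positivity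
  constructor
  · rw [← e1, hqφ]; nlinarith
  · rw [← e2, hder, norm_mul, Complex.norm_I, one_mul]
    refine (norm_sub_le _ _).trans ?_
    rw [norm_mul, norm_mul, hzn, mul_one, Complex.norm_natCast]
    have : (d : ℝ) * ‖q.eval z‖ ≤ d * (SA * S) := by gcongr
    nlinarith

/-- Coefficients of the directional derivative `D_y P`. -/
def dirCoef {n : ℕ} (a : Finset (Fin n) → ℝ) (y : Fin n → ℝ) (J : Finset (Fin n)) : ℝ :=
  ∑ i, y i * coefDeriv a i J

lemma mlEval_dirCoef {n : ℕ} (a : Finset (Fin n) → ℝ) (y x : Fin n → ℝ) :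
    mlEval (dirCoef a y) x = ∑ i, y i * mlEval (coefDeriv a i) x := by
  simp only [mlEval, dirCoef, Finset.sum_mul, Finset.mul_sum]
  rw [Finset.sum_comm]
  exact Finset.sum_congr rfl fun i _ => Finset.sum_congr rfl fun I _ => by ring

lemma measurable_mlEval_dirCoef {n : ℕ} (a : Finset (Fin n) → ℝ) :
    Measurable fun p : (Fin n → ℝ) × (Fin n → ℝ) => mlEval (dirCoef a p.2) p.1 := by
  simp only [mlEval_dirCoef]
  have := fun i => measurable_mlEval (coefDeriv a i)
  fun_prop

lemma hasDerivAt_mlEval {n : ℕ} (a : Finset (Fin n) → ℝ) {u u' : ℝ → Fin n → ℝ} {φ : ℝ}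
    (hu : ∀ i, HasDerivAt (fun t => u t i) (u' φ i) φ) :
    HasDerivAt (fun t => mlEval a (u t)) (mlEval (dirCoef a (u' φ)) (u φ)) φ := by
  have h : HasDerivAt (fun t => mlEval a (u t))
      (∑ I : Finset (Fin n), a I * ∑ i ∈ I, (∏ j ∈ I.erase i, u φ j) * u' φ i) φ := by
    unfold mlEval
    refine HasDerivAt.fun_sum fun I _ => HasDerivAt.const_mul _ ?_
    simpa using HasDerivAt.fun_finsetProd (u := I) (fun i _ => hu i)
  refine h.congr_deriv ?_
  rw [mlEval_dirCoef]
  have e : ∀ I : Finset (Fin n), a I * ∑ i ∈ I, (∏ j ∈ I.erase i, u φ j) * u' φ i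
      = ∑ i, if i ∈ I then u' φ i * (a I * ∏ j ∈ I.erase i, u φ j) else 0 := by
    intro I
    rw [Finset.sum_ite_mem, Finset.univ_inter, Finset.mul_sum]
    exact Finset.sum_congr rfl fun i _ => by ring
  simp_rw [e]
  rw [Finset.sum_comm]
  refine Finset.sum_congr rfl fun i _ => ?_
  rw [sum_split i, mlEval, Finset.mul_sum]
  have z : ∑ I : Finset (Fin n), (if i ∈ I then (0 : ℝ) else
      if i ∈ I then u' φ i * (a I * ∏ j ∈ I.erase i, u φ j) else 0) = 0 :=
    Finset.sum_eq_zero fun I _ => by split_ifs <;> rfl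
  rw [z, zero_add]
  refine Finset.sum_congr rfl fun I _ => ?_
  by_cases hi : i ∈ I
  · simp [coefDeriv, hi]
  · simp [coefDeriv, hi, Finset.erase_insert hi]

/-- Coordinatewise rotation of a pair of vectors. -/
def rot {n : ℕ} (φ : ℝ) (p : (Fin n → ℝ) × (Fin n → ℝ)) : (Fin n → ℝ) × (Fin n → ℝ) :=
  (fun i => Real.cos φ * p.1 i + Real.sin φ * p.2 i,
    fun i => -Real.sin φ * p.1 i + Real.cos φ * p.2 i)

instance (n : ℕ) : IsProbabilityMeasure (gaussn n) := by unfold gaussn; infer_instance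

lemma measurable_rot {n : ℕ} :
    Measurable fun q : ℝ × ((Fin n → ℝ) × (Fin n → ℝ)) => rot q.1 q.2 := by
  unfold rot; fun_prop

lemma measurePreserving_rot {n : ℕ} (φ : ℝ) :
    MeasurePreserving (rot (n := n) φ) ((gaussn n).prod (gaussn n))
      ((gaussn n).prod (gaussn n)) := by
  have h1 : MeasurePreserving (ContinuousLinearMap.rotation φ : ℝ × ℝ →L[ℝ] ℝ × ℝ)
      ((gaussianReal 0 1).prod (gaussianReal 0 1)) ((gaussianReal 0 1).prod (gaussianReal 0 1)) :=
    ⟨by fun_prop, IsGaussian.map_rotation_eq_self (by simp) φ⟩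
  have h2 := measurePreserving_pi (fun _ : Fin n => (gaussianReal 0 1).prod (gaussianReal 0 1))
    (fun _ : Fin n => (gaussianReal 0 1).prod (gaussianReal 0 1)) (fun _ => h1)
  have h3 := measurePreserving_arrowProdEquivProdArrow ℝ ℝ (Fin n) (fun _ => gaussianReal 0 1)
    (fun _ => gaussianReal 0 1)
  have h4 := (h3.comp h2).comp h3.symm
  convert h4 using 1
  · ext p i <;> simp [rot, MeasurableEquiv.arrowProdEquivProdArrow,
      Equiv.arrowProdEquivProdArrow, ContinuousLinearMap.rotation_apply]
  · rfl
  · rfl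

lemma hasDerivAt_rot {n : ℕ} (a : Finset (Fin n) → ℝ) (p : (Fin n → ℝ) × (Fin n → ℝ)) (φ : ℝ) :
    HasDerivAt (fun φ => mlEval a (rot φ p).1) (mlEval (dirCoef a (rot φ p).2) (rot φ p).1) φ := by
  refine hasDerivAt_mlEval a (u := fun φ => (rot φ p).1) (u' := fun φ => (rot φ p).2) fun i => ?_
  simp only [rot]
  exact ((Real.hasDerivAt_cos φ).mul_const _).add ((Real.hasDerivAt_sin φ).mul_const _)

lemma trigPoly_rot {n d : ℕ} {a : Finset (Fin n) → ℝ} (ha : DegLE a d)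
    (p : (Fin n → ℝ) × (Fin n → ℝ)) : TrigPoly d fun φ => mlEval a (rot φ p).1 := by
  set L : Fin n → Polynomial ℂ := fun i =>
    Polynomial.C (((p.1 i : ℂ) - Complex.I * p.2 i) / 2) * Polynomial.X ^ 2
      + Polynomial.C (((p.1 i : ℂ) + Complex.I * p.2 i) / 2) with hL
  have hLd : ∀ i, (L i).natDegree ≤ 2 := by
    intro i
    refine Polynomial.natDegree_add_le_of_degree_le (Polynomial.natDegree_C_mul_X_pow_le _ _) ?_
    simp
  refine ⟨∑ I : Finset (Fin n), Polynomial.C (a I : ℂ) *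
    (Polynomial.X ^ (d - I.card) * ∏ i ∈ I, L i), ?_, fun φ => ?_⟩
  · refine Polynomial.natDegree_sum_le_of_forall_le _ _ fun I _ => ?_
    by_cases hI : a I = 0
    · simp [hI]
    refine (Polynomial.natDegree_C_mul_le _ _).trans ?_
    refine Polynomial.natDegree_mul_le.trans ?_
    have h1 := Polynomial.natDegree_prod_le I L
    have h2 : ∑ i ∈ I, (L i).natDegree ≤ ∑ i ∈ I, 2 := Finset.sum_le_sum fun i _ => hLd i
    rw [Finset.sum_const, smul_eq_mul] at h2
    rw [Polynomial.natDegree_X_pow]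
    have := ha I hI
    omega
  · simp only [mlEval, Polynomial.eval_finsetSum, Polynomial.eval_mul, Polynomial.eval_C,
      Polynomial.eval_pow, Polynomial.eval_X, Polynomial.eval_prod, Complex.ofReal_sum,
      Complex.ofReal_mul, Complex.ofReal_prod, Finset.sum_mul]
    refine Finset.sum_congr rfl fun I _ => ?_
    by_cases hI : a I = 0
    · simp [hI]
    have hId := ha I hI
    have hc : ∀ i, (((rot φ p).1 i : ℝ) : ℂ) * Complex.exp (φ * Complex.I)
        = (L i).eval (Complex.exp (φ * Complex.I)) := by
      intro i
      have hcs : Complex.cos φ ^ 2 + Complex.sin φ ^ 2 = 1 := Complex.cos_sq_add_sin_sq φ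
      simp only [rot, hL, Polynomial.eval_add, Polynomial.eval_mul, Polynomial.eval_C,
        Polynomial.eval_pow, Polynomial.eval_X, Complex.exp_mul_I]
      push_cast
      have hI2 : Complex.I ^ 2 = -1 := Complex.I_sq
      linear_combination (exp := 1) ((p.1 i : ℂ) + Complex.I * p.2 i) / 2 * hcs
        + (-(p.1 i : ℂ) / 2 * Complex.sin φ ^ 2 + Complex.I * p.2 i / 2 * Complex.sin φ ^ 2
          + p.2 i * Complex.sin φ * Complex.cos φ) * hI2
    simp_rw [← hc]
    rw [Finset.prod_mul_distrib, Finset.prod_const]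
    have : Complex.exp (φ * Complex.I) ^ d = Complex.exp (φ * Complex.I) ^ (d - I.card)
        * Complex.exp (φ * Complex.I) ^ I.card := by
      rw [← pow_add, Nat.sub_add_cancel hId]
    rw [this]; ring

/-- Remove the constant term. -/
def dropConst {n : ℕ} (a : Finset (Fin n) → ℝ) (I : Finset (Fin n)) : ℝ := if I = ∅ then 0 else a I

lemma mlEval_dropConst {n : ℕ} (a : Finset (Fin n) → ℝ) (x : Fin n → ℝ) :
    mlEval a x = a ∅ + mlEval (dropConst a) x := by
  unfold mlEval dropConst
  rw [← Finset.add_sum_erase _ _ (Finset.mem_univ ∅),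
    ← Finset.add_sum_erase (a := ∅) _ _ (Finset.mem_univ ∅)]
  simp only [Finset.prod_empty, mul_one, if_true, zero_add]
  congr 1
  refine Finset.sum_congr rfl fun I hI => ?_
  simp [Finset.ne_of_mem_erase hI]

lemma DegLE.dropConst {n d : ℕ} {a : Finset (Fin n) → ℝ} (h : DegLE a d) :
    DegLE (dropConst a) d := by
  intro I hI
  simp only [_root_.dropConst] at hI
  split_ifs at hI with h0
  · simp at hI
  · exact h I hI

lemma sum_sq_dropConst {n : ℕ} (a : Finset (Fin n) → ℝ) :
    ∑ I, a I ^ 2 = a ∅ ^ 2 + ∑ I, dropConst a I ^ 2 := by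
  rw [← Finset.add_sum_erase _ _ (Finset.mem_univ ∅),
    ← Finset.add_sum_erase _ (fun I => dropConst a I ^ 2) (Finset.mem_univ ∅)]
  simp only [dropConst, if_true]
  congr 1
  simp only [ne_eq, OfNat.ofNat_ne_zero, not_false_eq_true, zero_pow, zero_add]
  refine Finset.sum_congr rfl fun I hI => ?_
  simp [Finset.ne_of_mem_erase hI]

lemma sum_wsq {n : ℕ} (a : Finset (Fin n) → ℝ) : ∑ i, wsq a i = ∑ I, (I.card : ℝ) * a I ^ 2 := by
  simp only [wsq, Finset.sum_filter]
  rw [Finset.sum_comm]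
  refine Finset.sum_congr rfl fun I _ => ?_
  rw [Finset.sum_ite_mem, Finset.univ_inter, Finset.sum_const, nsmul_eq_mul]

lemma sum_sq_dropConst_le {n : ℕ} (a : Finset (Fin n) → ℝ) :
    ∑ I, dropConst a I ^ 2 ≤ ∑ i, wsq a i := by
  rw [sum_wsq]
  refine Finset.sum_le_sum fun I _ => ?_
  unfold dropConst
  split_ifs with h
  · simp [h]
  · have : (1 : ℝ) ≤ I.card := by
      exact_mod_cast Finset.card_pos.2 (Finset.nonempty_iff_ne_empty.2 h)
    nlinarith [sq_nonneg (a I)]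

lemma dirCoef_dropConst {n : ℕ} (a : Finset (Fin n) → ℝ) (y : Fin n → ℝ) :
    dirCoef (dropConst a) y = dirCoef a y := by
  ext J
  simp [dirCoef, coefDeriv, dropConst]

lemma measurableSet_dirSmall {n : ℕ} (a : Finset (Fin n) → ℝ) (ρ : ℝ) :
    MeasurableSet {p : (Fin n → ℝ) × (Fin n → ℝ) |
      |mlEval a p.1| < ρ * |mlEval (dirCoef a p.2) p.1|} := by
  have h1 := measurable_mlEval a
  have h2 := measurable_mlEval_dirCoef a
  exact measurableSet_lt (by fun_prop) (h2.abs.const_mul ρ)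

lemma measure_eq_lintegral_rot {n : ℕ} {B : Set ((Fin n → ℝ) × (Fin n → ℝ))}
    (hB : MeasurableSet B) :
    ((gaussn n).prod (gaussn n)) B = ∫⁻ p, volume {φ : ℝ | φ ∈ Set.Icc (0 : ℝ) 1 ∧ rot φ p ∈ B}
      ∂((gaussn n).prod (gaussn n)) := by
  set μ2 := (gaussn n).prod (gaussn n) with hμ2
  have hT : MeasurableSet {q : ℝ × ((Fin n → ℝ) × (Fin n → ℝ)) | rot q.1 q.2 ∈ B} :=
    measurable_rot hB
  have e1 := Measure.prod_apply (μ := volume.restrict (Set.Icc (0 : ℝ) 1)) (ν := μ2) hT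
  have e2 := Measure.prod_apply_symm (μ := volume.restrict (Set.Icc (0 : ℝ) 1)) (ν := μ2) hT
  have e3 : ∀ φ : ℝ, μ2 (Prod.mk φ ⁻¹' {q : ℝ × ((Fin n → ℝ) × (Fin n → ℝ)) | rot q.1 q.2 ∈ B})
      = μ2 B := fun φ => (measurePreserving_rot φ).measure_preimage hB.nullMeasurableSet
  simp_rw [e3] at e1
  rw [e2] at e1
  rw [lintegral_const, Measure.restrict_apply_univ, Real.volume_Icc] at e1
  simp only [sub_zero, ENNReal.ofReal_one, mul_one] at e1
  rw [← e1]
  refine lintegral_congr fun p => ?_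
  rw [Measure.restrict_apply (hT.preimage (by fun_prop))]
  congr 1
  ext φ
  simp [and_comm]

/-- A polynomial is rarely much smaller than its derivative in a random Gaussian direction. -/
lemma dirSmall_le {d : ℕ} (hd : 1 ≤ d) : ∃ C : ℝ, 0 < C ∧ ∀ (n : ℕ) (a : Finset (Fin n) → ℝ),
    DegLE a d → ∀ ρ : ℝ, 0 < ρ → ρ ≤ 1 →
      ((gaussn n).prod (gaussn n)).real {p | |mlEval a p.1| < ρ * |mlEval (dirCoef a p.2) p.1|}
        * ∑ I, a I ^ 2 ≤ C * ρ * ∑ i, wsq a i := by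
  obtain ⟨C, hC, hsup⟩ := trig_sup d
  refine ⟨32 * d ^ 2 * (1 + 4 * C ^ 2 * (2 * d + 1) * (2 * d + 1)), by positivity,
    fun n a ha ρ hρ hρ1 => ?_⟩
  set μ2 := (gaussn n).prod (gaussn n) with hμ2
  set B := {p : (Fin n → ℝ) × (Fin n → ℝ) | |mlEval a p.1| < ρ * |mlEval (dirCoef a p.2) p.1|}
    with hB
  have hBm : MeasurableSet B := measurableSet_dirSmall a ρ
  set h := dropConst a with hh
  set s2 := ∑ I, h I ^ 2 with hs2
  have hs2' : ∑ I, a I ^ 2 = a ∅ ^ 2 + s2 := sum_sq_dropConst a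
  have hs20 : 0 ≤ s2 := Finset.sum_nonneg fun I _ => sq_nonneg _
  set H : (Fin n → ℝ) × (Fin n → ℝ) → ℝ := fun p =>
    ∑ k ∈ range (2 * d + 1), mlEval h (rot (trigNode d k) p).1 ^ 2 with hH
  have hH0 : ∀ p, 0 ≤ H p := fun p => Finset.sum_nonneg fun k _ => sq_nonneg _
  have hmp : ∀ k, MeasurePreserving (fun p : (Fin n → ℝ) × (Fin n → ℝ) =>
      (rot (trigNode d k) p).1) μ2 (gaussn n) := fun k =>
    measurePreserving_fst.comp (measurePreserving_rot (trigNode d k))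
  have hInt1 : Integrable (fun x => mlEval h x ^ 2) (gaussn n) := integrable_mlEval_pow _ h 2
  have hHint : ∀ k, Integrable (fun p => mlEval h (rot (trigNode d k) p).1 ^ 2) μ2 := fun k =>
    (hmp k).integrable_comp_of_integrable hInt1
  have hHI : ∫ p, H p ∂μ2 = (2 * d + 1) * s2 := by
    rw [hH, integral_finsetSum _ fun k _ => hHint k]
    have : ∀ k ∈ range (2 * d + 1), ∫ p, mlEval h (rot (trigNode d k) p).1 ^ 2 ∂μ2 = s2 := by
      intro k _
      have e := integral_map (hmp k).measurable.aemeasurable (f := fun x => mlEval h x ^ 2)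
        (by rw [(hmp k).map_eq]; exact hInt1.aestronglyMeasurable)
      rw [(hmp k).map_eq] at e
      rw [← e]
      exact integral_mlEval_sq _ h
    rw [Finset.sum_congr rfl this, Finset.sum_const, Finset.card_range, nsmul_eq_mul]
    push_cast; ring
  set D : ℝ := 32 * d ^ 2 * ρ with hD
  have hD0 : 0 ≤ D := by positivity
  have pw : ∀ p, volume {φ : ℝ | φ ∈ Set.Icc (0 : ℝ) 1 ∧ rot φ p ∈ B} * ENNReal.ofReal (a ∅ ^ 2 + s2)
      ≤ ENNReal.ofReal (D * (s2 + 4 * C ^ 2 * (2 * d + 1) * H p)) := by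
    intro p
    have hg := trig_small hd (trigPoly_rot ha p) (hasDerivAt_rot a p) hρ
    rcases Set.eq_empty_or_nonempty {φ : ℝ | φ ∈ Set.Icc (0 : ℝ) 1 ∧ rot φ p ∈ B} with he | ⟨φ, -, hφ⟩
    · rw [he]; simp
    have hφ' : |mlEval a (rot φ p).1| < ρ * |mlEval (dirCoef a (rot φ p).2) (rot φ p).1| := hφ
    have hsp := hsup _ _ (trigPoly_rot ha.dropConst p) (hasDerivAt_rot _ p) φ
    rw [dirCoef_dropConst] at hsp
    obtain ⟨u1, u2⟩ := hsp
    set S1 := ∑ k ∈ range (2 * d + 1), |mlEval (dropConst a) (rot (trigNode d k) p).1| with hS1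
    have hcs : S1 ^ 2 ≤ (2 * d + 1) * H p := by
      have := sq_sum_le_card_mul_sum_sq (s := range (2 * d + 1))
        (f := fun k => |mlEval (dropConst a) (rot (trigNode d k) p).1|)
      simp only [sq_abs, Finset.card_range] at this
      rw [hS1, hH]
      push_cast at this
      exact this
    have hc : |a ∅| ≤ 2 * C * S1 := by
      have e := mlEval_dropConst a (rot φ p).1
      have e2 : |a ∅| ≤ |mlEval a (rot φ p).1| + |mlEval (dropConst a) (rot φ p).1| := by
        rw [show a ∅ = mlEval a (rot φ p).1 - mlEval (dropConst a) (rot φ p).1 by rw [e]; ring]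
        exact abs_sub _ _
      have e3 : ρ * |mlEval (dirCoef a (rot φ p).2) (rot φ p).1|
          ≤ 1 * |mlEval (dirCoef a (rot φ p).2) (rot φ p).1| := by gcongr
      linarith
    have hc2 : a ∅ ^ 2 ≤ 4 * C ^ 2 * (2 * d + 1) * H p := by
      have : a ∅ ^ 2 ≤ (2 * C * S1) ^ 2 := by
        rw [← sq_abs]; exact pow_le_pow_left₀ (abs_nonneg _) hc 2
      calc a ∅ ^ 2 ≤ 4 * C ^ 2 * S1 ^ 2 := by linarith [this]
        _ ≤ 4 * C ^ 2 * ((2 * d + 1) * H p) := by gcongr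
        _ = _ := by ring
    calc _ ≤ ENNReal.ofReal D * ENNReal.ofReal (a ∅ ^ 2 + s2) := by gcongr; exact hg
      _ = ENNReal.ofReal (D * (a ∅ ^ 2 + s2)) := (ENNReal.ofReal_mul hD0).symm
      _ ≤ _ := by
        refine ENNReal.ofReal_le_ofReal (mul_le_mul_of_nonneg_left ?_ hD0)
        linarith
  have hHi : Integrable H μ2 := integrable_finsetSum _ fun k _ => hHint k
  have main : μ2 B * ENNReal.ofReal (a ∅ ^ 2 + s2)
      ≤ ENNReal.ofReal (D * (s2 + 4 * C ^ 2 * (2 * d + 1) * ((2 * d + 1) * s2))) := by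
    rw [measure_eq_lintegral_rot hBm, ← lintegral_mul_const' _ _ ENNReal.ofReal_ne_top]
    refine (lintegral_mono pw).trans ?_
    rw [← ofReal_integral_eq_lintegral_ofReal]
    · refine ENNReal.ofReal_le_ofReal (le_of_eq ?_)
      rw [integral_const_mul, integral_add (integrable_const _) (hHi.const_mul _),
        integral_const_mul, hHI]
      simp
    · exact ((integrable_const _).add (hHi.const_mul _)).const_mul _
    · refine Filter.Eventually.of_forall fun p => ?_
      have := hH0 p
      simp only [Pi.zero_apply]
      positivity
  have main' := ENNReal.toReal_mono ENNReal.ofReal_ne_top main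
  rw [ENNReal.toReal_mul, ENNReal.toReal_ofReal (by positivity),
    ENNReal.toReal_ofReal (by positivity)] at main'
  rw [hs2', measureReal_def]
  refine main'.trans ?_
  have hle : s2 ≤ ∑ i, wsq a i := sum_sq_dropConst_le a
  calc D * (s2 + 4 * C ^ 2 * (2 * d + 1) * ((2 * d + 1) * s2))
      = 32 * d ^ 2 * (1 + 4 * C ^ 2 * (2 * d + 1) * (2 * d + 1)) * ρ * s2 := by rw [hD]; ring
    _ ≤ _ := by gcongr

lemma measurePreserving_linear {n : ℕ} (b : Fin n → ℝ) (hb : ∑ i, b i ^ 2 = 1) :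
    MeasurePreserving (fun x : Fin n → ℝ => ∑ i, b i * x i) (gaussn n) (gaussianReal 0 1) := by
  have hm : Measurable (fun x : Fin n → ℝ => ∑ i, b i * x i) := by fun_prop
  refine ⟨hm, ?_⟩
  have : IsProbabilityMeasure ((gaussn n).map (fun x : Fin n → ℝ => ∑ i, b i * x i)) :=
    Measure.isProbabilityMeasure_map hm.aemeasurable
  refine Measure.ext_of_charFun ?_
  ext t
  rw [charFun_apply_real, integral_map hm.aemeasurable (by fun_prop), charFun_gaussianReal]
  have e : ∀ x : Fin n → ℝ, Complex.exp (t * ((∑ i, b i * x i : ℝ) : ℂ) * Complex.I)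
      = ∏ i, Complex.exp (((t * b i : ℝ) : ℂ) * x i * Complex.I) := by
    intro x
    rw [← Complex.exp_sum]
    congr 1
    push_cast
    rw [Finset.mul_sum, Finset.sum_mul]
    exact Finset.sum_congr rfl fun i _ => by ring
  simp_rw [e]
  unfold gaussn
  rw [integral_fintype_prod_eq_prod (fun i (y : ℝ) =>
    Complex.exp (((t * b i : ℝ) : ℂ) * y * Complex.I))]
  have e2 : ∀ i, ∫ y : ℝ, Complex.exp (((t * b i : ℝ) : ℂ) * y * Complex.I) ∂gaussianReal 0 1
      = Complex.exp (-(t ^ 2 / 2 : ℝ) * (b i ^ 2 : ℝ)) := by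
    intro i
    rw [← charFun_apply_real, charFun_gaussianReal]
    congr 1
    push_cast
    ring
  simp_rw [e2]
  rw [← Complex.exp_sum, ← Finset.mul_sum, ← Complex.ofReal_sum, hb]
  congr 1
  push_cast
  ring

lemma gaussianReal_le_volume : gaussianReal 0 1 ≤ (volume : Measure ℝ) := by
  rw [gaussianReal_of_var_ne_zero _ one_ne_zero]
  calc volume.withDensity (gaussianPDF 0 1) ≤ volume.withDensity 1 := by
        refine withDensity_mono (Filter.Eventually.of_forall fun x => ?_)
        rw [gaussianPDF, Pi.one_apply, ENNReal.ofReal_le_one, gaussianPDFReal]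
        have h1 : (√(2 * Real.pi * (1 : NNReal)))⁻¹ ≤ 1 := by
          refine inv_le_one_of_one_le₀ ?_
          rw [Real.one_le_sqrt]
          have := Real.pi_gt_three
          push_cast
          linarith
        have h2 : Real.exp (-(x - 0) ^ 2 / (2 * (1 : NNReal))) ≤ 1 := by
          rw [Real.exp_le_one_iff]
          have := sq_nonneg x
          push_cast
          simp only [sub_zero]
          linarith
        exact mul_le_one₀ h1 (Real.exp_nonneg _) h2
    _ = volume := withDensity_one

lemma integrable_abs_rpow_neg {p : ℝ} (hp : 0 ≤ p) (hp1 : p < 1) :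
    Integrable (fun z : ℝ => |z| ^ (-p)) (gaussianReal 0 1) := by
  have hm : Measurable fun z : ℝ => |z| ^ (-p) := by fun_prop
  have h0 : IntervalIntegrable (fun z : ℝ => z ^ (-p)) volume 0 1 :=
    intervalIntegral.intervalIntegrable_rpow' (by linarith)
  have h1 : IntegrableOn (fun z : ℝ => |z| ^ (-p)) (Set.Ioc 0 1) volume := by
    rw [intervalIntegrable_iff_integrableOn_Ioc_of_le zero_le_one] at h0
    refine h0.congr_fun (fun z hz => ?_) measurableSet_Ioc
    simp only [abs_of_pos hz.1]
  have h2 : IntegrableOn (fun z : ℝ => |z| ^ (-p)) (Set.Ico (-1) 0) volume := by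
    have := (Measure.measurePreserving_neg (volume : Measure ℝ)).integrableOn_comp_preimage
      (Homeomorph.neg ℝ).measurableEmbedding (f := fun z : ℝ => |z| ^ (-p)) (s := Set.Ioc 0 1)
    have h3 := this.2 h1
    have e : (Neg.neg ⁻¹' Set.Ioc (0 : ℝ) 1) = Set.Ico (-1) 0 := by
      ext z; simp only [Set.mem_preimage, Set.mem_Ioc, Set.mem_Ico]
      constructor <;> rintro ⟨a, b⟩ <;> constructor <;> linarith
    rw [e] at h3
    refine h3.congr_fun (fun z _ => ?_) measurableSet_Ico
    simp
  have h3 : IntegrableOn (fun z : ℝ => |z| ^ (-p)) {0} volume := by simp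
  have h4 := ((h2.union h1).union h3).mono_measure gaussianReal_le_volume
  rw [← integrableOn_univ]
  have h5 : IntegrableOn (fun z : ℝ => |z| ^ (-p))
      ((Set.Ico (-1) 0 ∪ Set.Ioc 0 1) ∪ {0})ᶜ (gaussianReal 0 1) := by
    refine Measure.integrableOn_of_bounded (M := 1) (measure_ne_top _ _) hm.aestronglyMeasurable ?_
    rw [ae_restrict_iff' (by measurability)]
    refine Filter.Eventually.of_forall fun z hz => ?_
    have hz1 : 1 ≤ |z| := by
      by_contra hlt
      push Not at hlt
      obtain ⟨u, v⟩ := abs_lt.1 hlt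
      apply hz
      rcases lt_trichotomy z 0 with h | h | h
      · exact Or.inl (Or.inl ⟨u.le, h⟩)
      · exact Or.inr h
      · exact Or.inl (Or.inr ⟨h, v.le⟩)
    rw [Real.norm_of_nonneg (by positivity)]
    exact Real.rpow_le_one_of_one_le_of_nonpos hz1 (by linarith)
  simpa using h4.union h5

/-- Convexity of `x ↦ x ^ (-κ)` on the positive reals. -/
lemma rpow_neg_sum_le {ι : Type*} (s : Finset ι) (w x : ι → ℝ) (hw : ∀ i ∈ s, 0 ≤ w i)
    (hw1 : ∑ i ∈ s, w i = 1) (hx : ∀ i ∈ s, 0 < x i) {κ : ℝ} (hκ : 0 ≤ κ) :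
    (∑ i ∈ s, w i * x i) ^ (-κ) ≤ ∑ i ∈ s, w i * x i ^ (-κ) := by
  have h1 := Real.geom_mean_le_arith_mean_weighted s w x hw hw1 fun i hi => (hx i hi).le
  have h2 := Real.geom_mean_le_arith_mean_weighted s w (fun i => x i ^ (-κ)) hw hw1
    fun i hi => (Real.rpow_pos_of_pos (hx i hi) _).le
  refine le_trans ?_ h2
  have hp : 0 < ∏ i ∈ s, x i ^ w i :=
    Finset.prod_pos fun i hi => Real.rpow_pos_of_pos (hx i hi) _
  refine (Real.rpow_le_rpow_of_nonpos hp h1 (by linarith)).trans (le_of_eq ?_)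
  rw [← Real.finsetProd_rpow _ _ fun i hi => (Real.rpow_pos_of_pos (hx i hi) _).le]
  refine Finset.prod_congr rfl fun i hi => ?_
  rw [← Real.rpow_mul (hx i hi).le, ← Real.rpow_mul (hx i hi).le, mul_comm]

lemma integral_gaussian_rpow_le {κ : ℝ} (hκ : 0 ≤ κ) (hκ1 : 2 * κ < 1) {V u : ℝ} (hV : 0 < V)
    (hu : 0 < u) :
    ∫ z, (V * z ^ 2 + u ^ 2) ^ (-κ) ∂gaussianReal 0 1
      ≤ (∫ z, |z| ^ (-(2 * κ)) ∂gaussianReal 0 1) * V ^ (-κ) := by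
  rw [mul_comm, ← integral_const_mul]
  have hu2 : 0 < u ^ 2 := by positivity
  refine integral_mono_ae ?_ ((integrable_abs_rpow_neg (by linarith) hκ1).const_mul _) ?_
  · refine Integrable.of_bound (C := (u ^ 2) ^ (-κ)) (Measurable.aestronglyMeasurable (by fun_prop))
      (Filter.Eventually.of_forall fun z => ?_)
    rw [Real.norm_of_nonneg (by positivity)]
    exact Real.rpow_le_rpow_of_nonpos hu2 (by nlinarith [sq_nonneg z]) (by linarith)
  · have h0 : ∀ᵐ z ∂gaussianReal 0 1, z ≠ 0 :=
      ae_mono gaussianReal_le_volume (compl_mem_ae_iff.2 (measure_singleton (0 : ℝ)))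
    filter_upwards [h0] with z hz
    have hz2 : 0 < z ^ 2 := by positivity
    calc (V * z ^ 2 + u ^ 2) ^ (-κ) ≤ (V * z ^ 2) ^ (-κ) :=
          Real.rpow_le_rpow_of_nonpos (by positivity) (by linarith) (by linarith)
      _ = V ^ (-κ) * |z| ^ (-(2 * κ)) := by
        rw [Real.mul_rpow hV.le hz2.le, ← sq_abs, ← Real.rpow_natCast, ← Real.rpow_mul (abs_nonneg _)]
        congr 2
        push_cast; ring

lemma integral_rpow_dirCoef_le {κ : ℝ} (hκ : 0 ≤ κ) (hκ1 : 2 * κ < 1) {n : ℕ}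
    (a : Finset (Fin n) → ℝ) (hV : 0 < ∑ i, wsq a i) {u : ℝ} (hu : 0 < u) :
    ∫ y, (∑ J, dirCoef a y J ^ 2 + u ^ 2) ^ (-κ) ∂gaussn n
      ≤ (∫ z, |z| ^ (-(2 * κ)) ∂gaussianReal 0 1) * (∑ i, wsq a i) ^ (-κ) := by
  set V := ∑ i, wsq a i with hVd
  set β : Finset (Fin n) → ℝ := fun J => ∑ i, coefDeriv a i J ^ 2 with hβ
  set s := univ.filter (fun J : Finset (Fin n) => β J ≠ 0) with hs
  have hβ0 : ∀ J, 0 ≤ β J := fun J => Finset.sum_nonneg fun i _ => sq_nonneg _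
  have hβp : ∀ J ∈ s, 0 < β J := fun J hJ =>
    lt_of_le_of_ne (hβ0 J) (Ne.symm (Finset.mem_filter.1 hJ).2)
  have hsum : ∑ J ∈ s, β J = V := by
    rw [hs, Finset.sum_filter_ne_zero, hβ, Finset.sum_comm, hVd]
    exact Finset.sum_congr rfl fun i _ => sum_sq_coefDeriv a i
  have hu2 : 0 < u ^ 2 := by positivity
  set z : Finset (Fin n) → (Fin n → ℝ) → ℝ := fun J y =>
    ∑ i, (coefDeriv a i J / √(β J)) * y i with hz
  have hzd : ∀ J ∈ s, ∀ y, β J * z J y ^ 2 = dirCoef a y J ^ 2 := by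
    intro J hJ y
    have h1 : z J y = dirCoef a y J / √(β J) := by
      simp only [hz, dirCoef, Finset.sum_div]
      exact Finset.sum_congr rfl fun i _ => by ring
    rw [h1, div_pow, Real.sq_sqrt (hβ0 J)]
    field_simp [(hβp J hJ).ne']
  have hz0 : ∀ J, J ∉ s → ∀ y, dirCoef a y J = 0 := by
    intro J hJ y
    have : β J = 0 := by by_contra h; exact hJ (by simp [hs, h])
    refine Finset.sum_eq_zero fun i _ => ?_
    have := (Finset.sum_eq_zero_iff_of_nonneg fun i _ => sq_nonneg _).1 this i (Finset.mem_univ i)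
    rw [pow_eq_zero_iff two_ne_zero] at this
    rw [this, mul_zero]
  have hmp : ∀ J ∈ s, MeasurePreserving (z J) (gaussn n) (gaussianReal 0 1) := by
    intro J hJ
    refine measurePreserving_linear _ ?_
    simp_rw [div_pow, Real.sq_sqrt (hβ0 J)]
    rw [← Finset.sum_div]
    exact div_self (hβp J hJ).ne'
  have pw : ∀ y, (∑ J, dirCoef a y J ^ 2 + u ^ 2) ^ (-κ)
      ≤ ∑ J ∈ s, β J / V * (V * z J y ^ 2 + u ^ 2) ^ (-κ) := by
    intro y
    have hj := rpow_neg_sum_le s (fun J => β J / V) (fun J => V * z J y ^ 2 + u ^ 2)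
      (fun J _ => div_nonneg (hβ0 J) hV.le) (by rw [← Finset.sum_div, hsum, div_self hV.ne'])
      (fun J _ => by positivity) hκ
    refine le_trans (le_of_eq ?_) hj
    congr 1
    have e : ∀ J ∈ s, β J / V * (V * z J y ^ 2 + u ^ 2) = dirCoef a y J ^ 2 + β J / V * u ^ 2 := by
      intro J hJ
      rw [← hzd J hJ]; field_simp
    rw [Finset.sum_congr rfl e, Finset.sum_add_distrib, ← Finset.sum_mul, ← Finset.sum_div, hsum,
      div_self hV.ne', one_mul]
    congr 1
    symm
    refine Finset.sum_subset (Finset.subset_univ _) fun J _ hJ => ?_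
    rw [hz0 J hJ]; simp
  have hmz : ∀ J, Measurable (z J) := fun J => by fun_prop
  have hmd : ∀ J, Measurable fun y : Fin n → ℝ => dirCoef a y J := by
    intro J; unfold dirCoef; fun_prop
  have hi : ∀ f : (Fin n → ℝ) → ℝ, Measurable f → (∀ y, 0 ≤ f y) →
      Integrable (fun y => (f y + u ^ 2) ^ (-κ)) (gaussn n) := by
    intro f hf hf0
    refine Integrable.of_bound (C := (u ^ 2) ^ (-κ)) (Measurable.aestronglyMeasurable (by fun_prop))
      (Filter.Eventually.of_forall fun y => ?_)
    have := hf0 y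
    rw [Real.norm_of_nonneg (by positivity)]
    exact Real.rpow_le_rpow_of_nonpos hu2 (by linarith) (by linarith)
  have hiz : ∀ J ∈ s, Integrable (fun y => β J / V * (V * z J y ^ 2 + u ^ 2) ^ (-κ)) (gaussn n) :=
    fun J _ => (hi _ (by fun_prop) fun y => by positivity).const_mul _
  refine (integral_mono (hi _ (by fun_prop) fun y => by positivity)
    (integrable_finsetSum _ hiz) pw).trans ?_
  rw [integral_finsetSum _ hiz]
  have hterm : ∀ J ∈ s, ∫ y, β J / V * (V * z J y ^ 2 + u ^ 2) ^ (-κ) ∂gaussn n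
      ≤ β J / V * ((∫ z, |z| ^ (-(2 * κ)) ∂gaussianReal 0 1) * V ^ (-κ)) := by
    intro J hJ
    rw [integral_const_mul]
    refine mul_le_mul_of_nonneg_left ?_ (div_nonneg (hβ0 J) hV.le)
    have e := integral_map (μ := gaussn n) (hmz J).aemeasurable
      (f := fun w : ℝ => (V * w ^ 2 + u ^ 2) ^ (-κ)) (Measurable.aestronglyMeasurable (by fun_prop))
    rw [(hmp J hJ).map_eq] at e
    rw [← e]
    exact integral_gaussian_rpow_le hκ hκ1 hV hu
  refine (Finset.sum_le_sum hterm).trans (le_of_eq ?_)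
  rw [← Finset.sum_mul, ← Finset.sum_div, hsum, div_self hV.ne', one_mul]

/-- Second-moment tail bound. -/
lemma measureReal_ge_le {Ω : Type*} [MeasurableSpace Ω] {μ : Measure Ω} [IsFiniteMeasure μ]
    {f : Ω → ℝ} (hf0 : ∀ x, 0 ≤ f x) (hf : Integrable f μ) {r : ℝ} (hr : 0 < r) :
    μ.real {x | r ≤ f x} ≤ (∫ x, f x ∂μ) / r := by
  rw [le_div_iff₀ hr, mul_comm]
  exact mul_meas_ge_le_integral_of_nonneg (Filter.Eventually.of_forall hf0) hf r

/-- A polynomial with small variance and unit second moment is bounded away from zero. -/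
lemma gaussian_small_of_var {n : ℕ} (a : Finset (Fin n) → ℝ) (ha1 : ∑ I, a I ^ 2 = 1) {s t : ℝ}
    (hs : 0 ≤ s) (hts : t ≤ s) (hV : ∑ i, wsq a i ≤ s ^ 2) :
    (gaussn n).real {x | |mlEval a x| ≤ t} ≤ 16 * s ^ 2 := by
  rcases le_or_gt (1 / 4) s with h | h
  · exact measureReal_le_one.trans (by nlinarith)
  have hle := (sum_sq_dropConst_le a).trans hV
  have hsq := sum_sq_dropConst a
  rw [ha1] at hsq
  have hc : 3 / 4 ≤ |a ∅| := by
    by_contra hlt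
    push Not at hlt
    have : a ∅ ^ 2 < (3 / 4) ^ 2 := by
      rw [← sq_abs]; exact pow_lt_pow_left₀ hlt (abs_nonneg _) two_ne_zero
    nlinarith
  have hsub : {x | |mlEval a x| ≤ t} ⊆ {x | 1 / 4 ≤ mlEval (dropConst a) x ^ 2} := by
    intro x hx
    have hx' : |mlEval a x| ≤ t := hx
    have e := mlEval_dropConst a x
    have : |a ∅| ≤ |mlEval a x| + |mlEval (dropConst a) x| := by
      rw [show a ∅ = mlEval a x - mlEval (dropConst a) x by rw [e]; ring]
      exact abs_sub _ _
    have h2 : 1 / 2 ≤ |mlEval (dropConst a) x| := by linarith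
    change 1 / 4 ≤ mlEval (dropConst a) x ^ 2
    rw [← sq_abs]
    nlinarith
  have hI : ∫ x, mlEval (dropConst a) x ^ 2 ∂gaussn n = ∑ I, dropConst a I ^ 2 :=
    integral_mlEval_sq _ _
  have hi : Integrable (fun x => mlEval (dropConst a) x ^ 2) (gaussn n) :=
    integrable_mlEval_pow _ _ 2
  calc _ ≤ (gaussn n).real {x | 1 / 4 ≤ mlEval (dropConst a) x ^ 2} := measureReal_mono hsub
    _ ≤ (∑ I, dropConst a I ^ 2) / (1 / 4) := by
      rw [← hI]; exact measureReal_ge_le (fun x => sq_nonneg _) hi (by norm_num)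
    _ ≤ 16 * s ^ 2 := by rw [div_le_iff₀ (by norm_num)]; nlinarith

lemma gaussianReal_smallBall {c v t : ℝ} (hv : 0 < v) (ht : 0 ≤ t) :
    (gaussianReal 0 1).real {z | |c + v * z| ≤ t} ≤ 2 * t / v := by
  have hsub : {z : ℝ | |c + v * z| ≤ t} ⊆ Set.Icc ((-t - c) / v) ((t - c) / v) := by
    intro z hz
    obtain ⟨h1, h2⟩ := abs_le.1 (show |c + v * z| ≤ t from hz)
    refine ⟨?_, ?_⟩
    · rw [div_le_iff₀ hv]; linarith
    · rw [le_div_iff₀ hv]; linarith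
  have h1 : gaussianReal 0 1 {z | |c + v * z| ≤ t} ≤ ENNReal.ofReal (2 * t / v) := by
    calc _ ≤ volume {z | |c + v * z| ≤ t} := gaussianReal_le_volume _
      _ ≤ volume (Set.Icc ((-t - c) / v) ((t - c) / v)) := measure_mono hsub
      _ = _ := by rw [Real.volume_Icc]; congr 1; ring
  rw [measureReal_def]
  exact ENNReal.toReal_le_of_le_ofReal (by positivity) h1

lemma mlEval_degLE_one {n : ℕ} {a : Finset (Fin n) → ℝ} (ha : DegLE a 1) (x : Fin n → ℝ) :
    mlEval a x = a ∅ + ∑ i, a {i} * x i := by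
  have h : ∀ I : Finset (Fin n), a I * ∏ i ∈ I, x i
      = (if I = ∅ then a ∅ else 0) + ∑ i, if I = {i} then a {i} * x i else 0 := by
    intro I
    rcases Nat.lt_or_ge 1 I.card with hc | hc
    · have h0 : a I = 0 := by by_contra h; exact absurd (ha I h) (by omega)
      rw [h0, zero_mul, if_neg (by rintro rfl; simp at hc), zero_add]
      symm
      refine Finset.sum_eq_zero fun i _ => if_neg ?_
      rintro rfl; simp at hc
    · rcases Nat.le_one_iff_eq_zero_or_eq_one.1 hc with h0 | h1
      · rw [Finset.card_eq_zero] at h0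
        subst h0
        simp [eq_comm (a := (∅ : Finset (Fin n)))]
      · obtain ⟨j, rfl⟩ := Finset.card_eq_one.1 h1
        simp
  simp only [mlEval]
  rw [Finset.sum_congr rfl fun I _ => h I, Finset.sum_add_distrib, Finset.sum_comm]
  simp

lemma sum_wsq_degLE_one {n : ℕ} {a : Finset (Fin n) → ℝ} (ha : DegLE a 1) :
    ∑ i, wsq a i = ∑ i, a {i} ^ 2 := by
  refine Finset.sum_congr rfl fun i _ => ?_
  unfold wsq
  rw [Finset.sum_eq_single {i}]
  · intro I hI hne
    have hi := (Finset.mem_filter.1 hI).2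
    by_contra h
    have hc := ha I fun h0 => h (by rw [h0]; norm_num)
    exact hne (Finset.eq_singleton_iff_unique_mem.2
      ⟨hi, fun j hj => Finset.card_le_one.1 hc j hj i hi⟩)
  · intro h; simp at h

/-- Gaussian small-ball estimate with a given exponent, for normalised polynomials. -/
def SmallBall (d : ℕ) (γ : ℝ) : Prop :=
  ∃ C : ℝ, 1 ≤ C ∧ ∀ (n : ℕ) (a : Finset (Fin n) → ℝ), DegLE a d → ∑ I, a I ^ 2 = 1 →
    ∀ t : ℝ, 0 < t → (gaussn n).real {x | |mlEval a x| ≤ t} ≤ C * t ^ γ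

lemma smallBall_one : SmallBall 1 (2 / 3) := by
  refine ⟨16, by norm_num, fun n a ha ha1 t ht => ?_⟩
  rcases le_or_gt 1 t with ht1 | ht1
  · have := Real.one_le_rpow ht1 (show (0 : ℝ) ≤ 2 / 3 by norm_num)
    exact measureReal_le_one.trans (by linarith)
  set V := ∑ i, wsq a i with hV
  have hV0 : 0 ≤ V := Finset.sum_nonneg fun i _ => Finset.sum_nonneg fun I _ => sq_nonneg _
  set r := t ^ ((1 : ℝ) / 3) with hr
  have hr0 : 0 < r := Real.rpow_pos_of_pos ht _
  have hr1 : r ≤ 1 := Real.rpow_le_one ht.le ht1.le (by norm_num)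
  have hr2 : t ^ ((2 : ℝ) / 3) = r ^ 2 := by
    rw [hr, ← Real.rpow_natCast, ← Real.rpow_mul ht.le]; norm_num
  have hr3 : t = r ^ 3 := by
    rw [hr, ← Real.rpow_natCast, ← Real.rpow_mul ht.le]; norm_num
  rw [hr2]
  rcases le_or_gt V (r ^ 2) with hle | hgt
  · exact gaussian_small_of_var a ha1 hr0.le (by rw [hr3]; nlinarith [pow_pos hr0 2]) hle
  · set v := √V with hv
    have hv0 : 0 < v := Real.sqrt_pos.2 (lt_of_le_of_lt (by positivity) hgt)
    have hv2 : v ^ 2 = V := Real.sq_sqrt hV0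
    have hrv : r ≤ v := by
      rw [hv]; exact Real.le_sqrt_of_sq_le hgt.le
    have hmp := measurePreserving_linear (fun i => a {i} / v) (by
      simp_rw [div_pow]
      rw [← Finset.sum_div, hv2, ← sum_wsq_degLE_one ha]
      exact div_self (by rw [← hV, ← hv2]; positivity))
    have hset : {x | |mlEval a x| ≤ t} = (fun x : Fin n → ℝ => ∑ i, a {i} / v * x i) ⁻¹'
        {z | |a ∅ + v * z| ≤ t} := by
      ext x
      simp only [Set.mem_preimage, Set.mem_ofPred_eq]
      rw [mlEval_degLE_one ha, Finset.mul_sum]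
      have : ∀ i, v * (a {i} / v * x i) = a {i} * x i := fun i => by field_simp
      simp_rw [this]
    have hm : MeasurableSet {z : ℝ | |a ∅ + v * z| ≤ t} :=
      measurableSet_le (by fun_prop) (by fun_prop)
    rw [measureReal_def, hset, hmp.measure_preimage hm.nullMeasurableSet, ← measureReal_def]
    refine (gaussianReal_smallBall hv0 ht.le).trans ?_
    rw [div_le_iff₀ hv0, hr3]
    nlinarith [pow_pos hr0 2, mul_le_mul_of_nonneg_left hrv (pow_pos hr0 2).le]

lemma mlEval_smul {n : ℕ} (a : Finset (Fin n) → ℝ) (c : ℝ) (x : Fin n → ℝ) :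
    mlEval (fun I => c * a I) x = c * mlEval a x := by
  simp only [mlEval, Finset.mul_sum]
  exact Finset.sum_congr rfl fun I _ => by ring

lemma DegLE.dirCoef {n d : ℕ} {a : Finset (Fin n) → ℝ} (h : DegLE a (d + 1)) (y : Fin n → ℝ) :
    DegLE (dirCoef a y) d := by
  intro J hJ
  obtain ⟨i, -, hi⟩ := Finset.exists_ne_zero_of_sum_ne_zero hJ
  exact h.coefDeriv i J (right_ne_zero_of_mul hi)

lemma sum_wsq_le {n d : ℕ} {a : Finset (Fin n) → ℝ} (h : DegLE a d) :
    ∑ i, wsq a i ≤ d * ∑ I, dropConst a I ^ 2 := by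
  rw [sum_wsq, Finset.mul_sum]
  refine Finset.sum_le_sum fun I _ => ?_
  unfold dropConst
  split_ifs with h0
  · simp [h0]
  · by_cases h1 : a I = 0
    · simp [h1]
    · have : (I.card : ℝ) ≤ d := by exact_mod_cast h I h1
      gcongr

lemma smallBall_scale {d : ℕ} {γ C : ℝ}
    (hC : ∀ (n : ℕ) (a : Finset (Fin n) → ℝ), DegLE a d → ∑ I, a I ^ 2 = 1 →
      ∀ t : ℝ, 0 < t → (gaussn n).real {x | |mlEval a x| ≤ t} ≤ C * t ^ γ)
    {n : ℕ} {a : Finset (Fin n) → ℝ} (ha : DegLE a d) (hN : 0 < ∑ I, a I ^ 2) {t : ℝ}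
    (ht : 0 < t) :
    (gaussn n).real {x | |mlEval a x| ≤ t} ≤ C * (t ^ γ * (∑ I, a I ^ 2) ^ (-(γ / 2))) := by
  set N := ∑ I, a I ^ 2 with hNd
  have hs : 0 < √N := Real.sqrt_pos.2 hN
  have h := hC n (fun I => (√N)⁻¹ * a I) (fun I hI => ha I (right_ne_zero_of_mul hI))
    (by simp_rw [mul_pow]; rw [← Finset.mul_sum, ← hNd, inv_pow, Real.sq_sqrt hN.le,
          inv_mul_cancel₀ hN.ne']) ((√N)⁻¹ * t) (by positivity)
  have hset : {x | |mlEval (fun I => (√N)⁻¹ * a I) x| ≤ (√N)⁻¹ * t} = {x | |mlEval a x| ≤ t} := by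
    ext x
    simp only [Set.mem_ofPred_eq]
    rw [mlEval_smul, abs_mul, abs_of_pos (inv_pos.2 hs), mul_le_mul_iff_right₀ (inv_pos.2 hs)]
  rw [hset, Real.mul_rpow (inv_pos.2 hs).le ht.le, Real.inv_rpow hs.le, ← Real.rpow_neg hs.le,
    Real.sqrt_eq_rpow, ← Real.rpow_mul hN.le] at h
  refine h.trans (le_of_eq ?_)
  rw [show (1 / 2 : ℝ) * -γ = -(γ / 2) by ring]
  ring

/-- Small-ball estimate valid also for polynomials with tiny second moment. -/
lemma smallBall_truncated {d : ℕ} {γ' C : ℝ} (h0 : 0 < γ') (h1 : γ' < 1) (hC1 : 1 ≤ C)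
    (hC : ∀ (n : ℕ) (a : Finset (Fin n) → ℝ), DegLE a d → ∑ I, a I ^ 2 = 1 →
      ∀ t : ℝ, 0 < t → (gaussn n).real {x | |mlEval a x| ≤ t} ≤ C * t ^ γ')
    {n : ℕ} {a : Finset (Fin n) → ℝ} (ha : DegLE a d) {u : ℝ} (hu0 : 0 < u) :
    (gaussn n).real {x | |mlEval a x| ≤ u}
      ≤ 2 * C * u ^ γ' * (∑ J, a J ^ 2 + u ^ 2) ^ (-(γ' / 2)) := by
  set N := ∑ J, a J ^ 2 with hN
  have hN0 : 0 ≤ N := Finset.sum_nonneg fun J _ => sq_nonneg _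
  have h2k : (2 : ℝ) ^ (-(γ' / 2)) ≥ 1 / 2 := by
    have := Real.rpow_le_rpow_of_exponent_le (x := 2) (by norm_num) (show (-1 : ℝ) ≤ -(γ' / 2) by linarith)
    rw [Real.rpow_neg_one] at this
    linarith
  rcases le_or_gt N (u ^ 2) with hNu | hNu
  · have e1 : (2 * u ^ 2) ^ (-(γ' / 2)) ≤ (N + u ^ 2) ^ (-(γ' / 2)) :=
      Real.rpow_le_rpow_of_nonpos (by positivity) (by linarith) (by linarith)
    have e2 : (2 * u ^ 2) ^ (-(γ' / 2)) = (2 : ℝ) ^ (-(γ' / 2)) * u ^ (-γ') := by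
      rw [Real.mul_rpow (by norm_num) (by positivity), ← Real.rpow_natCast, ← Real.rpow_mul hu0.le]
      congr 2
      push_cast; ring
    have e3 : u ^ γ' * u ^ (-γ') = 1 := by
      rw [← Real.rpow_add hu0, add_neg_cancel, Real.rpow_zero]
    have hup : 0 < u ^ γ' := Real.rpow_pos_of_pos hu0 _
    have hun : 0 < u ^ (-γ') := Real.rpow_pos_of_pos hu0 _
    calc (gaussn n).real _ ≤ 1 := measureReal_le_one
      _ ≤ C := hC1
      _ = 2 * C * u ^ γ' * (1 / 2 * u ^ (-γ')) := by
        rw [show 2 * C * u ^ γ' * (1 / 2 * u ^ (-γ')) = C * (u ^ γ' * u ^ (-γ')) by ring, e3,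
          mul_one]
      _ ≤ 2 * C * u ^ γ' * ((2 : ℝ) ^ (-(γ' / 2)) * u ^ (-γ')) := by gcongr
      _ ≤ _ := by rw [← e2]; gcongr
  · have hNp : 0 < N := lt_of_le_of_lt (by positivity) hNu
    refine (smallBall_scale hC ha hNp hu0).trans ?_
    rw [← hN]
    have e1 : (2 * N) ^ (-(γ' / 2)) ≤ (N + u ^ 2) ^ (-(γ' / 2)) :=
      Real.rpow_le_rpow_of_nonpos (by positivity) (by linarith) (by linarith)
    have e2 : (2 * N) ^ (-(γ' / 2)) = (2 : ℝ) ^ (-(γ' / 2)) * N ^ (-(γ' / 2)) :=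
      Real.mul_rpow (by norm_num) hN0
    calc C * (u ^ γ' * N ^ (-(γ' / 2)))
        = 2 * C * u ^ γ' * (1 / 2 * N ^ (-(γ' / 2))) := by ring
      _ ≤ 2 * C * u ^ γ' * ((2 : ℝ) ^ (-(γ' / 2)) * N ^ (-(γ' / 2))) := by gcongr
      _ ≤ _ := by rw [← e2]; gcongr

set_option maxHeartbeats 800000 in
lemma SmallBall.succ {d : ℕ} {γ' γ : ℝ} (h : SmallBall d γ') (h0 : 0 < γ') (h1 : γ' < 1)
    (hγ0 : 0 < γ) (hγ1 : γ < 1) (hγ : γ' * (1 - γ) = γ) : SmallBall (d + 1) γ := by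
  obtain ⟨C, hC1, hC⟩ := h
  obtain ⟨CK, hCK0, hCK⟩ := dirSmall_le (d := d + 1) (by omega)
  set E := ∫ z, |z| ^ (-(2 * (γ' / 2))) ∂gaussianReal 0 1 with hE
  have hE0 : 0 ≤ E := integral_nonneg fun z => by positivity
  have hCE : 0 ≤ C * E := mul_nonneg (by linarith) hE0
  have hCd : 0 ≤ CK * (d + 1) := by positivity
  refine ⟨16 + CK * (d + 1) + 2 * C * E, by linarith, fun n a ha ha1 t ht => ?_⟩
  rcases le_or_gt 1 t with ht1 | ht1
  · have := Real.one_le_rpow ht1 hγ0.le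
    exact measureReal_le_one.trans (by nlinarith)
  set s := t ^ γ with hs
  have hs0 : 0 < s := Real.rpow_pos_of_pos ht _
  have hs1 : s ≤ 1 := Real.rpow_le_one ht.le ht1.le hγ0.le
  have hts : t ≤ s := by
    have := Real.rpow_le_rpow_of_exponent_ge ht ht1.le hγ1.le
    rwa [Real.rpow_one] at this
  set V := ∑ i, wsq a i with hV
  have hV0 : 0 ≤ V := Finset.sum_nonneg fun i _ => Finset.sum_nonneg fun I _ => sq_nonneg _
  rcases le_or_gt V (s ^ 2) with hle | hgt
  · refine (gaussian_small_of_var a ha1 hs0.le hts hle).trans ?_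
    nlinarith [mul_nonneg hCd hs0.le, mul_nonneg hCE hs0.le]
  have hVp : 0 < V := lt_of_le_of_lt (by positivity) hgt
  set v := √V with hv
  have hv0 : 0 < v := Real.sqrt_pos.2 hVp
  have hv2 : v ^ 2 = V := Real.sq_sqrt hV0
  have hsv : s ≤ v := Real.le_sqrt_of_sq_le hgt.le
  have hVd : V ≤ d + 1 := by
    have e1 := sum_wsq_le ha
    have e2 := sum_sq_dropConst a
    rw [ha1] at e2
    have e3 : ∑ I, dropConst a I ^ 2 ≤ 1 := by nlinarith [sq_nonneg (a ∅)]
    have e4 : ((d + 1 : ℕ) : ℝ) * ∑ I, dropConst a I ^ 2 ≤ ((d + 1 : ℕ) : ℝ) * 1 := by gcongr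
    push_cast at e4 e1
    linarith
  have hvd : v ≤ d + 1 := by
    rw [hv, Real.sqrt_le_left (by positivity)]
    nlinarith [show (0 : ℝ) ≤ d by positivity]
  set ρ := s / v with hρ
  have hρ0 : 0 < ρ := by positivity
  have hρ1 : ρ ≤ 1 := (div_le_one hv0).2 hsv
  set u := t / ρ with hu
  have hu0 : 0 < u := by positivity
  set μ2 := (gaussn n).prod (gaussn n) with hμ2
  set B := {p : (Fin n → ℝ) × (Fin n → ℝ) | |mlEval a p.1| < ρ * |mlEval (dirCoef a p.2) p.1|}
    with hB
  set D := {p : (Fin n → ℝ) × (Fin n → ℝ) | |mlEval (dirCoef a p.2) p.1| ≤ u} with hD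
  have hDm : MeasurableSet D :=
    measurableSet_le (measurable_mlEval_dirCoef a).abs measurable_const
  have hma := measurable_mlEval a
  have step1 : (gaussn n).real {x | |mlEval a x| ≤ t} ≤ μ2.real B + μ2.real D := by
    have hm : MeasurableSet {x | |mlEval a x| ≤ t} :=
      measurableSet_le (by fun_prop) (by fun_prop)
    have e : (gaussn n).real {x | |mlEval a x| ≤ t}
        = μ2.real (Prod.fst ⁻¹' {x | |mlEval a x| ≤ t}) := by
      rw [measureReal_def, measureReal_def,
        (measurePreserving_fst (μ := gaussn n) (ν := gaussn n)).measure_preimage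
          hm.nullMeasurableSet]
    rw [e]
    refine (measureReal_mono ?_).trans (measureReal_union_le B D)
    intro p hp
    by_cases hpB : p ∈ B
    · exact Or.inl hpB
    · right
      have h1 : ρ * |mlEval (dirCoef a p.2) p.1| ≤ |mlEval a p.1| := not_lt.1 hpB
      have h2 : |mlEval a p.1| ≤ t := hp
      change |mlEval (dirCoef a p.2) p.1| ≤ u
      rw [hu, le_div_iff₀ hρ0]
      linarith
  have step2 : μ2.real B ≤ CK * (d + 1) * s := by
    have := hCK n a ha ρ hρ0 hρ1
    rw [ha1, mul_one] at this
    refine this.trans ?_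
    have e : CK * ρ * V = CK * s * v := by
      rw [hρ, ← hv2]; field_simp
    calc CK * ρ * ∑ i, wsq a i = CK * s * v := e
      _ ≤ CK * s * (d + 1) := by gcongr
      _ = _ := by ring
  have pw : ∀ y, (gaussn n).real {x | |mlEval (dirCoef a y) x| ≤ u}
      ≤ 2 * C * u ^ γ' * (∑ J, dirCoef a y J ^ 2 + u ^ 2) ^ (-(γ' / 2)) := fun y =>
    smallBall_truncated h0 h1 hC1 hC (ha.dirCoef y) hu0
  have hmd : ∀ J, Measurable fun y : Fin n → ℝ => dirCoef a y J := by
    intro J; unfold dirCoef; fun_prop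
  have hInt : Integrable (fun y => (∑ J, dirCoef a y J ^ 2 + u ^ 2) ^ (-(γ' / 2))) (gaussn n) := by
    refine Integrable.of_bound (C := (u ^ 2) ^ (-(γ' / 2)))
      (Measurable.aestronglyMeasurable (by fun_prop)) (Filter.Eventually.of_forall fun y => ?_)
    have : 0 ≤ ∑ J, dirCoef a y J ^ 2 := Finset.sum_nonneg fun J _ => sq_nonneg _
    rw [Real.norm_of_nonneg (by positivity)]
    exact Real.rpow_le_rpow_of_nonpos (by positivity) (by linarith) (by linarith)
  have step3 : μ2.real D ≤ 2 * C * u ^ γ' * (E * V ^ (-(γ' / 2))) := by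
    have hI := integral_rpow_dirCoef_le (κ := γ' / 2) (by linarith) (by linarith) a hVp hu0
    rw [measureReal_def]
    refine ENNReal.toReal_le_of_le_ofReal (by positivity) ?_
    rw [hμ2, Measure.prod_apply_symm hDm]
    calc ∫⁻ y, gaussn n ((fun x => (x, y)) ⁻¹' D) ∂gaussn n
        ≤ ∫⁻ y, ENNReal.ofReal
            (2 * C * u ^ γ' * (∑ J, dirCoef a y J ^ 2 + u ^ 2) ^ (-(γ' / 2))) ∂gaussn n := by
          refine lintegral_mono fun y => ?_
          rw [← ofReal_measureReal]
          exact ENNReal.ofReal_le_ofReal (pw y)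
      _ = ENNReal.ofReal (∫ y, 2 * C * u ^ γ' *
            (∑ J, dirCoef a y J ^ 2 + u ^ 2) ^ (-(γ' / 2)) ∂gaussn n) := by
          rw [ofReal_integral_eq_lintegral_ofReal (hInt.const_mul _)]
          refine Filter.Eventually.of_forall fun y => ?_
          have : 0 ≤ ∑ J, dirCoef a y J ^ 2 := Finset.sum_nonneg fun J _ => sq_nonneg _
          simp only [Pi.zero_apply]
          positivity
      _ ≤ _ := by
          refine ENNReal.ofReal_le_ofReal ?_
          rw [integral_const_mul]
          gcongr
  have step4 : u ^ γ' * V ^ (-(γ' / 2)) = s := by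
    have e1 : V ^ (-(γ' / 2)) = v ^ (-γ') := by
      rw [← hv2, ← Real.rpow_natCast, ← Real.rpow_mul hv0.le]
      congr 1
      push_cast; ring
    have e2 : u = t ^ (1 - γ) * v := by
      rw [hu, hρ, Real.rpow_sub ht, Real.rpow_one, ← hs]; field_simp
    rw [e1, e2, Real.mul_rpow (by positivity) hv0.le, ← Real.rpow_mul ht.le, mul_assoc,
      ← Real.rpow_add hv0, add_neg_cancel, Real.rpow_zero, mul_one, mul_comm (1 - γ), hγ]
  calc _ ≤ μ2.real B + μ2.real D := step1
    _ ≤ CK * (d + 1) * s + 2 * C * u ^ γ' * (E * V ^ (-(γ' / 2))) := add_le_add step2 step3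
    _ = CK * (d + 1) * s + 2 * C * E * s := by
      rw [← step4]; ring
    _ ≤ _ := by nlinarith

lemma smallBall (d : ℕ) (hd : 1 ≤ d) : SmallBall d (2 / (2 * (d : ℝ) + 1)) := by
  induction d, hd using Nat.le_induction with
  | base => convert smallBall_one using 1; norm_num
  | succ d hd ih =>
    have h1 : (1 : ℝ) ≤ d := by exact_mod_cast hd
    refine ih.succ (by positivity) ?_ (by positivity) ?_ ?_
    · rw [div_lt_one (by positivity)]; linarith
    · push_cast
      rw [div_lt_one (by positivity)]; linarith
    · push_cast
      field_simp
      ring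

lemma rad_real_eq {n : ℕ} {S : Set (Fin n → ℝ)} (hS : MeasurableSet S) :
    (Measure.pi (fun _ : Fin n => rad)).real S
      = (1 / 2 ^ n : ℝ) * ∑ x : Fin n → Bool, if (fun i => pmOne (x i)) ∈ S then (1 : ℝ) else 0 := by
  have h := integral_pi_rad (n := n) (S.indicator 1) (measurable_one.indicator hS)
  rw [integral_indicator_one hS] at h
  rw [h]
  simp [Set.indicator_apply]

lemma sum_noise_weight_mul {n : ℕ} (ε : ℝ) (I : Finset (Fin n)) :
    ∑ s : Fin n → Bool, (∏ i, if s i then ε else 1 - ε) * ∏ i ∈ I, (if s i then (-1 : ℝ) else 1)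
      = (1 - 2 * ε) ^ I.card := by
  have h := Finset.prod_univ_sum (fun _ : Fin n => (univ : Finset Bool))
    (fun i b => (if b then ε else 1 - ε) * if i ∈ I then (if b then (-1 : ℝ) else 1) else 1)
  rw [Fintype.piFinset_univ] at h
  have e : ∀ s : Fin n → Bool, (∏ i, (if s i then ε else 1 - ε) *
      if i ∈ I then (if s i then (-1 : ℝ) else 1) else 1)
      = (∏ i, if s i then ε else 1 - ε) * ∏ i ∈ I, (if s i then (-1 : ℝ) else 1) := by
    intro s
    rw [Finset.prod_mul_distrib, Finset.prod_ite_mem, Finset.univ_inter]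
  rw [← Finset.sum_congr rfl fun s _ => e s, ← h]
  have e2 : ∀ i : Fin n, ∑ b : Bool, ((if b then ε else 1 - ε) *
      if i ∈ I then (if b then (-1 : ℝ) else 1) else 1) = if i ∈ I then 1 - 2 * ε else 1 := by
    intro i
    by_cases hi : i ∈ I
    · simp [hi]; ring
    · simp [hi]
  rw [Finset.prod_congr rfl fun i _ => e2 i, Finset.prod_ite_mem, Finset.univ_inter,
    Finset.prod_const]

lemma sum_noise_weight {n : ℕ} (ε : ℝ) :
    ∑ s : Fin n → Bool, (∏ i, if s i then ε else 1 - ε) = 1 := by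
  simpa using sum_noise_weight_mul (n := n) ε ∅

lemma sum_sq_noise_le {n : ℕ} {ε : ℝ} (h1 : ε < 1) (b : Finset (Fin n) → ℝ) :
    (1 / 2 ^ n : ℝ) * ∑ x : Fin n → Bool, ∑ s : Fin n → Bool, (∏ i, if s i then ε else 1 - ε) *
      (mlEval b (fun i => pmOne (x i)) - mlEval b (fun i => pmOne (xor (s i) (x i)))) ^ 2
      ≤ 4 * ε * ∑ i, wsq b i := by
  rw [Finset.sum_comm, Finset.mul_sum]
  set χ : (Fin n → Bool) → Finset (Fin n) → ℝ := fun s I => ∏ i ∈ I, (if s i then (-1 : ℝ) else 1)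
    with hχ
  have hχ2 : ∀ s I, χ s I ^ 2 = 1 := by
    intro s I
    rw [hχ, ← Finset.prod_pow]
    exact Finset.prod_eq_one fun i _ => by split_ifs <;> norm_num
  have e1 : ∀ s : Fin n → Bool, (1 / 2 ^ n : ℝ) * ∑ x : Fin n → Bool,
      (∏ i, if s i then ε else 1 - ε) *
      (mlEval b (fun i => pmOne (x i)) - mlEval b (fun i => pmOne (xor (s i) (x i)))) ^ 2
      = (∏ i, if s i then ε else 1 - ε) * ∑ I, b I ^ 2 * (2 - 2 * χ s I) := by
    intro s
    have e : ∀ x : Fin n → Bool,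
        mlEval b (fun i => pmOne (x i)) - mlEval b (fun i => pmOne (xor (s i) (x i)))
        = mlEval (fun I => b I * (1 - χ s I)) (fun i => pmOne (x i)) := by
      intro x
      simp only [mlEval, ← Finset.sum_sub_distrib]
      refine Finset.sum_congr rfl fun I _ => ?_
      have : ∏ i ∈ I, pmOne (xor (s i) (x i)) = χ s I * ∏ i ∈ I, pmOne (x i) := by
        rw [hχ, ← Finset.prod_mul_distrib]
        refine Finset.prod_congr rfl fun i _ => ?_
        cases s i <;> cases x i <;> simp [pmOne]
      rw [this]; ring
    simp_rw [e]
    rw [← Finset.mul_sum, ← mul_assoc, mul_comm (1 / 2 ^ n : ℝ), mul_assoc]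
    congr 1
    have hm := measurable_mlEval (fun I => b I * (1 - χ s I))
    have hI := integral_pi_rad (n := n) (fun x => mlEval (fun I => b I * (1 - χ s I)) x ^ 2)
      (by fun_prop)
    rw [← hI, integral_mlEval_sq]
    refine Finset.sum_congr rfl fun I _ => ?_
    linear_combination b I ^ 2 * hχ2 s I
  rw [Finset.sum_congr rfl fun s _ => e1 s]
  rw [sum_wsq]
  simp_rw [Finset.mul_sum]
  rw [Finset.sum_comm]
  refine Finset.sum_le_sum fun I _ => ?_
  have e2 : ∑ s : Fin n → Bool, (∏ i, if s i then ε else 1 - ε) * (b I ^ 2 * (2 - 2 * χ s I))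
      = b I ^ 2 * (2 - 2 * (1 - 2 * ε) ^ I.card) := by
    rw [← sum_noise_weight_mul]
    have : ∀ s : Fin n → Bool, (∏ i, if s i then ε else 1 - ε) * (b I ^ 2 * (2 - 2 * χ s I))
        = b I ^ 2 * 2 * (∏ i, if s i then ε else 1 - ε)
          - b I ^ 2 * 2 * ((∏ i, if s i then ε else 1 - ε) * χ s I) := fun s => by ring
    rw [Finset.sum_congr rfl fun s _ => this s, Finset.sum_sub_distrib, ← Finset.mul_sum,
      ← Finset.mul_sum, sum_noise_weight]
    ring
  rw [e2]
  have hb := one_add_mul_le_pow (show (-2 : ℝ) ≤ -(2 * ε) by linarith) I.card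
  rw [← sub_eq_add_neg] at hb
  have : 2 - 2 * (1 - 2 * ε) ^ I.card ≤ 4 * ε * I.card := by linarith
  calc _ ≤ b I ^ 2 * (4 * ε * I.card) := by gcongr
    _ = _ := by ring

lemma noiseSens_le_one {n : ℕ} {ε : ℝ} (h0 : 0 < ε) (h1 : ε < 1) (f : (Fin n → Bool) → Bool) :
    noiseSens ε f ≤ 1 := by
  have hw : ∀ s : Fin n → Bool, 0 ≤ ∏ i, if s i then ε else 1 - ε := fun s =>
    Finset.prod_nonneg fun i _ => by split_ifs <;> linarith
  unfold noiseSens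
  calc _ ≤ (1 / 2 ^ n : ℝ) * ∑ x : Fin n → Bool, ∑ s : Fin n → Bool,
        (∏ i, if s i then ε else 1 - ε) * 1 := by
        gcongr with x _ s _
        split_ifs <;> norm_num
    _ = 1 := by simp [sum_noise_weight]

/-- Noise sensitivity of a threshold function is controlled by its small-ball probability. -/
lemma noiseSens_sign_le {n : ℕ} {ε : ℝ} (h0 : 0 < ε) (h1 : ε < 1) (b : Finset (Fin n) → ℝ) {t : ℝ}
    (ht : 0 < t) :
    noiseSens ε (fun y => decide (0 ≤ mlEval b (fun i => pmOne (y i))))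
      ≤ (Measure.pi (fun _ : Fin n => rad)).real {x | |mlEval b x| ≤ t}
        + 4 * ε * (∑ i, wsq b i) / t ^ 2 := by
  have hw : ∀ s : Fin n → Bool, 0 ≤ ∏ i, if s i then ε else 1 - ε := fun s =>
    Finset.prod_nonneg fun i _ => by split_ifs <;> linarith
  have hm := measurable_mlEval b
  rw [rad_real_eq (measurableSet_le (by fun_prop) (by fun_prop))]
  simp only [Set.mem_ofPred_eq]
  have key : noiseSens ε (fun y => decide (0 ≤ mlEval b (fun i => pmOne (y i))))
      ≤ (1 / 2 ^ n : ℝ) * ∑ x : Fin n → Bool, ∑ s : Fin n → Bool,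
        (∏ i, if s i then ε else 1 - ε) * ((if |mlEval b (fun i => pmOne (x i))| ≤ t then 1 else 0)
        + (mlEval b (fun i => pmOne (x i)) - mlEval b (fun i => pmOne (xor (s i) (x i)))) ^ 2
          / t ^ 2) := by
    unfold noiseSens
    refine mul_le_mul_of_nonneg_left (Finset.sum_le_sum fun x _ => Finset.sum_le_sum fun s _ =>
      mul_le_mul_of_nonneg_left ?_ (hw s)) (by positivity)
    set p := mlEval b (fun i => pmOne (x i))
    set q := mlEval b (fun i => pmOne (xor (s i) (x i)))
    have hq0 : 0 ≤ (p - q) ^ 2 / t ^ 2 := by positivity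
    by_cases hpt : |p| ≤ t
    · rw [if_pos hpt]
      split_ifs <;> linarith
    · rw [if_neg hpt, zero_add]
      split_ifs with hne
      · rw [one_le_div (by positivity)]
        have hpq : (0 ≤ p ∧ q < 0) ∨ (p < 0 ∧ 0 ≤ q) := by
          by_cases hp : 0 ≤ p <;> by_cases hq : 0 ≤ q
          · exact absurd (decide_eq_decide.2 (iff_of_true hp hq)) hne
          · exact Or.inl ⟨hp, not_le.1 hq⟩
          · exact Or.inr ⟨not_le.1 hp, hq⟩
          · exact absurd (decide_eq_decide.2 (iff_of_false hp hq)) hne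
        have h2 : |p| ≤ |p - q| := by
          rcases hpq with ⟨hp, hq⟩ | ⟨hp, hq⟩
          · rw [abs_of_nonneg hp, abs_of_nonneg (by linarith)]; linarith
          · rw [abs_of_neg hp, abs_of_neg (by linarith)]; linarith
        rw [← sq_abs (p - q)]
        exact pow_le_pow_left₀ ht.le (by linarith [not_le.1 hpt]) 2
      · exact hq0
  refine key.trans ?_
  have hs := sum_sq_noise_le h1 b
  simp_rw [mul_add, Finset.sum_add_distrib, ← Finset.sum_mul, sum_noise_weight, one_mul, mul_add,
    ← mul_div_assoc, ← Finset.sum_div]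
  rw [← mul_div_assoc]
  gcongr

lemma noiseSens_const {n : ℕ} (ε : ℝ) {f : (Fin n → Bool) → Bool} (c : Bool) (h : ∀ x, f x = c) :
    noiseSens ε f = 0 := by
  simp [noiseSens, h]

lemma mlEval_of_sum_wsq_eq_zero {n : ℕ} {b : Finset (Fin n) → ℝ} (h : ∑ i, wsq b i = 0)
    (x : Fin n → ℝ) : mlEval b x = b ∅ := by
  have h0 : ∑ I, dropConst b I ^ 2 = 0 :=
    le_antisymm (h ▸ sum_sq_dropConst_le b) (Finset.sum_nonneg fun _ _ => sq_nonneg _)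
  rw [Finset.sum_eq_zero_iff_of_nonneg fun _ _ => sq_nonneg _] at h0
  have : mlEval (dropConst b) x = 0 :=
    Finset.sum_eq_zero fun I hI => by rw [pow_eq_zero_iff two_ne_zero |>.1 (h0 I hI), zero_mul]
  rw [mlEval_dropConst, this, add_zero]

lemma noiseSens_sign_eq_zero {n : ℕ} (ε : ℝ) {b : Finset (Fin n) → ℝ} (h : ∑ i, wsq b i = 0) :
    noiseSens ε (fun y => decide (0 ≤ mlEval b (fun i => pmOne (y i)))) = 0 :=
  noiseSens_const ε (decide (0 ≤ b ∅)) fun x => by rw [mlEval_of_sum_wsq_eq_zero h]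

lemma wsq_nonneg {n : ℕ} (a : Finset (Fin n) → ℝ) (i : Fin n) : 0 ≤ wsq a i :=
  Finset.sum_nonneg fun _ _ => sq_nonneg _

/-- Regular polynomial threshold functions have small noise sensitivity. -/
theorem noiseSens_regular (d : ℕ) (hd : 1 ≤ d) {A : ℝ} (hA : 0 ≤ A) : ∃ C : ℝ, 0 ≤ C ∧
    ∀ ε : ℝ, 0 < ε → ε < 1 → ∀ (n : ℕ) (b : Finset (Fin n) → ℝ), DegLE b d →
      ∑ i, wsq b i ^ 2 ≤ A * ε ^ 2 * (∑ i, wsq b i) ^ 2 →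
      noiseSens ε (fun y => decide (0 ≤ mlEval b (fun i => pmOne (y i))))
        ≤ C * ε ^ ((1 : ℝ) / (2 * (d : ℝ) + 2)) := by
  obtain ⟨C₁, hC₁, h₁⟩ := smallBall_compare
  obtain ⟨C₂, hC₂, h₂⟩ := smallBall d hd
  have hdR : (1 : ℝ) ≤ d := by exact_mod_cast hd
  refine ⟨C₂ * (16 * d) + C₁ * 9 ^ d * A + 4, by positivity, fun ε h0 h1 n b hb hreg => ?_⟩
  set V := ∑ i, wsq b i with hV
  set δ := ε ^ ((1 : ℝ) / (2 * (d : ℝ) + 2)) with hδ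
  have hδ0 : 0 < δ := Real.rpow_pos_of_pos h0 _
  have hV0 : 0 ≤ V := Finset.sum_nonneg fun i _ => wsq_nonneg b i
  rcases hV0.eq_or_lt with hz | hVp
  · rw [noiseSens_sign_eq_zero ε hz.symm]; positivity
  have hδ1 : δ ≤ 1 := Real.rpow_le_one h0.le h1.le (by positivity)
  have hδε : δ ^ (2 * d + 2) = ε := by
    rw [hδ, ← Real.rpow_natCast, ← Real.rpow_mul h0.le]
    push_cast
    rw [one_div, inv_mul_cancel₀ (by positivity), Real.rpow_one]
  -- The threshold is `t² = V δ^(2d+1)`.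
  set t := √(V * δ ^ (2 * d + 1)) with ht
  have ht0 : 0 < t := Real.sqrt_pos.2 (by positivity)
  have ht2 : t ^ 2 = V * δ ^ (2 * d + 1) := Real.sq_sqrt (by positivity)
  have hN := sum_sq_dropConst b
  have hW := sum_wsq_le hb
  have hNV : V ≤ d * ∑ I, b I ^ 2 := by
    refine hW.trans (mul_le_mul_of_nonneg_left ?_ (by positivity))
    rw [hN]; nlinarith [sq_nonneg (b ∅)]
  have hNp : 0 < ∑ I, b I ^ 2 := by
    by_contra hc
    nlinarith
  have s1 : (gaussn n).real {x | |mlEval b x| ≤ 2 * t} ≤ C₂ * (16 * d) * δ := by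
    refine (smallBall_scale h₂ hb hNp (by positivity)).trans ?_
    rw [mul_assoc]
    refine mul_le_mul_of_nonneg_left ?_ (by positivity)
    set γ : ℝ := 2 / (2 * (d : ℝ) + 1)
    have hγ0 : 0 < γ := by positivity
    have hγ2 : γ / 2 ≤ 1 := by
      rw [div_div, div_le_one (by positivity)]; linarith
    have e1 : (2 * t) ^ γ = (4 * t ^ 2) ^ (γ / 2) := by
      rw [show 4 * t ^ 2 = (2 * t) ^ (2 : ℝ) by rw [Real.rpow_two]; ring,
        ← Real.rpow_mul (by positivity)]
      congr 1; ring
    rw [e1, Real.rpow_neg hNp.le, ← Real.inv_rpow hNp.le,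
      ← Real.mul_rpow (by positivity) (by positivity)]
    have e2 : 4 * t ^ 2 * (∑ I, b I ^ 2)⁻¹ ≤ 4 * d * δ ^ (2 * d + 1) := by
      rw [ht2, ← div_eq_mul_inv, div_le_iff₀ hNp]
      have : 0 < δ ^ (2 * d + 1) := by positivity
      nlinarith
    calc _ ≤ (4 * d * δ ^ (2 * d + 1)) ^ (γ / 2) :=
          Real.rpow_le_rpow (by positivity) e2 (by positivity)
      _ = (4 * (d : ℝ)) ^ (γ / 2) * (δ ^ (2 * d + 1)) ^ (γ / 2) :=
          Real.mul_rpow (by positivity) (by positivity)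
      _ = (4 * (d : ℝ)) ^ (γ / 2) * δ := by
          congr 1
          rw [← Real.rpow_natCast, ← Real.rpow_mul hδ0.le]
          convert Real.rpow_one δ using 2
          push_cast
          simp only [γ]
          field_simp
      _ ≤ (4 * (d : ℝ)) ^ (1 : ℝ) * δ := by
          gcongr
          linarith
      _ ≤ 16 * d * δ := by
          rw [Real.rpow_one]; gcongr; norm_num
  have s2 : C₁ * 9 ^ d * (∑ k, wsq b k ^ 2) / t ^ 4 ≤ C₁ * 9 ^ d * A * δ := by
    have e4 : t ^ 4 = V ^ 2 * δ ^ (4 * d + 2) := by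
      rw [show t ^ 4 = (t ^ 2) ^ 2 by ring, ht2]; ring
    rw [div_le_iff₀ (by positivity), e4]
    calc _ ≤ C₁ * 9 ^ d * (A * ε ^ 2 * V ^ 2) := by gcongr
      _ = C₁ * 9 ^ d * A * V ^ 2 * δ ^ (4 * d + 4) := by rw [← hδε]; ring
      _ ≤ C₁ * 9 ^ d * A * V ^ 2 * δ ^ (4 * d + 3) := by
          gcongr ?_ * ?_
          exact pow_le_pow_of_le_one hδ0.le hδ1 (by omega)
      _ = _ := by ring
  have s3 : 4 * ε * V / t ^ 2 = 4 * δ := by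
    rw [ht2, ← hδε]; field_simp; ring
  have := noiseSens_sign_le h0 h1 b ht0
  have := h₁ n d b hb t ht0
  rw [← hV, s3] at *
  linarith

/-- Threshold functions of polynomials dominated by their constant term have small noise
sensitivity. -/
lemma noiseSens_le_of_const {n d : ℕ} {ε : ℝ} (h0 : 0 < ε) (h1 : ε < 1)
    {b : Finset (Fin n) → ℝ} (hb : DegLE b d) (hc : b ∅ ≠ 0) :
    noiseSens ε (fun y => decide (0 ≤ mlEval b (fun i => pmOne (y i))))
      ≤ (4 + 16 * d) * (∑ I, dropConst b I ^ 2) / b ∅ ^ 2 := by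
  have hc0 : 0 < |b ∅| := abs_pos.2 hc
  set T := ∑ I, dropConst b I ^ 2
  have hT : 0 ≤ T := Finset.sum_nonneg fun _ _ => sq_nonneg _
  have hm := measurable_mlEval (dropConst b)
  refine (noiseSens_sign_le h0 h1 b (half_pos hc0)).trans ?_
  have hW := sum_wsq_le hb
  have s1 : (Measure.pi (fun _ : Fin n => rad)).real {x | |mlEval b x| ≤ |b ∅| / 2}
      ≤ 4 * T / b ∅ ^ 2 := by
    have hM := measureReal_ge_le (μ := Measure.pi (fun _ : Fin n => rad))
      (f := fun x => mlEval (dropConst b) x ^ 2) (r := b ∅ ^ 2 / 4) (fun _ => sq_nonneg _)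
      (integrable_mlEval_pow _ _ 2) (by positivity)
    rw [integral_mlEval_sq] at hM
    refine (measureReal_mono ?_).trans (hM.trans_eq (by field_simp; rfl))
    intro x hx
    simp only [Set.mem_ofPred_eq] at hx ⊢
    rw [mlEval_dropConst] at hx
    have h3 : |b ∅| / 2 ≤ |mlEval (dropConst b) x| := by
      have := abs_sub_abs_le_abs_sub (b ∅) (-mlEval (dropConst b) x)
      rw [abs_neg, sub_neg_eq_add] at this
      linarith
    have := pow_le_pow_left₀ (by positivity) h3 2
    rw [sq_abs, div_pow, sq_abs] at this
    linarith
  have s2 : 4 * ε * (∑ i, wsq b i) / (|b ∅| / 2) ^ 2 ≤ 16 * d * T / b ∅ ^ 2 := by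
    rw [div_pow, sq_abs, div_div_eq_mul_div]
    refine div_le_div_of_nonneg_right ?_ (sq_nonneg _)
    have : ε * ∑ i, wsq b i ≤ 1 * (d * T) :=
      mul_le_mul h1.le hW (Finset.sum_nonneg fun i _ => wsq_nonneg b i) zero_le_one
    linarith
  calc _ ≤ 4 * T / b ∅ ^ 2 + 16 * d * T / b ∅ ^ 2 := add_le_add s1 s2
    _ = _ := by ring

/-- The coefficients, as a polynomial in the restricted variables, of the coefficient
`restCoeff a M · J`. -/
def fiberCoeff {n : ℕ} (a : Finset (Fin n) → ℝ) (M : ℕ) (J L : Finset (Fin n)) : ℝ :=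
  if (∀ j ∈ J, M ≤ (j : ℕ)) ∧ ∀ i ∈ L, (i : ℕ) < M then a (L ∪ J) else 0

lemma sum_fiber {n : ℕ} (M : ℕ) {J : Finset (Fin n)} (hJ : ∀ j ∈ J, M ≤ (j : ℕ))
    (G : Finset (Fin n) → ℝ) :
    ∑ I ∈ univ.filter (fun I : Finset (Fin n) => I.filter (fun i => M ≤ i.val) = J), G I
      = ∑ L ∈ univ.filter (fun L : Finset (Fin n) => ∀ i ∈ L, (i : ℕ) < M), G (L ∪ J) := by
  refine Finset.sum_bij' (fun I _ => I.filter fun i => i.val < M) (fun L _ => L ∪ J) ?_ ?_ ?_ ?_ ?_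
  · intro I _
    simp
  · intro L hL
    simp only [Finset.mem_filter, Finset.mem_univ, true_and] at hL ⊢
    ext i
    simp only [Finset.mem_filter, Finset.mem_union]
    constructor
    · rintro ⟨h | h, h2⟩
      · exact absurd (hL i h) (by omega)
      · exact h
    · exact fun h => ⟨Or.inr h, hJ i h⟩
  · intro I hI
    simp only [Finset.mem_filter, Finset.mem_univ, true_and] at hI
    simp only [← hI]
    ext i
    simp only [Finset.mem_filter, Finset.mem_union]
    have := lt_or_ge (i : ℕ) M
    tauto
  · intro L hL
    simp only [Finset.mem_filter, Finset.mem_univ, true_and] at hL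
    ext i
    simp only [Finset.mem_filter, Finset.mem_union]
    constructor
    · rintro ⟨h | h, h2⟩
      · exact h
      · exact absurd (hJ i h) (by omega)
    · exact fun h => ⟨Or.inl h, hL i h⟩
  · intro I hI
    simp only [Finset.mem_filter, Finset.mem_univ, true_and] at hI
    congr 1
    rw [← hI]
    ext i
    simp only [Finset.mem_filter, Finset.mem_union]
    have := lt_or_ge (i : ℕ) M
    tauto

lemma filter_tail_eq_empty {n : ℕ} {M : ℕ} {J : Finset (Fin n)} (hJ : ¬∀ j ∈ J, M ≤ (j : ℕ)) :
    univ.filter (fun I : Finset (Fin n) => I.filter (fun i => M ≤ i.val) = J) = ∅ := by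
  refine Finset.filter_eq_empty_iff.2 fun I _ hI => hJ fun j hj => ?_
  rw [← hI] at hj
  exact (Finset.mem_filter.1 hj).2

lemma restCoeff_eq_mlEval {n : ℕ} (a : Finset (Fin n) → ℝ) (M : ℕ) (x : Fin n → ℝ)
    (J : Finset (Fin n)) : restCoeff a M x J = mlEval (fiberCoeff a M J) x := by
  unfold restCoeff mlEval fiberCoeff
  split_ifs with hJ
  · rw [sum_fiber M hJ, Finset.sum_filter]
    refine Finset.sum_congr rfl fun L _ => ?_
    by_cases hL : ∀ i ∈ L, (i : ℕ) < M
    · rw [if_pos hL, if_pos ⟨hJ, hL⟩]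
      congr 2
      ext i
      simp only [Finset.mem_filter, Finset.mem_union]
      constructor
      · rintro ⟨h | h, h2⟩
        · exact h
        · exact absurd (hJ i h) (by omega)
      · exact fun h => ⟨Or.inl h, hL i h⟩
    · rw [if_neg hL, if_neg fun h => hL h.2, zero_mul]
  · exact (Finset.sum_eq_zero fun L _ => by rw [if_neg fun h => hJ h.1, zero_mul]).symm

lemma sum_sq_fiberCoeff {n : ℕ} (a : Finset (Fin n) → ℝ) (M : ℕ) (J : Finset (Fin n)) :
    ∑ L, fiberCoeff a M J L ^ 2
      = ∑ I ∈ univ.filter (fun I : Finset (Fin n) => I.filter (fun i => M ≤ i.val) = J),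
          a I ^ 2 := by
  unfold fiberCoeff
  by_cases hJ : ∀ j ∈ J, M ≤ (j : ℕ)
  · rw [sum_fiber M hJ, Finset.sum_filter]
    refine Finset.sum_congr rfl fun L _ => ?_
    by_cases hL : ∀ i ∈ L, (i : ℕ) < M
    · rw [if_pos hL, if_pos ⟨hJ, hL⟩]
    · rw [if_neg hL, if_neg fun h => hL h.2, zero_pow two_ne_zero]
  · rw [filter_tail_eq_empty hJ, Finset.sum_empty]
    exact Finset.sum_eq_zero fun L _ => by rw [if_neg fun h => hJ h.1, zero_pow two_ne_zero]

lemma sum_sum_sq_fiberCoeff {n : ℕ} (a : Finset (Fin n) → ℝ) (M : ℕ)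
    (p : Finset (Fin n) → Prop) [DecidablePred p] :
    ∑ J, (if p J then ∑ L, fiberCoeff a M J L ^ 2 else 0)
      = ∑ I, if p (I.filter fun i => M ≤ i.val) then a I ^ 2 else 0 := by
  rw [← Finset.sum_fiberwise univ (fun I : Finset (Fin n) => I.filter fun i => M ≤ i.val)
    fun I => if p (I.filter fun i => M ≤ i.val) then a I ^ 2 else 0]
  refine Finset.sum_congr rfl fun J _ => ?_
  rw [sum_sq_fiberCoeff]
  split_ifs with h
  · refine Finset.sum_congr rfl fun I hI => ?_
    rw [if_pos (by rwa [(Finset.mem_filter.1 hI).2])]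
  · refine (Finset.sum_eq_zero fun I hI => ?_).symm
    rw [if_neg (by rwa [(Finset.mem_filter.1 hI).2])]

lemma mlEval_restCoeff {n : ℕ} (a : Finset (Fin n) → ℝ) (M : ℕ) (x y : Fin n → ℝ) :
    mlEval (restCoeff a M x) y = mlEval a (fun i => if i.val < M then x i else y i) := by
  unfold mlEval
  rw [← Finset.sum_fiberwise univ (fun I : Finset (Fin n) => I.filter fun i => M ≤ i.val)
    fun I => a I * ∏ i ∈ I, if i.val < M then x i else y i]
  refine Finset.sum_congr rfl fun J _ => ?_
  unfold restCoeff
  split_ifs with hJ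
  · rw [Finset.sum_mul]
    refine Finset.sum_congr rfl fun I hI => ?_
    rw [← (Finset.mem_filter.1 hI).2, mul_assoc, Finset.prod_ite]
    simp only [not_lt]
  · rw [filter_tail_eq_empty hJ, Finset.sum_empty, zero_mul]

lemma DegLE.fiberCoeff {n d : ℕ} {a : Finset (Fin n) → ℝ} (h : DegLE a d) (M : ℕ)
    (J : Finset (Fin n)) : DegLE (fiberCoeff a M J) d := by
  intro L hL
  simp only [_root_.fiberCoeff] at hL
  split_ifs at hL
  · exact (Finset.card_le_card Finset.subset_union_left).trans (h _ hL)
  · exact absurd rfl hL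

lemma DegLE.restCoeff {n d : ℕ} {a : Finset (Fin n) → ℝ} (h : DegLE a d) (M : ℕ)
    (x : Fin n → ℝ) : DegLE (restCoeff a M x) d := by
  intro J hJ
  rw [restCoeff_eq_mlEval] at hJ
  obtain ⟨L, -, hL⟩ := Finset.exists_ne_zero_of_sum_ne_zero hJ
  have hL := left_ne_zero_of_mul hL
  simp only [_root_.fiberCoeff] at hL
  split_ifs at hL
  · exact (Finset.card_le_card Finset.subset_union_right).trans (h _ hL)
  · exact absurd rfl hL

lemma wsq_restCoeff_eq_zero {n : ℕ} {a : Finset (Fin n) → ℝ} {M : ℕ} {j : Fin n}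
    (h : M ≤ (j : ℕ) → wsq a j = 0) (x : Fin n → ℝ) : wsq (restCoeff a M x) j = 0 := by
  refine Finset.sum_eq_zero fun J hJ => ?_
  have hj : j ∈ J := (Finset.mem_filter.1 hJ).2
  rw [sq_eq_zero_iff]
  unfold restCoeff
  split_ifs with hJM
  · have h0 := h (hJM j hj)
    rw [wsq, Finset.sum_eq_zero_iff_of_nonneg fun _ _ => sq_nonneg _] at h0
    refine Finset.sum_eq_zero fun I hI => ?_
    have hjI : j ∈ I := by
      rw [← (Finset.mem_filter.1 hI).2] at hj
      exact (Finset.mem_filter.1 hj).1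
    rw [pow_eq_zero_iff two_ne_zero |>.1 (h0 I (by simp [hjI])), zero_mul]
  · rfl

/-- The expected weight of the variable `j` after restriction. -/
lemma sum_wsq_fiberCoeff {n : ℕ} (a : Finset (Fin n) → ℝ) (M : ℕ) (j : Fin n) :
    ∑ J, (if j ∈ J then ∑ L, fiberCoeff a M J L ^ 2 else 0)
      = if M ≤ (j : ℕ) then wsq a j else 0 := by
  rw [sum_sum_sq_fiberCoeff a M fun J => j ∈ J, wsq, Finset.sum_filter]
  split_ifs with h
  · simp [h]
  · simp [h]

lemma integrable_sum_mlEval_sq {n : ℕ} (μ : Fin n → Measure ℝ) [∀ i, MomentLaw (μ i)]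
    {ι : Type*} (s : Finset ι) (c : ι → ℝ) (B : ι → Finset (Fin n) → ℝ) (m : ℕ) :
    Integrable (fun x => (∑ i ∈ s, c i * mlEval (B i) x ^ 2) ^ m) (Measure.pi μ) := by
  convert integrable_eval_pi μ ((∑ i ∈ s, MvPolynomial.C (c i) * mlPoly (B i) ^ 2) ^ m) using 2
  simp [eval_mlPoly]

lemma integral_sum_mlEval_sq {n : ℕ} (μ : Fin n → Measure ℝ) [∀ i, MomentLaw (μ i)]
    {ι : Type*} (s : Finset ι) (c : ι → ℝ) (B : ι → Finset (Fin n) → ℝ) :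
    ∫ x, ∑ i ∈ s, c i * mlEval (B i) x ^ 2 ∂Measure.pi μ
      = ∑ i ∈ s, c i * ∑ L, B i L ^ 2 := by
  rw [integral_finsetSum _ fun i _ => (integrable_mlEval_pow μ (B i) 2).const_mul _]
  refine Finset.sum_congr rfl fun i _ => ?_
  rw [integral_const_mul, integral_mlEval_sq]

/-- Hypercontractivity for weighted sums of squares. -/
lemma integral_sum_mlEval_sq_sq_le {n d : ℕ} (μ : Fin n → Measure ℝ) [∀ i, MomentLaw (μ i)]
    {ι : Type*} (s : Finset ι) {c : ι → ℝ} (hc : ∀ i, 0 ≤ c i) {B : ι → Finset (Fin n) → ℝ}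
    (hB : ∀ i, DegLE (B i) d) :
    ∫ x, (∑ i ∈ s, c i * mlEval (B i) x ^ 2) ^ 2 ∂Measure.pi μ
      ≤ 9 ^ d * (∑ i ∈ s, c i * ∑ L, B i L ^ 2) ^ 2 := by
  have hInt : ∀ i j, Integrable (fun x => mlEval (B i) x ^ 2 * mlEval (B j) x ^ 2)
      (Measure.pi μ) := by
    intro i j
    convert integrable_eval_pi μ (mlPoly (B i) ^ 2 * mlPoly (B j) ^ 2) using 2
    simp [eval_mlPoly]
  have hcross : ∀ i j, ∫ x, mlEval (B i) x ^ 2 * mlEval (B j) x ^ 2 ∂Measure.pi μ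
      ≤ 9 ^ d * ((∑ L, B i L ^ 2) * ∑ L, B j L ^ 2) := by
    intro i j
    have hp : ∀ i, (fun x => (mlEval (B i) x ^ 2) ^ 2) = fun x => mlEval (B i) x ^ 4 := by
      intro i; ext x; ring
    have h := sq_integral_mul_le (μ := Measure.pi μ) (f := fun x => mlEval (B i) x ^ 2)
      (g := fun x => mlEval (B j) x ^ 2) (by rw [hp]; exact integrable_mlEval_pow μ _ 4)
      (by rw [hp]; exact integrable_mlEval_pow μ _ 4) (hInt i j)
    rw [hp, hp] at h
    refine le_of_sq_le_sq (h.trans ?_) (by positivity)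
    calc _ ≤ (9 ^ d * (∑ L, B i L ^ 2) ^ 2) * (9 ^ d * (∑ L, B j L ^ 2) ^ 2) := by
          refine mul_le_mul (hypercontractive μ (hB i)) (hypercontractive μ (hB j)) ?_
            (by positivity)
          exact integral_nonneg fun x => by positivity
      _ = _ := by ring
  have hexp : ∀ x, (∑ i ∈ s, c i * mlEval (B i) x ^ 2) ^ 2
      = ∑ i ∈ s, ∑ j ∈ s, c i * c j * (mlEval (B i) x ^ 2 * mlEval (B j) x ^ 2) := by
    intro x
    rw [sq, Finset.sum_mul_sum]
    exact Finset.sum_congr rfl fun i _ => Finset.sum_congr rfl fun j _ => by ring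
  simp_rw [hexp]
  rw [integral_finsetSum _ fun i _ => integrable_finsetSum _ fun j _ => (hInt i j).const_mul _,
    sq (∑ i ∈ s, c i * ∑ L, B i L ^ 2), Finset.sum_mul_sum, Finset.mul_sum]
  refine Finset.sum_le_sum fun i _ => ?_
  rw [integral_finsetSum _ fun j _ => (hInt i j).const_mul _, Finset.mul_sum]
  refine Finset.sum_le_sum fun j _ => ?_
  rw [integral_const_mul]
  calc _ ≤ c i * c j * (9 ^ d * ((∑ L, B i L ^ 2) * ∑ L, B j L ^ 2)) :=
        mul_le_mul_of_nonneg_left (hcross i j) (mul_nonneg (hc i) (hc j))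
    _ = _ := by ring

/-- The Paley–Zygmund inequality. -/
lemma paley_zygmund {Ω : Type*} [MeasurableSpace Ω] {μ : Measure Ω} [IsProbabilityMeasure μ]
    {f : Ω → ℝ} {K : ℝ} (hfm : Measurable f) (hf : Integrable f μ)
    (hf2 : Integrable (fun x => f x ^ 2) μ) (hpos : 0 < ∫ x, f x ∂μ) (hK : 0 < K)
    (h : ∫ x, f x ^ 2 ∂μ ≤ K * (∫ x, f x ∂μ) ^ 2) :
    1 / (4 * K) ≤ μ.real {x | (∫ x, f x ∂μ) / 2 ≤ f x} := by
  set m := ∫ x, f x ∂μ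
  set S := {x | m / 2 ≤ f x}
  have hS : MeasurableSet S := measurableSet_le measurable_const hfm
  set g : Ω → ℝ := S.indicator 1
  have hgi : Integrable g μ := (integrable_const (1 : ℝ)).indicator hS
  have hg2 : (fun x => g x ^ 2) = g := by
    ext x
    by_cases hx : x ∈ S <;> simp [g, hx]
  have hfg : (fun x => f x * g x) = S.indicator f := by
    ext x
    by_cases hx : x ∈ S <;> simp [g, hx]
  have hfgi : Integrable (fun x => f x * g x) μ := by rw [hfg]; exact hf.indicator hS
  have hcs := sq_integral_mul_le hf2 (by rwa [hg2]) hfgi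
  have hgI : ∫ x, g x ∂μ = μ.real S := integral_indicator_one hS
  rw [hg2, hgI] at hcs
  have hlow : m / 2 ≤ ∫ x, f x * g x ∂μ := by
    have : m ≤ ∫ x, (f x * g x + m / 2) ∂μ := by
      refine integral_mono hf (hfgi.add (integrable_const _)) fun x => ?_
      by_cases hx : x ∈ S
      · simp [g, hx]; linarith
      · have := not_le.1 (show ¬ m / 2 ≤ f x from hx)
        simp [g, hx]; linarith
    rw [integral_add hfgi (integrable_const _), integral_const] at this
    simp at this
    linarith
  have h2 : (m / 2) ^ 2 ≤ K * m ^ 2 * μ.real S :=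
    (pow_le_pow_left₀ (by positivity) hlow 2).trans
      (hcs.trans (mul_le_mul_of_nonneg_right h measureReal_nonneg))
  rw [div_le_iff₀ (by positivity)]
  have hm2 : 0 < m ^ 2 := by positivity
  nlinarith

lemma measureReal_second_moment_diff {Ω : Type*} [MeasurableSpace Ω] {μ : Measure Ω}
    [IsProbabilityMeasure μ] {f g : Ω → ℝ} {K r : ℝ} (hfm : Measurable f) (hf : Integrable f μ)
    (hf2 : Integrable (fun x => f x ^ 2) μ) (hpos : 0 < ∫ x, f x ∂μ) (hK : 0 < K)
    (h : ∫ x, f x ^ 2 ∂μ ≤ K * (∫ x, f x ∂μ) ^ 2) (hg0 : ∀ x, 0 ≤ g x) (hg : Integrable g μ)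
    (hr : 0 < r) (hgr : ∫ x, g x ∂μ ≤ r) :
    1 / (8 * K) ≤ μ.real ({x | (∫ x, f x ∂μ) / 2 ≤ f x} \ {x | 8 * K * r ≤ g x}) := by
  have h1 := paley_zygmund hfm hf hf2 hpos hK h
  have h2 := measureReal_ge_le (μ := μ) hg0 hg (show 0 < 8 * K * r by positivity)
  have h3 : (∫ x, g x ∂μ) / (8 * K * r) ≤ 1 / (8 * K) := by
    rw [div_le_div_iff₀ (by positivity) (by positivity)]
    nlinarith
  have h4 : μ.real {x | (∫ x, f x ∂μ) / 2 ≤ f x}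
      ≤ μ.real ({x | (∫ x, f x ∂μ) / 2 ≤ f x} \ {x | 8 * K * r ≤ g x})
        + μ.real {x | 8 * K * r ≤ g x} := by
    refine (measureReal_mono ?_).trans (measureReal_union_le _ _)
    rw [Set.sdiff_union_self]
    exact Set.subset_union_left
  have h5 : 1 / (4 * K) = 1 / (8 * K) + 1 / (8 * K) := by field_simp; norm_num
  linarith

/-- Restricting the variables before the critical index yields a function of small noise
sensitivity with constant probability. -/
lemma exists_restriction_of_tail_le (d : ℕ) (hd : 1 ≤ d) : ∃ C : ℝ, 0 ≤ C ∧
    ∀ ε : ℝ, 0 < ε → ε < 1 → ∀ (n : ℕ) (a : Finset (Fin n) → ℝ) (M : ℕ), DegLE a d →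
      (∀ j : Fin n, M ≤ (j : ℕ) → wsq a j ≤ ε ^ 2 * sigmaSq a M) →
      ∃ G : Set (Fin n → ℝ), MeasurableSet G ∧
        1 / (8 * 9 ^ d) ≤ (Measure.pi (fun _ : Fin n => rad)).real G ∧
        ∀ x ∈ G, noiseSens ε (fun y => decide (0 ≤ mlEval (restCoeff a M x) (fun i => pmOne (y i))))
          ≤ C * ε ^ ((1 : ℝ) / (2 * (d : ℝ) + 2)) := by
  obtain ⟨C, hC, hR⟩ := noiseSens_regular d hd (A := 32 * 81 ^ d) (by positivity)
  refine ⟨C, hC, fun ε h0 h1 n a M ha hM => ?_⟩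
  set μ := Measure.pi (fun _ : Fin n => rad)
  have hσ0 : 0 ≤ sigmaSq a M := Finset.sum_nonneg fun j _ => wsq_nonneg a j
  have hK : (0 : ℝ) < 9 ^ d := by positivity
  rcases hσ0.eq_or_lt with hz | hσ
  · refine ⟨Set.univ, MeasurableSet.univ, ?_, fun x _ => ?_⟩
    · rw [probReal_univ, div_le_one (by positivity)]
      have : (1 : ℝ) ≤ 9 ^ d := one_le_pow₀ (by norm_num)
      linarith
    · rw [noiseSens_sign_eq_zero]
      · positivity
      · refine Finset.sum_eq_zero fun j _ => wsq_restCoeff_eq_zero (fun hj => ?_) x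
        have := hM j hj
        rw [← hz, mul_zero] at this
        exact le_antisymm this (wsq_nonneg a j)
  set σ := sigmaSq a M with hσd
  have hw : ∀ (x : Fin n → ℝ) (j : Fin n), wsq (restCoeff a M x) j
      = ∑ J, (if j ∈ J then 1 else 0) * mlEval (fiberCoeff a M J) x ^ 2 := by
    intro x j
    simp only [wsq, Finset.sum_filter, restCoeff_eq_mlEval, ite_mul, one_mul, zero_mul]
  have hV : ∀ x : Fin n → ℝ, ∑ j, wsq (restCoeff a M x) j
      = ∑ J, (J.card : ℝ) * mlEval (fiberCoeff a M J) x ^ 2 := by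
    intro x
    rw [sum_wsq]
    simp only [restCoeff_eq_mlEval]
  have hEV' : ∑ J : Finset (Fin n), (J.card : ℝ) * ∑ L, fiberCoeff a M J L ^ 2 = σ := by
    rw [hσd, sigmaSq, Finset.sum_filter, ← Finset.sum_congr rfl fun j _ => sum_wsq_fiberCoeff a M j,
      Finset.sum_comm]
    refine Finset.sum_congr rfl fun J _ => ?_
    rw [Finset.sum_ite_mem, Finset.univ_inter, Finset.sum_const, nsmul_eq_mul]
  have hEV : ∫ x, ∑ j, wsq (restCoeff a M x) j ∂μ = σ := by
    simp_rw [hV]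
    rw [integral_sum_mlEval_sq, hEV']
  have hEV2 : ∫ x, (∑ j, wsq (restCoeff a M x) j) ^ 2 ∂μ ≤ 9 ^ d * σ ^ 2 := by
    simp_rw [hV]
    rw [← hEV']
    exact integral_sum_mlEval_sq_sq_le _ univ (fun J => Nat.cast_nonneg _) fun J => ha.fiberCoeff M J
  have hwint : ∀ j, Integrable (fun x => wsq (restCoeff a M x) j ^ 2) μ := by
    intro j
    simp_rw [hw]
    exact integrable_sum_mlEval_sq _ univ _ _ 2
  have hEW : ∫ x, ∑ j, wsq (restCoeff a M x) j ^ 2 ∂μ ≤ 9 ^ d * ε ^ 2 * σ ^ 2 := by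
    rw [integral_finsetSum _ fun j _ => hwint j]
    have e1 : ∀ j, ∫ x, wsq (restCoeff a M x) j ^ 2 ∂μ
        ≤ 9 ^ d * (if M ≤ (j : ℕ) then wsq a j else 0) ^ 2 := by
      intro j
      simp_rw [hw]
      rw [← sum_wsq_fiberCoeff]
      have := integral_sum_mlEval_sq_sq_le (fun _ : Fin n => rad) univ
        (c := fun J : Finset (Fin n) => if j ∈ J then (1 : ℝ) else 0)
        (fun J => by split_ifs <;> norm_num) fun J => ha.fiberCoeff M J
      simpa only [ite_mul, one_mul, zero_mul] using this
    calc _ ≤ ∑ j : Fin n, 9 ^ d * (if M ≤ (j : ℕ) then wsq a j else 0) ^ 2 :=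
          Finset.sum_le_sum fun j _ => e1 j
      _ ≤ ∑ j : Fin n, 9 ^ d * (ε ^ 2 * σ * if M ≤ (j : ℕ) then wsq a j else 0) := by
          refine Finset.sum_le_sum fun j _ => mul_le_mul_of_nonneg_left ?_ hK.le
          split_ifs with hj
          · rw [sq]
            exact mul_le_mul_of_nonneg_right (hM j hj) (wsq_nonneg a j)
          · simp
      _ = 9 ^ d * ε ^ 2 * σ ^ 2 := by
          rw [← Finset.mul_sum, ← Finset.mul_sum, ← Finset.sum_filter]
          change 9 ^ d * (ε ^ 2 * σ * σ) = _
          ring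
  have hVm : Measurable fun x : Fin n → ℝ => ∑ j, wsq (restCoeff a M x) j := by
    simp_rw [hV]
    have := fun J => measurable_mlEval (fiberCoeff a M J)
    fun_prop
  have hWm : Measurable fun x : Fin n → ℝ => ∑ j, wsq (restCoeff a M x) j ^ 2 := by
    simp_rw [hw]
    have := fun J => measurable_mlEval (fiberCoeff a M J)
    fun_prop
  have hVi : ∀ m : ℕ, Integrable (fun x => (∑ j, wsq (restCoeff a M x) j) ^ m) μ := by
    intro m
    simp_rw [hV]
    exact integrable_sum_mlEval_sq _ univ _ _ m
  have hmain := measureReal_second_moment_diff (K := 9 ^ d) (r := 9 ^ d * ε ^ 2 * σ ^ 2) hVm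
    (by simpa using hVi 1) (hVi 2) (by rwa [hEV]) hK (by rwa [hEV])
    (fun x => Finset.sum_nonneg fun j _ => sq_nonneg (wsq (restCoeff a M x) j))
    (integrable_finsetSum _ fun j _ => hwint j) (by positivity) hEW
  refine ⟨_, (measurableSet_le measurable_const hVm).diff (measurableSet_le measurable_const hWm),
    hmain, fun x hx => hR ε h0 h1 n _ (ha.restCoeff M x) ?_⟩
  obtain ⟨hx1, hx2⟩ := hx
  simp only [Set.mem_ofPred_eq, not_le, hEV] at hx1 hx2
  refine hx2.le.trans ?_
  have h81 : (81 : ℝ) ^ d = 9 ^ d * 9 ^ d := by rw [← mul_pow]; norm_num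
  rw [h81]
  have h2 := pow_le_pow_left₀ (by positivity) hx1 2
  calc 8 * 9 ^ d * (9 ^ d * ε ^ 2 * σ ^ 2)
      = 32 * (9 ^ d * 9 ^ d) * ε ^ 2 * (σ / 2) ^ 2 := by ring
    _ ≤ _ := by gcongr

/-- If the unrestricted variables carry little weight then the restricted function is nearly
constant with constant probability. -/
lemma exists_restriction_of_sigmaSq_le {d : ℕ} (hd : 1 ≤ d) {ε : ℝ} (h0 : 0 < ε)
    (h1 : 2 * d * ε ≤ 1) {n : ℕ} {a : Finset (Fin n) → ℝ} {M : ℕ} (ha : DegLE a d)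
    (hpos : 0 < ∑ i, wsq a i) (hM : sigmaSq a M ≤ ε * ∑ i, wsq a i) :
    ∃ G : Set (Fin n → ℝ), MeasurableSet G ∧
      1 / (8 * 9 ^ d) ≤ (Measure.pi (fun _ : Fin n => rad)).real G ∧
      ∀ x ∈ G, noiseSens ε (fun y => decide (0 ≤ mlEval (restCoeff a M x) (fun i => pmOne (y i))))
        ≤ (4 + 16 * d) * (32 * d * 9 ^ d) * ε := by
  set μ := Measure.pi (fun _ : Fin n => rad)
  set S := ∑ i, wsq a i
  have hdR : (1 : ℝ) ≤ d := by exact_mod_cast hd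
  have hε1 : ε < 1 := by nlinarith
  have hK : (0 : ℝ) < 9 ^ d := by positivity
  set h := mlEval (fiberCoeff a M ∅) with hh
  have hb0 : ∀ x : Fin n → ℝ, restCoeff a M x ∅ = h x := fun x => restCoeff_eq_mlEval a M x ∅
  have hT : ∀ x : Fin n → ℝ, ∑ J, dropConst (restCoeff a M x) J ^ 2
      = ∑ J : Finset (Fin n), (if J ≠ ∅ then 1 else 0) * mlEval (fiberCoeff a M J) x ^ 2 := by
    intro x
    refine Finset.sum_congr rfl fun J _ => ?_
    rw [dropConst, restCoeff_eq_mlEval]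
    by_cases hJ : J = ∅ <;> simp [hJ]
  have hTi : Integrable (fun x => ∑ J, dropConst (restCoeff a M x) J ^ 2) μ := by
    simp_rw [hT]
    simpa using integrable_sum_mlEval_sq (fun _ : Fin n => rad) univ
      (fun J : Finset (Fin n) => if J ≠ ∅ then (1 : ℝ) else 0) (fiberCoeff a M) 1
  have hTm : Measurable fun x : Fin n → ℝ => ∑ J, dropConst (restCoeff a M x) J ^ 2 := by
    simp_rw [hT]
    have := fun J => measurable_mlEval (fiberCoeff a M J)
    fun_prop
  set T := ∑ J : Finset (Fin n), (if J ≠ ∅ then 1 else 0) * ∑ L, fiberCoeff a M J L ^ 2 with hTd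
  have hET : ∫ x, ∑ J, dropConst (restCoeff a M x) J ^ 2 ∂μ = T := by
    simp_rw [hT]
    rw [integral_sum_mlEval_sq]
  have hTσ : T ≤ ε * S := by
    refine le_trans ?_ hM
    rw [sigmaSq, Finset.sum_filter, ← Finset.sum_congr rfl fun j _ => sum_wsq_fiberCoeff a M j,
      Finset.sum_comm]
    refine Finset.sum_le_sum fun J _ => ?_
    rw [Finset.sum_ite_mem, Finset.univ_inter, Finset.sum_const, nsmul_eq_mul]
    refine mul_le_mul_of_nonneg_right ?_ (Finset.sum_nonneg fun _ _ => sq_nonneg _)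
    split_ifs with hJ
    · exact_mod_cast Finset.card_pos.2 (Finset.nonempty_iff_ne_empty.2 hJ)
    · positivity
  have hEh : ∫ x, h x ^ 2 ∂μ = ∑ L, fiberCoeff a M ∅ L ^ 2 := integral_mlEval_sq _ _
  have hEh4 : ∫ x, (h x ^ 2) ^ 2 ∂μ ≤ 9 ^ d * (∫ x, h x ^ 2 ∂μ) ^ 2 := by
    rw [hEh]
    simp_rw [← pow_mul]
    exact hypercontractive _ (ha.fiberCoeff M ∅)
  have hsum : ∑ I, a I ^ 2 = ∑ L, fiberCoeff a M ∅ L ^ 2 + T := by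
    have e1 := sum_sum_sq_fiberCoeff a M fun _ => True
    simp only [if_true] at e1
    have e2 : ∑ J : Finset (Fin n), (if J = ∅ then ∑ L, fiberCoeff a M J L ^ 2 else 0)
        = ∑ L, fiberCoeff a M ∅ L ^ 2 := by simp
    rw [← e1, ← e2, hTd, ← Finset.sum_add_distrib]
    refine Finset.sum_congr rfl fun J _ => ?_
    by_cases hJ : J = ∅ <;> simp [hJ]
  have hlow : S ≤ 2 * d * ∫ x, h x ^ 2 ∂μ := by
    have e1 : S ≤ d * ∑ I, a I ^ 2 := by
      refine (sum_wsq_le ha).trans (mul_le_mul_of_nonneg_left ?_ (by positivity))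
      rw [sum_sq_dropConst a]
      linarith [sq_nonneg (a ∅)]
    rw [hEh]
    rw [hsum] at e1
    have e2 : d * T ≤ d * (ε * S) := mul_le_mul_of_nonneg_left hTσ (by positivity)
    nlinarith
  have hEpos : 0 < ∫ x, h x ^ 2 ∂μ := by
    by_contra hc
    nlinarith [not_lt.1 hc]
  have hmain := measureReal_second_moment_diff (K := 9 ^ d) (r := ε * S)
    ((measurable_mlEval (fiberCoeff a M ∅)).pow_const 2) (integrable_mlEval_pow _ _ 2)
    (by simpa only [← pow_mul] using integrable_mlEval_pow _ _ (2 * 2)) hEpos hK hEh4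
    (fun x => Finset.sum_nonneg fun J _ => sq_nonneg (dropConst (restCoeff a M x) J))
    hTi (by positivity) (hET.trans_le hTσ)
  refine ⟨_, (measurableSet_le measurable_const
    ((measurable_mlEval (fiberCoeff a M ∅)).pow_const 2)).diff
    (measurableSet_le measurable_const hTm), hmain, fun x hx => ?_⟩
  obtain ⟨hx1, hx2⟩ := hx
  simp only [Set.mem_ofPred_eq, not_le] at hx1 hx2
  have hh2 : S ≤ 4 * d * h x ^ 2 := by
    have : 4 * d * ((∫ x, h x ^ 2 ∂μ) / 2) ≤ 4 * d * h x ^ 2 := by gcongr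
    linarith
  have hhp : 0 < h x ^ 2 := by
    by_contra hc
    nlinarith [not_lt.1 hc]
  refine (noiseSens_le_of_const h0 hε1 (ha.restCoeff M x) ?_).trans ?_
  · rw [hb0]; exact fun hz => by simp [hz] at hhp
  · rw [hb0, div_le_iff₀ hhp]
    calc _ ≤ (4 + 16 * (d : ℝ)) * (8 * 9 ^ d * (ε * S)) := by gcongr
      _ ≤ (4 + 16 * (d : ℝ)) * (8 * 9 ^ d * (ε * (4 * d * h x ^ 2))) := by gcongr
      _ = _ := by ring

lemma sigmaSq_zero {n : ℕ} (a : Finset (Fin n) → ℝ) : sigmaSq a 0 = ∑ i, wsq a i := by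
  simp [sigmaSq]

lemma sigmaSq_succ {n : ℕ} (a : Finset (Fin n) → ℝ) (k : Fin n) :
    sigmaSq a k = wsq a k + sigmaSq a (k + 1) := by
  unfold sigmaSq
  rw [← Finset.add_sum_erase _ _ (show k ∈ univ.filter (fun j : Fin n => (k : ℕ) ≤ j) by simp)]
  congr 2
  ext j
  simp only [Finset.mem_erase, Finset.mem_filter, Finset.mem_univ, true_and, ne_eq, Fin.ext_iff]
  omega

lemma critIndex_spec {n : ℕ} (a : Finset (Fin n) → ℝ) (ε : ℝ) (j : Fin n)
    (hj : critIndex a ε ≤ (j : ℕ)) : wsq a j ≤ ε ^ 2 * sigmaSq a (critIndex a ε) :=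
  Nat.sInf_mem (s := {k : ℕ | ∀ j : Fin n, k ≤ (j : ℕ) → wsq a j ≤ ε ^ 2 * sigmaSq a k})
    ⟨n, fun j hj => absurd hj (by omega)⟩ j hj

lemma exists_of_lt_critIndex {n : ℕ} {a : Finset (Fin n) → ℝ} {ε : ℝ} {k : ℕ}
    (hk : k < critIndex a ε) : ∃ j : Fin n, k ≤ (j : ℕ) ∧ ε ^ 2 * sigmaSq a k < wsq a j := by
  have h := Nat.notMem_of_lt_sInf hk
  simp only [Set.mem_ofPred_eq] at h
  push Not at h
  exact h

/-- Before the critical index the tail weights decay geometrically. -/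
lemma sigmaSq_le_pow {n : ℕ} {a : Finset (Fin n) → ℝ} (ho : OrderedWeights a) {ε : ℝ}
    (hε : ε ^ 2 ≤ 1) {k : ℕ} (hk : k ≤ critIndex a ε) :
    sigmaSq a k ≤ (1 - ε ^ 2) ^ k * ∑ i, wsq a i := by
  induction k with
  | zero => simp [sigmaSq_zero]
  | succ k ih =>
    obtain ⟨j, hkj, hj⟩ := exists_of_lt_critIndex hk
    have h1 := sigmaSq_succ a ⟨k, hkj.trans_lt j.isLt⟩
    have h2 := ho ⟨k, hkj.trans_lt j.isLt⟩ j hkj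
    simp only at h1
    calc sigmaSq a (k + 1) ≤ (1 - ε ^ 2) * sigmaSq a k := by linarith
      _ ≤ (1 - ε ^ 2) * ((1 - ε ^ 2) ^ k * ∑ i, wsq a i) :=
          mul_le_mul_of_nonneg_left (ih (by omega)) (by linarith)
      _ = _ := by ring

lemma sigmaSq_le_mul_of_ceil_le_critIndex {n : ℕ} {a : Finset (Fin n) → ℝ} (ho : OrderedWeights a)
    {ε : ℝ} (h0 : 0 < ε) (h1 : ε < 1) (hk : ⌈Real.log (1 / ε) / ε ^ 2⌉₊ ≤ critIndex a ε) :
    0 < ∑ i, wsq a i ∧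
      sigmaSq a ⌈Real.log (1 / ε) / ε ^ 2⌉₊ ≤ ε * ∑ i, wsq a i := by
  have hε2 : ε ^ 2 ≤ 1 := pow_le_one₀ h0.le h1.le
  have hlog : 0 < Real.log (1 / ε) := Real.log_pos (by rw [lt_div_iff₀ h0]; linarith)
  have hS : 0 ≤ ∑ i, wsq a i := Finset.sum_nonneg fun i _ => wsq_nonneg a i
  set m := ⌈Real.log (1 / ε) / ε ^ 2⌉₊
  constructor
  · have hm : 0 < m := Nat.ceil_pos.2 (by positivity)
    obtain ⟨j, -, hj⟩ := exists_of_lt_critIndex (hm.trans_le hk)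
    rw [sigmaSq_zero] at hj
    have : wsq a j ≤ ∑ i, wsq a i :=
      Finset.single_le_sum (fun i _ => wsq_nonneg a i) (Finset.mem_univ j)
    exact (by positivity : 0 ≤ ε ^ 2 * ∑ i, wsq a i).trans_lt (hj.trans_le this)
  · refine (sigmaSq_le_pow ho hε2 hk).trans (mul_le_mul_of_nonneg_right ?_ hS)
    calc (1 - ε ^ 2) ^ m ≤ Real.exp (-ε ^ 2) ^ m :=
          pow_le_pow_left₀ (by linarith) (by linarith [Real.add_one_le_exp (-ε ^ 2)]) m
      _ = Real.exp (-(m * ε ^ 2)) := by rw [← Real.exp_nat_mul]; ring_nf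
      _ ≤ Real.exp (-Real.log (1 / ε)) := by
          refine Real.exp_le_exp.2 (neg_le_neg ?_)
          exact (div_le_iff₀ (by positivity)).1 (Nat.le_ceil _)
      _ = ε := by rw [one_div, Real.log_inv, neg_neg, Real.exp_log h0]

lemma wsq_sub_const {n : ℕ} (a : Finset (Fin n) → ℝ) (θ : ℝ) :
    wsq (fun I => a I - if I = ∅ then θ else 0) = wsq a := by
  ext i
  refine Finset.sum_congr rfl fun I hI => ?_
  dsimp only
  rw [if_neg (Finset.ne_empty_of_mem (Finset.mem_filter.1 hI).2), sub_zero]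

lemma mlEval_sub_const {n : ℕ} (a : Finset (Fin n) → ℝ) (θ : ℝ) (x : Fin n → ℝ) :
    mlEval (fun I => a I - if I = ∅ then θ else 0) x = mlEval a x - θ := by
  simp only [mlEval, sub_mul, Finset.sum_sub_distrib, ite_mul, zero_mul, Finset.sum_ite_eq',
    Finset.mem_univ, if_true, Finset.prod_empty, mul_one]

lemma DegLE.sub_const {n d : ℕ} {a : Finset (Fin n) → ℝ} (h : DegLE a d) (θ : ℝ) :
    DegLE (fun I => a I - if I = ∅ then θ else 0) d := by
  intro I hI
  by_cases hI0 : I = ∅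
  · simp [hI0]
  · exact h I (by simpa [hI0] using hI)

/-- Lemma 6.4: for each `d ≥ 1` there are constants `c_d, Δ_d ∈ ℕ` and
`α_d ∈ (0,1)` such that for `f = sign(P - θ)` and `M = min(K(P,ε), c_d log(1/ε)/ε²)`, a
uniformly random restriction of the first `M` variables yields a function with
`NS_ε ≤ Δ_d ε^{1/(2d+2)}`, with probability at least `α_d`. -/
theorem random_restriction_noise_sensitivity (d : ℕ) (hd : 1 ≤ d) :
    ∃ (cd Δd : ℕ) (αd : ℝ), 0 < αd ∧ αd < 1 ∧
      ∀ (ε : ℝ), 0 < ε → ε < 1 →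
        ∀ (n : ℕ) (a : Finset (Fin n) → ℝ) (θ : ℝ), DegLE a d → OrderedWeights a →
          ∀ M : ℕ, M = min (critIndex a ε) ⌈(cd : ℝ) * Real.log (1 / ε) / ε ^ 2⌉₊ →
            αd ≤ (1 / 2 ^ n : ℝ) * ∑ x : Fin n → Bool,
              (if noiseSens ε (fun y : Fin n → Bool =>
                    decide (0 ≤ mlEval a
                      (fun i => pmOne (if i.val < M then x i else y i)) - θ))
                  ≤ (Δd : ℝ) * ε ^ ((1 : ℝ) / (2 * (d : ℝ) + 2))
                then (1 : ℝ) else 0) := by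
  obtain ⟨C, hC, hR⟩ := exists_restriction_of_tail_le d hd
  have hdR : (1 : ℝ) ≤ d := by exact_mod_cast hd
  have h9 : (1 : ℝ) ≤ 9 ^ d := one_le_pow₀ (by norm_num)
  set D : ℝ := C + (4 + 16 * d) * (32 * d * 9 ^ d) + 2 * d with hD
  refine ⟨1, ⌈D⌉₊, 1 / (8 * 9 ^ d), by positivity, ?_, fun ε h0 h1 n a θ ha ho M hM => ?_⟩
  · rw [div_lt_one (by positivity)]; linarith
  set δ := ε ^ ((1 : ℝ) / (2 * (d : ℝ) + 2)) with hδ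
  have hδ0 : 0 < δ := Real.rpow_pos_of_pos h0 _
  have hεδ : ε ≤ δ := by
    refine (Real.rpow_one ε).symm.trans_le (Real.rpow_le_rpow_of_exponent_ge h0 h1.le ?_)
    rw [div_le_one (by positivity)]
    linarith
  have hDc : D * δ ≤ ⌈D⌉₊ * δ := mul_le_mul_of_nonneg_right (Nat.le_ceil D) hδ0.le
  set b : Finset (Fin n) → ℝ := fun I => a I - if I = ∅ then θ else 0 with hb
  have hbd : DegLE b d := ha.sub_const θ
  have hw : wsq b = wsq a := wsq_sub_const a θ
  have hσ : sigmaSq b = sigmaSq a := by funext k; simp only [sigmaSq, hw]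
  have hcr : critIndex b ε = critIndex a ε := by simp only [critIndex, hw, hσ]
  have hbo : OrderedWeights b := fun i j hij => by rw [hw]; exact ho i j hij
  rw [← hcr, Nat.cast_one, one_mul] at hM
  have hfun : ∀ x : Fin n → Bool,
      (fun y : Fin n → Bool =>
        decide (0 ≤ mlEval a (fun i => pmOne (if i.val < M then x i else y i)) - θ))
      = fun y => decide (0 ≤ mlEval (restCoeff b M fun i => pmOne (x i)) fun i => pmOne (y i)) := by
    intro x
    funext y
    rw [mlEval_restCoeff, hb, mlEval_sub_const]
    simp only [apply_ite pmOne]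
  simp only [hfun]
  have main : ∃ G : Set (Fin n → ℝ), MeasurableSet G ∧
      1 / (8 * 9 ^ d) ≤ (Measure.pi (fun _ : Fin n => rad)).real G ∧
      ∀ x ∈ G, noiseSens ε
        (fun y => decide (0 ≤ mlEval (restCoeff b M x) (fun i => pmOne (y i)))) ≤ D * δ := by
    by_cases hε : 2 * d * ε ≤ 1
    · rcases le_total (critIndex b ε) ⌈Real.log (1 / ε) / ε ^ 2⌉₊ with hle | hle
      · rw [min_eq_left hle] at hM
        obtain ⟨G, hG, hG1, hG2⟩ := hR ε h0 h1 n b M hbd (hM ▸ critIndex_spec b ε)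
        refine ⟨G, hG, hG1, fun x hx => (hG2 x hx).trans ?_⟩
        gcongr
        rw [hD, add_assoc]
        exact le_add_of_nonneg_right (by positivity)
      · rw [min_eq_right hle] at hM
        obtain ⟨hpos, hS⟩ := sigmaSq_le_mul_of_ceil_le_critIndex hbo h0 h1 hle
        obtain ⟨G, hG, hG1, hG2⟩ :=
          exists_restriction_of_sigmaSq_le hd h0 hε hbd hpos (hM ▸ hS)
        refine ⟨G, hG, hG1, fun x hx => (hG2 x hx).trans ?_⟩
        have hp : 0 ≤ (4 + 16 * (d : ℝ)) * (32 * d * 9 ^ d) := by positivity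
        refine mul_le_mul ?_ hεδ h0.le (by positivity)
        rw [hD]
        linarith
    · refine ⟨Set.univ, MeasurableSet.univ, ?_, fun x _ => (noiseSens_le_one h0 h1 _).trans ?_⟩
      · rw [probReal_univ, div_le_one (by positivity)]
        linarith
      · calc (1 : ℝ) ≤ 2 * d * ε := (not_le.1 hε).le
          _ ≤ D * δ := by
            refine mul_le_mul ?_ hεδ h0.le (by positivity)
            rw [hD]
            exact le_add_of_nonneg_left (by positivity)
  obtain ⟨G, hG, hG1, hG2⟩ := main
  refine hG1.trans ?_
  rw [rad_real_eq hG]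
  refine mul_le_mul_of_nonneg_left (Finset.sum_le_sum fun x _ => ?_) (by positivity)
  by_cases hx : (fun i => pmOne (x i)) ∈ G
  · rw [if_pos hx, if_pos ((hG2 _ hx).trans hDc)]
  · rw [if_neg hx]
    split_ifs <;> norm_num

end
end

section
/- Let d ≥ 1, δ ∈ (0,1), and let S = (s_1,…,s_n) be a multiset over [n] with |S| = Σ_i s_i = d. For x ∈ R^n, let H_S(x) = Π_{i=1}^n H_{s_i}(x_i), where H_k is the normalized probabilists' Hermite polynomial of degree k. Let X, Y be independent standard Gaussian vectors on R^n and Z = (1-δ)·X + √(2δ-δ²)·Y. If d^{3/2}·√(2δ) ≤ 1/2, then E[ |H_S(Z) − H_S(X)| ] ≤ 2·d^{3/2}·√(2δ). -/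
open Finset MeasureTheory ProbabilityTheory
open scoped Classical

noncomputable section

lemma integrable_eval_gaussianReal (p : Polynomial ℝ) :
    Integrable (fun x => p.eval x) (gaussianReal 0 1) := by
  simp only [Polynomial.eval_eq_sum, Polynomial.sum_def]
  refine integrable_finsetSum _ fun n _ => Integrable.const_mul ?_ _
  have h := (memLp_id_gaussianReal (μ := 0) (v := 1) (n : NNReal)).integrable_norm_pow'
  refine (integrable_norm_iff (by fun_prop)).1 ?_
  simpa [norm_pow] using h

lemma memLp_two_eval_gaussianReal (p : Polynomial ℝ) :
    MemLp (fun x => p.eval x) 2 (gaussianReal 0 1) := by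
  refine (memLp_two_iff_integrable_sq p.continuous.aestronglyMeasurable).2 ?_
  have h := integrable_eval_gaussianReal (p ^ 2)
  simp only [Polynomial.eval_pow] at h
  exact h

lemma hasDerivAt_gaussianPDFReal (x : ℝ) :
    HasDerivAt (gaussianPDFReal 0 1) (-x * gaussianPDFReal 0 1 x) x := by
  have h : HasDerivAt (fun y : ℝ => -(y - 0) ^ 2 / (2 * ((1 : NNReal) : ℝ))) (-x) x := by
    have := (((hasDerivAt_id x).pow 2).neg).div_const 2
    convert! this using 1
    · ext y; simp
    · simp; ring
  have := (h.exp).const_mul (Real.sqrt (2 * Real.pi * ((1 : NNReal) : ℝ)))⁻¹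
  convert! this using 1
  simp only [gaussianPDFReal]
  ring

lemma integrable_gaussianPDFReal_mul_eval (p : Polynomial ℝ) :
    Integrable (fun x => gaussianPDFReal 0 1 x * p.eval x) := by
  have h := integrable_eval_gaussianReal p
  rw [gaussianReal_of_var_ne_zero 0 one_ne_zero,
    integrable_withDensity_iff_integrable_smul' (measurable_gaussianPDF _ _)
      (ae_of_all _ fun _ => gaussianPDF_lt_top)] at h
  simpa [toReal_gaussianPDF] using h

/-- Gaussian integration by parts for polynomials. -/
lemma integral_mul_eval_gaussianReal (p : Polynomial ℝ) :
    ∫ x, x * p.eval x ∂(gaussianReal 0 1) = ∫ x, p.derivative.eval x ∂(gaussianReal 0 1) := by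
  have hX := integrable_eval_gaussianReal (Polynomial.X * p)
  simp only [Polynomial.eval_mul, Polynomial.eval_X] at hX
  rw [← sub_eq_zero, ← integral_sub hX (integrable_eval_gaussianReal _),
    integral_gaussianReal_eq_integral_smul one_ne_zero, ← neg_eq_zero, ← integral_neg]
  refine integral_eq_zero_of_hasDerivAt_of_integrable
    (f := fun x => gaussianPDFReal 0 1 x * p.eval x) (fun x => ?_) ?_
    (integrable_gaussianPDFReal_mul_eval p)
  · convert! (hasDerivAt_gaussianPDFReal x).mul (p.hasDerivAt x) using 1
    simp only [smul_eq_mul]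
    ring
  · have := (integrable_gaussianPDFReal_mul_eval (Polynomial.X * p - p.derivative)).neg
    simpa [Pi.neg_def] using this

/-- The probabilists' Hermite polynomial with real coefficients. -/
def realHermite (k : ℕ) : Polynomial ℝ := (Polynomial.hermite k).map (Int.castRingHom ℝ)

lemma realHermite_succ (k : ℕ) :
    realHermite (k + 1) =
      Polynomial.X * realHermite k - Polynomial.derivative (realHermite k) := by
  simp [realHermite, Polynomial.hermite_succ, Polynomial.derivative_map]

lemma derivative_realHermite_succ (k : ℕ) :
    Polynomial.derivative (realHermite (k + 1)) = ((k + 1 : ℕ) : Polynomial ℝ) * realHermite k := by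
  induction k with
  | zero => simp [realHermite]
  | succ k ih =>
    rw [realHermite_succ (k + 1), Polynomial.derivative_sub, Polynomial.derivative_mul, ih]
    simp only [Polynomial.derivative_X, Polynomial.derivative_mul, Polynomial.derivative_natCast]
    rw [realHermite_succ k]
    push_cast
    ring

lemma normHermite_eq (k : ℕ) (x : ℝ) :
    normHermite k x = (realHermite k).eval x / Real.sqrt (Nat.factorial k) := by
  rw [normHermite, realHermite, Polynomial.eval_map, Polynomial.aeval_def]
  rfl

lemma integral_realHermite_succ_mul (k : ℕ) (p : Polynomial ℝ) :
    ∫ x, (realHermite (k + 1)).eval x * p.eval x ∂(gaussianReal 0 1)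
      = ∫ x, (realHermite k).eval x * p.derivative.eval x ∂(gaussianReal 0 1) := by
  have h := integral_mul_eval_gaussianReal (realHermite k * p)
  have hX := integrable_eval_gaussianReal (Polynomial.X * (realHermite k * p))
  have hD := integrable_eval_gaussianReal (Polynomial.derivative (realHermite k) * p)
  have hE := integrable_eval_gaussianReal (realHermite k * Polynomial.derivative p)
  simp only [Polynomial.derivative_mul, Polynomial.eval_add, Polynomial.eval_mul,
    Polynomial.eval_X] at h hX hD hE
  rw [integral_add hD hE] at h
  rw [← sub_eq_iff_eq_add', ← integral_sub hX hD] at h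
  rw [← h]
  congr with x
  simp only [realHermite_succ, Polynomial.eval_sub, Polynomial.eval_mul, Polynomial.eval_X]
  ring

lemma integral_realHermite_sq (k : ℕ) :
    ∫ x, (realHermite k).eval x * (realHermite k).eval x ∂(gaussianReal 0 1)
      = (Nat.factorial k : ℝ) := by
  induction k with
  | zero => simp [realHermite]
  | succ k ih =>
    rw [integral_realHermite_succ_mul, derivative_realHermite_succ, Nat.factorial_succ,
      Nat.cast_mul, ← ih, ← integral_const_mul]
    congr with x
    simp only [Polynomial.eval_mul, Polynomial.eval_natCast]
    ring

/-- The Gaussian noise operator acts diagonally on Hermite polynomials. -/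
lemma integral_realHermite_noise {a b : ℝ} (hab : a ^ 2 + b ^ 2 = 1) (k : ℕ) (x : ℝ) :
    ∫ y, (realHermite k).eval (a * x + b * y) ∂(gaussianReal 0 1)
      = a ^ k * (realHermite k).eval x := by
  have hcomp (p : Polynomial ℝ) (y : ℝ) : p.eval (a * x + b * y) =
      (p.comp (Polynomial.C (a * x) + Polynomial.C b * Polynomial.X)).eval y := by
    simp
  have hint (p : Polynomial ℝ) :
      Integrable (fun y => p.eval (a * x + b * y)) (gaussianReal 0 1) := by
    simp only [hcomp]
    exact integrable_eval_gaussianReal _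
  have hparts (p : Polynomial ℝ) : ∫ y, y * p.eval (a * x + b * y) ∂(gaussianReal 0 1)
      = b * ∫ y, p.derivative.eval (a * x + b * y) ∂(gaussianReal 0 1) := by
    simp only [hcomp, integral_mul_eval_gaussianReal]
    rw [← integral_const_mul]
    congr with y
    simp [Polynomial.derivative_comp]
  have hstep (k : ℕ) : ∫ y, (realHermite (k + 1)).eval (a * x + b * y) ∂(gaussianReal 0 1)
      = a * x * ∫ y, (realHermite k).eval (a * x + b * y) ∂(gaussianReal 0 1)
        - a ^ 2 * ∫ y, (realHermite k).derivative.eval (a * x + b * y) ∂(gaussianReal 0 1) := by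
    have hy : Integrable (fun y => y * (realHermite k).eval (a * x + b * y))
        (gaussianReal 0 1) := by
      have h := integrable_eval_gaussianReal (Polynomial.X *
        ((realHermite k).comp (Polynomial.C (a * x) + Polynomial.C b * Polynomial.X)))
      simp only [Polynomial.eval_mul, Polynomial.eval_X, ← hcomp] at h
      exact h
    have h : ∀ y, (realHermite (k + 1)).eval (a * x + b * y)
        = (a * x * (realHermite k).eval (a * x + b * y)
          + b * (y * (realHermite k).eval (a * x + b * y)))
          - (realHermite k).derivative.eval (a * x + b * y) := fun y => by
      simp only [realHermite_succ, Polynomial.eval_sub, Polynomial.eval_mul, Polynomial.eval_X]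
      ring
    have hadd : Integrable (fun y => a * x * (realHermite k).eval (a * x + b * y)
        + b * (y * (realHermite k).eval (a * x + b * y))) (gaussianReal 0 1) :=
      ((hint _).const_mul _).add (hy.const_mul _)
    simp only [h]
    rw [integral_sub hadd (hint _),
      integral_add ((hint _).const_mul _) (hy.const_mul _), integral_const_mul,
      integral_const_mul, hparts]
    linear_combination (∫ y, (realHermite k).derivative.eval (a * x + b * y) ∂(gaussianReal 0 1))
      * hab
  induction k using Nat.strong_induction_on with
  | _ k ih =>
    match k, ih with
    | 0, _ => simp [realHermite]
    | 1, ih =>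
      rw [hstep 0, ih 0 (by simp)]
      simp [realHermite]
    | k + 2, ih =>
      rw [hstep (k + 1), ih (k + 1) (by simp), realHermite_succ (k + 1),
        derivative_realHermite_succ]
      simp only [Polynomial.eval_sub, Polynomial.eval_mul, Polynomial.eval_natCast,
        Polynomial.eval_X, integral_const_mul, ih k (by simp)]
      ring

lemma measurePreserving_gaussianReal_rotation {a b : ℝ} (hab : a ^ 2 + b ^ 2 = 1) :
    MeasurePreserving (fun q : ℝ × ℝ => a * q.1 + b * q.2)
      ((gaussianReal 0 1).prod (gaussianReal 0 1)) (gaussianReal 0 1) := by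
  refine ⟨by fun_prop, ?_⟩
  have h : (fun q : ℝ × ℝ => a * q.1 + b * q.2)
      = (fun q : ℝ × ℝ => q.1 + q.2) ∘ Prod.map (a * ·) (b * ·) := rfl
  rw [h, ← Measure.map_map (by fun_prop) (by fun_prop),
    ← Measure.map_prod_map _ _ (by fun_prop) (by fun_prop), gaussianReal_map_const_mul,
    gaussianReal_map_const_mul]
  change Measure.conv _ _ = _
  rw [gaussianReal_conv_gaussianReal]
  congr 1
  · simp
  · ext
    simpa using hab

lemma memLp_two_normHermite (k : ℕ) : MemLp (normHermite k) 2 (gaussianReal 0 1) := by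
  have h : normHermite k = fun x => (Real.sqrt (Nat.factorial k))⁻¹ * (realHermite k).eval x := by
    ext x
    rw [normHermite_eq, div_eq_inv_mul]
  rw [h]
  exact (memLp_two_eval_gaussianReal _).const_mul _

lemma integral_normHermite_sq (k : ℕ) :
    ∫ x, normHermite k x * normHermite k x ∂(gaussianReal 0 1) = 1 := by
  have hk : (0 : ℝ) < Nat.factorial k := by positivity
  simp only [normHermite_eq, div_mul_div_comm, Real.mul_self_sqrt hk.le]
  rw [integral_div, integral_realHermite_sq, div_self hk.ne']

lemma integral_normHermite_noise {a b : ℝ} (hab : a ^ 2 + b ^ 2 = 1) (k : ℕ) (x : ℝ) :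
    ∫ y, normHermite k (a * x + b * y) ∂(gaussianReal 0 1) = a ^ k * normHermite k x := by
  simp only [normHermite_eq]
  rw [integral_div, integral_realHermite_noise hab, mul_div_assoc]

lemma integral_normHermite_mul_noise {a b : ℝ} (hab : a ^ 2 + b ^ 2 = 1) (k : ℕ) :
    ∫ q : ℝ × ℝ, normHermite k (a * q.1 + b * q.2) * normHermite k q.1
      ∂((gaussianReal 0 1).prod (gaussianReal 0 1)) = a ^ k := by
  have hU := (memLp_two_normHermite k).comp_measurePreserving
    (measurePreserving_gaussianReal_rotation hab)
  have hV := (memLp_two_normHermite k).comp_measurePreserving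
    (measurePreserving_fst (μ := gaussianReal 0 1) (ν := gaussianReal 0 1))
  refine (integral_prod _ (hU.integrable_mul hV)).trans ?_
  simp only [Pi.mul_apply, Function.comp_apply, integral_mul_const, integral_normHermite_noise hab, mul_assoc, integral_const_mul,
    integral_normHermite_sq, mul_one]

/-- Products over coordinates of functions of the pairs `(x i, y i)` under a product of two
Gaussian measures on `ℝ^n`. -/
lemma integrable_and_integral_prod_gaussn {n : ℕ} (F : Fin n → ℝ × ℝ → ℝ)
    (hF : ∀ i, Integrable (F i) ((gaussianReal 0 1).prod (gaussianReal 0 1))) :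
    Integrable (fun p : (Fin n → ℝ) × (Fin n → ℝ) => ∏ i, F i (p.1 i, p.2 i))
        ((gaussn n).prod (gaussn n)) ∧
      ∫ p : (Fin n → ℝ) × (Fin n → ℝ), ∏ i, F i (p.1 i, p.2 i) ∂((gaussn n).prod (gaussn n))
        = ∏ i, ∫ q, F i q ∂((gaussianReal 0 1).prod (gaussianReal 0 1)) := by
  have hmp := measurePreserving_arrowProdEquivProdArrow ℝ ℝ (Fin n)
    (fun _ => gaussianReal 0 1) (fun _ => gaussianReal 0 1)
  constructor
  · refine (hmp.integrable_comp_emb (MeasurableEquiv.measurableEmbedding _)).1 ?_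
    exact Integrable.fintype_prod hF
  · have h := hmp.integral_comp' (fun p : (Fin n → ℝ) × (Fin n → ℝ) => ∏ i, F i (p.1 i, p.2 i))
    refine h.symm.trans ?_
    exact integral_fintype_prod_eq_prod F

/-- `L¹` bound from an `L²` bound on a probability space. -/
lemma integral_abs_le_of_integral_sq_le {Ω : Type*} [MeasurableSpace Ω] {μ : Measure Ω}
    [IsProbabilityMeasure μ] {f : Ω → ℝ} (hf : Integrable (fun ω => f ω ^ 2) μ) {v : ℝ}
    (hv : 0 < v) (hfv : ∫ ω, f ω ^ 2 ∂μ ≤ v ^ 2) : ∫ ω, |f ω| ∂μ ≤ v := by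
  have hle : ∫ ω, |f ω| ∂μ ≤ ∫ ω, (f ω ^ 2 * (2 * v)⁻¹ + v / 2) ∂μ := by
    refine integral_mono_of_nonneg (ae_of_all _ fun _ => abs_nonneg _)
      ((hf.mul_const _).add (integrable_const _)) (ae_of_all _ fun ω => ?_)
    have h : |f ω| = f ω ^ 2 * (2 * v)⁻¹ + v / 2 - (|f ω| - v) ^ 2 * (2 * v)⁻¹ := by
      rw [sub_sq, sq_abs]
      field_simp
      ring
    have h0 : 0 ≤ (|f ω| - v) ^ 2 * (2 * v)⁻¹ := by positivity
    change |f ω| ≤ f ω ^ 2 * (2 * v)⁻¹ + v / 2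
    linarith
  refine hle.trans ?_
  rw [integral_add (hf.mul_const _) (integrable_const _), integral_mul_const, integral_const]
  have h1 : (∫ ω, f ω ^ 2 ∂μ) * (2 * v)⁻¹ ≤ v ^ 2 * (2 * v)⁻¹ := by gcongr
  have h2 : v ^ 2 * (2 * v)⁻¹ = v / 2 := by field_simp
  simp only [probReal_univ, one_smul]
  linarith

lemma integrable_and_integral_sq_sub_hermite {a b : ℝ} (hab : a ^ 2 + b ^ 2 = 1) {n : ℕ}
    (s : Fin n → ℕ) :
    Integrable (fun p : (Fin n → ℝ) × (Fin n → ℝ) =>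
        ((∏ i, normHermite (s i) (a * p.1 i + b * p.2 i)) - ∏ i, normHermite (s i) (p.1 i)) ^ 2)
        ((gaussn n).prod (gaussn n)) ∧
      ∫ p : (Fin n → ℝ) × (Fin n → ℝ),
        ((∏ i, normHermite (s i) (a * p.1 i + b * p.2 i)) - ∏ i, normHermite (s i) (p.1 i)) ^ 2
        ∂((gaussn n).prod (gaussn n)) = 2 - 2 * a ^ ∑ i, s i := by
  have hrot := measurePreserving_gaussianReal_rotation hab
  have hfst := measurePreserving_fst (μ := gaussianReal 0 1) (ν := gaussianReal 0 1)
  have hU i := (memLp_two_normHermite (s i)).comp_measurePreserving hrot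
  have hV i := (memLp_two_normHermite (s i)).comp_measurePreserving hfst
  obtain ⟨iUU, eUU⟩ := integrable_and_integral_prod_gaussn _
    fun i => (hU i).integrable_mul (hU i)
  obtain ⟨iUV, eUV⟩ := integrable_and_integral_prod_gaussn _
    fun i => (hU i).integrable_mul (hV i)
  obtain ⟨iVV, eVV⟩ := integrable_and_integral_prod_gaussn _
    fun i => (hV i).integrable_mul (hV i)
  have hsq (k : ℕ) {T : ℝ × ℝ → ℝ} (hT : MeasurePreserving T
      ((gaussianReal 0 1).prod (gaussianReal 0 1)) (gaussianReal 0 1)) :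
      ∫ q, normHermite k (T q) * normHermite k (T q)
        ∂((gaussianReal 0 1).prod (gaussianReal 0 1)) = 1 := by
    have hm := ((memLp_two_normHermite k).integrable_mul
      (memLp_two_normHermite k)).aestronglyMeasurable
    rw [← hT.map_eq] at hm
    have h := integral_map hT.aemeasurable hm
    rw [hT.map_eq] at h
    exact h.symm.trans (integral_normHermite_sq k)
  simp only [Pi.mul_apply, Function.comp_apply, hsq _ hrot, hsq _ hfst,
    integral_normHermite_mul_noise hab, prod_const_one, prod_pow_eq_pow_sum,
    prod_mul_distrib] at iUU eUU iUV eUV iVV eVV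
  have hexp (u v : ℝ) : (u - v) ^ 2 = u * u - 2 * (u * v) + v * v := by ring
  simp only [hexp]
  refine ⟨(iUU.sub (iUV.const_mul 2)).add iVV, ?_⟩
  refine (integral_add (iUU.sub (iUV.const_mul 2)) iVV).trans ?_
  rw [integral_sub' iUU (iUV.const_mul 2), integral_const_mul, eUU, eUV, eVV]
  ring

/-- for a multiset `S` of total degree `d` (given by multiplicities
`s : Fin n → ℕ` with `Σ s_i = d`), if `d^{3/2}√(2δ) ≤ 1/2`, then
`E[|H_S(Z) - H_S(X)|] ≤ 2 d^{3/2} √(2δ)`. -/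
theorem hermite_perturbation_bound (n d : ℕ) (hd : 1 ≤ d) (δ : ℝ)
    (hδ0 : 0 < δ) (hδ1 : δ < 1) (s : Fin n → ℕ) (hs : ∑ i, s i = d)
    (hsmall : (d : ℝ) ^ ((3 : ℝ) / 2) * Real.sqrt (2 * δ) ≤ 1 / 2) :
    (∫ p : (Fin n → ℝ) × (Fin n → ℝ),
        |(∏ i, normHermite (s i) ((1 - δ) * p.1 i + Real.sqrt (2 * δ - δ ^ 2) * p.2 i))
          - ∏ i, normHermite (s i) (p.1 i)|
      ∂((gaussn n).prod (gaussn n)))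
      ≤ 2 * (d : ℝ) ^ ((3 : ℝ) / 2) * Real.sqrt (2 * δ) := by
  have hab : (1 - δ) ^ 2 + Real.sqrt (2 * δ - δ ^ 2) ^ 2 = 1 := by
    rw [Real.sq_sqrt (by nlinarith)]
    ring
  have hd' : (1 : ℝ) ≤ d := by exact_mod_cast hd
  have hprob : IsProbabilityMeasure (gaussn n) := by
    unfold gaussn
    infer_instance
  obtain ⟨hint, heq⟩ := integrable_and_integral_sq_sub_hermite hab s
  have hbern : 1 + (d : ℝ) * (-δ) ≤ (1 + -δ) ^ d :=
    one_add_mul_le_pow (by linarith) d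
  have hv : 0 < Real.sqrt (d * (2 * δ)) := by positivity
  refine (integral_abs_le_of_integral_sq_le hint hv ?_).trans ?_
  · rw [heq, hs, Real.sq_sqrt (by positivity), sub_eq_add_neg 1 δ]
    linarith
  · rw [Real.sqrt_mul (by positivity)]
    have h1 : Real.sqrt d ≤ (d : ℝ) ^ ((3 : ℝ) / 2) := by
      rw [Real.sqrt_eq_rpow]
      exact Real.rpow_le_rpow_of_exponent_le hd' (by norm_num)
    have h2 : (0 : ℝ) ≤ (d : ℝ) ^ ((3 : ℝ) / 2) := by positivity
    gcongr
    linarith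

end
end
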